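/- arXiv:1503.06290 — 3 statements merged into one kernel-verified Lean document; each statement's English description precedes it below -/
import Mathlib

section
/- Let ν, μ ∈ ℂ with Re ν < 0 and −1 < Re μ < 1, and let z ∈ ℂ. Then (1/Γ(1−ν−μ)) · [ (∫₀^∞ e^(−z·s − s²/2) s^(−ν−1) ds)·(∫₀^∞ e^(z·t − t²/2) t^(−ν−μ) dt) − (∫₀^∞ e^(z·s − s²/2) s^(−ν−1) ds)·(∫₀^∞ e^(−z·t − t²/2) t^(−ν−μ) dt) ] = (4·z·√π/Γ((1−μ)/2)) · e^(z²/2) · ∫₀^∞ e^((2ν+μ)·t) · (sinh 2t)^(−μ/2) · √(tanh t) · ((Γ(3/2)/(Γ((1+μ)/2)·Γ(1−μ/2))) ∫₀^1 e^(−(z²/2)·tanh(t)·u) · u^((μ−1)/2) · (1−u)^(−μ/2) du) dt. (This is identity (54): D_ν(z)·D_(ν+μ−1)(−z) − D_ν(−z)·D_(ν+μ−1)(z) = (4z√π/(Γ(−ν)Γ((1−μ)/2))) ∫₀^∞ e^((2ν+μ)t) (sinh 2t)^(−μ/2) √(tanh t) · Φ((1+μ)/2, 3/2; −(z²/2) tanh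 t) dt, written with Φ replaced by its Euler integral and each D by its Laplace-integral representation.) -/
open MeasureTheory Complex Set

namespace Nich

lemma intgl_beta {β γ : ℂ} (hβ : -1 < β.re) (hγ : -1 < γ.re) :
    IntegrableOn (fun r : ℝ => (r:ℂ) ^ β * ((1 - r : ℝ) : ℂ) ^ γ) (Ioo 0 1) := by
  have h := Complex.betaIntegral_convergent (u := β + 1) (v := γ + 1)
    (by simp; linarith) (by simp; linarith)
  rw [intervalIntegrable_iff_integrableOn_Ioo_of_le zero_le_one] at h
  simpa using h

lemma beta_eq {β γ : ℂ} (hβ : -1 < β.re) (hγ : -1 < γ.re) :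
    ∫ r in Ioo (0:ℝ) 1, (r:ℂ) ^ β * ((1 - r : ℝ) : ℂ) ^ γ =
      Gamma (β + 1) * Gamma (γ + 1) / Gamma (β + 1 + (γ + 1)) := by
  have h := Complex.Gamma_mul_Gamma_eq_betaIntegral (s := β + 1) (t := γ + 1)
    (by simp; linarith) (by simp; linarith)
  have h0 : Gamma (β + 1 + (γ + 1)) ≠ 0 := Complex.Gamma_ne_zero_of_re_pos (by simp; linarith)
  rw [h, mul_div_cancel_left₀ _ h0, Complex.betaIntegral,
    intervalIntegral.integral_of_le zero_le_one, integral_Ioc_eq_integral_Ioo]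
  simp

lemma cpow_bound (δ : ℂ) {m M : ℝ} (hm : 0 < m) :
    ∃ K : ℝ, ∀ x : ℝ, m ≤ x → x ≤ M → ‖(x:ℂ) ^ δ‖ ≤ K := by
  have hc : ContinuousOn (fun x : ℝ => (x:ℂ) ^ δ) (Icc m M) := by
    intro x hx
    refine ContinuousAt.continuousWithinAt ?_
    have : (x:ℂ) ∈ slitPlane := Or.inl (by simpa using lt_of_lt_of_le hm hx.1)
    exact (Complex.continuous_ofReal.continuousAt).cpow continuousAt_const this
  obtain ⟨K, hK⟩ := isCompact_Icc.exists_bound_of_continuousOn hc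
  exact ⟨K, fun x h1 h2 => hK x ⟨h1, h2⟩⟩

noncomputable def I (β γ δ : ℂ) (S : ℝ) : ℂ :=
  ∫ r in Ioo (0:ℝ) 1, (r:ℂ) ^ β * ((1 - r : ℝ) : ℂ) ^ γ * ((1 + r * S : ℝ) : ℂ) ^ δ

lemma base_lo {r S m : ℝ} (hr : r ∈ Ioo (0:ℝ) 1) (hm1 : m ≤ 1) (hS : m ≤ 1 + S) :
    m ≤ 1 + r * S := by
  have := hr.1; have := hr.2
  nlinarith

lemma intgl_I {β γ δ : ℂ} (hβ : -1 < β.re) (hγ : -1 < γ.re) {S : ℝ} (hS : -1 < S) :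
    IntegrableOn (fun r : ℝ => (r:ℂ) ^ β * ((1 - r : ℝ) : ℂ) ^ γ * ((1 + r * S : ℝ) : ℂ) ^ δ)
      (Ioo 0 1) := by
  obtain ⟨K, hK⟩ := cpow_bound δ (m := min 1 (1 + S)) (M := 1 + |S|) (by
    apply lt_min <;> linarith)
  refine Integrable.mul_bdd (c := K) (intgl_beta hβ hγ) ?_ ?_
  · exact Measurable.aestronglyMeasurable (by fun_prop)
  · filter_upwards [ae_restrict_mem measurableSet_Ioo] with r hr
    apply hK
    · exact base_lo hr (min_le_left _ _) (min_le_right _ _)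
    · have := hr.1; have := hr.2
      have := le_abs_self S
      have := abs_nonneg S
      nlinarith

lemma hasDeriv_I {β γ δ : ℂ} (hβ : -1 < β.re) (hγ : -1 < γ.re) {S : ℝ} (hS : -1 < S) :
    HasDerivAt (I β γ δ) (δ * I (β + 1) γ (δ - 1) S) S := by
  obtain ⟨K, hK⟩ := cpow_bound (δ - 1) (m := min 1 ((1 + S)/2)) (M := 1 + (|S| + (1+S))) (by
    apply lt_min <;> linarith)
  have key := hasDerivAt_integral_of_dominated_loc_of_deriv_le
    (μ := volume.restrict (Ioo (0:ℝ) 1)) (x₀ := S)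
    (F := fun S (r:ℝ) => (r:ℂ) ^ β * ((1 - r : ℝ) : ℂ) ^ γ * ((1 + r * S : ℝ) : ℂ) ^ δ)
    (F' := fun S (r:ℝ) => (r:ℂ) ^ β * ((1 - r : ℝ) : ℂ) ^ γ *
      (δ * ((1 + r * S : ℝ) : ℂ) ^ (δ - 1) * r))
    (s := Ioo (S - (1+S)/2) (S + (1+S)/2))
    (bound := fun r => ‖(r:ℂ) ^ β * ((1 - r : ℝ) : ℂ) ^ γ‖ * (‖δ‖ * K * 1))
    (Ioo_mem_nhds (by linarith) (by linarith))
    (Filter.Eventually.of_forall fun S => Measurable.aestronglyMeasurable (by fun_prop))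
    (intgl_I hβ hγ hS)
    (Measurable.aestronglyMeasurable (by fun_prop))
    ?_ ((intgl_beta hβ hγ).norm.mul_const _) ?_
  · have h2 := key.2
    have : (∫ r in Ioo (0:ℝ) 1, (r:ℂ) ^ β * ((1 - r : ℝ) : ℂ) ^ γ *
      (δ * ((1 + r * S : ℝ) : ℂ) ^ (δ - 1) * r)) = δ * I (β + 1) γ (δ - 1) S := by
      rw [I, ← integral_const_mul]
      refine setIntegral_congr_fun measurableSet_Ioo fun r hr => ?_
      have hr0 : (r:ℂ) ≠ 0 := by exact_mod_cast hr.1.ne'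
      rw [cpow_add _ _ hr0, cpow_one]; ring
    rw [← this]; exact h2
  · filter_upwards [ae_restrict_mem measurableSet_Ioo] with r hr x hx
    rw [norm_mul]
    gcongr
    rw [norm_mul, norm_mul]
    have h1 : ‖((1 + r * x : ℝ) : ℂ) ^ (δ - 1)‖ ≤ K := by
      apply hK
      · exact base_lo hr (min_le_left _ _) ((min_le_right _ _).trans (by linarith [hx.1]))
      · have := hr.1; have := hr.2
        have := le_abs_self S
        have := abs_nonneg S
        have := hx.2
        nlinarith
    have h2 : ‖(r:ℂ)‖ ≤ 1 := by
      rw [Complex.norm_real, Real.norm_eq_abs, abs_of_pos hr.1]; exact hr.2.le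
    have h3 := (norm_nonneg _).trans h1
    gcongr
  · filter_upwards [ae_restrict_mem measurableSet_Ioo] with r hr x hx
    refine HasDerivAt.const_mul _ ?_
    have hpos : 0 < 1 + r * x := by
      refine lt_of_lt_of_le (b := min 1 ((1+S)/2)) (by apply lt_min <;> linarith) ?_
      exact base_lo hr (min_le_left _ _) ((min_le_right _ _).trans (by linarith [hx.1]))
    have hin : HasDerivAt (fun x : ℝ => ((1 + r * x : ℝ) : ℂ)) (r:ℂ) x := by
      have : HasDerivAt (fun x : ℝ => 1 + r * x) r x := by
        simpa using ((hasDerivAt_id x).const_mul r).const_add 1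
      exact this.ofReal_comp
    have hsl : ((1 + r * x : ℝ) : ℂ) ∈ slitPlane := Or.inl (by simpa using hpos)
    have ho := (hasDerivAt_id (((1 + r * x : ℝ) : ℂ))).cpow_const (c := δ) hsl
    have := HasDerivAt.comp x ho hin
    simpa [Function.comp_def] using this

end Nich

namespace Nich

lemma hasDeriv_ofReal_cpow {x : ℝ} (hx : 0 < x) (p : ℂ) :
    HasDerivAt (fun y : ℝ => (y:ℂ) ^ p) (p * (x:ℂ) ^ (p - 1)) x := by
  have hsl : (x : ℂ) ∈ slitPlane := Or.inl (by simpa using hx)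
  have ho := (hasDerivAt_id (x : ℂ)).cpow_const (c := p) hsl
  have := HasDerivAt.comp x ho (hasDerivAt_id x).ofReal_comp
  simpa [Function.comp_def] using this

lemma hasDeriv_cpow {f : ℝ → ℝ} {f' x : ℝ} (hf : HasDerivAt f f' x) (h : 0 < f x) (p : ℂ) :
    HasDerivAt (fun y : ℝ => ((f y : ℝ):ℂ) ^ p) (p * ((f x : ℝ):ℂ) ^ (p - 1) * f') x := by
  have := HasDerivAt.scomp x (hasDeriv_ofReal_cpow h p) hf
  refine this.congr_deriv ?_
  rw [real_smul, mul_comm]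

lemma tendsto_cpow_zero {p : ℂ} (hp : 0 < p.re) {l : Filter ℝ} {f : ℝ → ℝ}
    (hf : Filter.Tendsto f l (nhds 0)) :
    Filter.Tendsto (fun y => ((f y : ℝ) : ℂ) ^ p) l (nhds 0) := by
  have h := (Complex.continuousAt_ofReal_cpow_const 0 p (Or.inl hp)).tendsto.comp hf
  have hp0 : p ≠ 0 := by rintro rfl; simp at hp
  simpa [Function.comp_def, hp0] using h

lemma int3 {m : Measure ℝ} {f g h : ℝ → ℂ} (hf : Integrable f m) (hg : Integrable g m)
    (hh : Integrable h m) : ∫ x, (f x - g x + h x) ∂m =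
      ∫ x, f x ∂m - ∫ x, g x ∂m + ∫ x, h x ∂m := by
  rw [← integral_sub hf hg]
  exact integral_add (hf.sub hg) hh

lemma int3' {m : Measure ℝ} {f g h : ℝ → ℂ} (hf : Integrable f m) (hg : Integrable g m)
    (hh : Integrable h m) : ∫ x, (f x + g x - h x) ∂m =
      ∫ x, f x ∂m + ∫ x, g x ∂m - ∫ x, h x ∂m := by
  rw [← integral_add hf hg]
  exact integral_sub (hf.add hg) hh

lemma tot_deriv {β γ δ : ℂ} (hβ : -1 < β.re) (hγ : -1 < γ.re) {S : ℝ} (hS : -1 < S) :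
    (β + 1) * I β (γ + 1) (δ - 1) S - (γ + 1) * I (β + 1) γ (δ - 1) S +
      (δ - 1) * S * I (β + 1) (γ + 1) (δ - 2) S = 0 := by
  have hb1 : -1 < (β + 1).re := by simp; linarith
  have hg1 : -1 < (γ + 1).re := by simp; linarith
  have i1 := (intgl_I (δ := δ - 1) hβ hg1 hS).const_mul (β + 1)
  have i2 := (intgl_I (δ := δ - 1) hb1 hγ hS).const_mul (γ + 1)
  have i3 := (intgl_I (δ := δ - 2) hb1 hg1 hS).const_mul ((δ - 1) * S)
  have hbase : ∀ r ∈ Ioo (0:ℝ) 1, 0 < 1 + r * S := fun r hr =>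
    lt_of_lt_of_le (b := min 1 (1+S)) (by apply lt_min <;> linarith)
      (base_lo hr (min_le_left _ _) (min_le_right _ _))
  have key := intervalIntegral.integral_eq_sub_of_hasDerivAt_of_tendsto
    (a := 0) (b := 1) zero_lt_one (fa := (0:ℂ)) (fb := 0)
    (f := fun r : ℝ => (r:ℂ) ^ (β + 1) * ((1 - r : ℝ) : ℂ) ^ (γ + 1) *
      ((1 + r * S : ℝ) : ℂ) ^ (δ - 1))
    (f' := fun r : ℝ => (β + 1) * ((r:ℂ) ^ β * ((1 - r : ℝ) : ℂ) ^ (γ + 1) *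
      ((1 + r * S : ℝ) : ℂ) ^ (δ - 1)) - (γ + 1) * ((r:ℂ) ^ (β + 1) * ((1 - r : ℝ) : ℂ) ^ γ *
      ((1 + r * S : ℝ) : ℂ) ^ (δ - 1)) + (δ - 1) * S * ((r:ℂ) ^ (β + 1) *
        ((1 - r : ℝ) : ℂ) ^ (γ + 1) * ((1 + r * S : ℝ) : ℂ) ^ (δ - 2)))
    ?_ ?_ ?_ ?_
  · rw [intervalIntegral.integral_of_le zero_le_one, integral_Ioc_eq_integral_Ioo,
      int3 i1 i2 i3, integral_const_mul, integral_const_mul,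
      integral_const_mul] at key
    simpa [I] using key
  · intro r hr
    have d1 := hasDeriv_ofReal_cpow hr.1 (β + 1)
    have d2 := hasDeriv_cpow (f := fun r => 1 - r) (f' := -1) (x := r)
      (by simpa using (hasDerivAt_id r).const_sub 1) (by simpa using hr.2) (γ + 1)
    have d3 := hasDeriv_cpow (f := fun r => 1 + r * S) (f' := S) (x := r)
      (by simpa using ((hasDerivAt_id r).mul_const S).const_add 1) (hbase r hr) (δ - 1)
    refine ((d1.mul d2).mul d3).congr_deriv ?_
    have e1 : β + 1 - 1 = β := by ring
    have e2 : γ + 1 - 1 = γ := by ring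
    have e3 : δ - 1 - 1 = δ - 2 := by ring
    rw [e1, e2, e3]
    simp only [Pi.mul_apply]
    push_cast
    ring
  · rw [intervalIntegrable_iff_integrableOn_Ioo_of_le zero_le_one]
    exact (i1.sub i2).add i3
  · have t1 : Filter.Tendsto (fun r : ℝ => (r:ℂ) ^ (β + 1)) (nhdsWithin 0 (Ioi 0)) (nhds 0) :=
      tendsto_cpow_zero (f := fun r => r) (by simp; linarith)
        (tendsto_nhdsWithin_of_tendsto_nhds Filter.tendsto_id)
    have c2 : ContinuousAt (fun r : ℝ => ((1 - r : ℝ) : ℂ) ^ (γ + 1) *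
      ((1 + r * S : ℝ) : ℂ) ^ (δ - 1)) 0 := by
      refine ContinuousAt.mul ?_ ?_
      · exact (hasDeriv_cpow (f := fun r => 1 - r) (f' := -1) (x := 0)
          (by simpa using (hasDerivAt_id (0:ℝ)).const_sub 1) (by simp) (γ + 1)).continuousAt
      · exact (hasDeriv_cpow (f := fun r => 1 + r * S) (f' := S) (x := 0)
          (by simpa using ((hasDerivAt_id (0:ℝ)).mul_const S).const_add 1) (by simp)
            (δ - 1)).continuousAt
    have := t1.mul (c2.tendsto.mono_left nhdsWithin_le_nhds)
    simpa [mul_assoc] using this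
  · have t1 : Filter.Tendsto (fun r : ℝ => ((1 - r : ℝ):ℂ) ^ (γ + 1)) (nhdsWithin 1 (Iio 1))
        (nhds 0) := by
      refine tendsto_cpow_zero (f := fun r => 1 - r) (by simp; linarith)
        (tendsto_nhdsWithin_of_tendsto_nhds ?_)
      have : Continuous (fun r : ℝ => 1 - r) := by fun_prop
      simpa using this.tendsto 1
    have c2 : ContinuousAt (fun r : ℝ => (r : ℂ) ^ (β + 1) *
      ((1 + r * S : ℝ) : ℂ) ^ (δ - 1)) 1 := by
      refine ContinuousAt.mul ?_ ?_
      · exact (hasDeriv_ofReal_cpow one_pos _).continuousAt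
      · exact (hasDeriv_cpow (f := fun r => 1 + r * S) (f' := S) (x := 1)
          (by simpa using ((hasDerivAt_id (1:ℝ)).mul_const S).const_add 1)
            (by simp; linarith) (δ - 1)).continuousAt
    have := t1.mul (c2.tendsto.mono_left nhdsWithin_le_nhds)
    simp only [zero_mul] at this
    refine this.congr fun r => ?_
    ring

lemma hyp_ode {β γ δ : ℂ} (hβ : -1 < β.re) (hγ : -1 < γ.re) {S : ℝ} (hS : -1 < S)
    (h1 : β + γ = -1/2) (h2 : δ = β - 1) :
    (S:ℂ) * (1 + S) * (δ * (δ - 1) * I (β + 2) γ (δ - 2) S) +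
      3/2 * (1 + 2 * S) * (δ * I (β + 1) γ (δ - 1) S) - δ * (β + 1) * I β γ δ S = 0 := by
  have hb1 : -1 < (β + 1).re := by simp; linarith
  have hb2 : -1 < (β + 2).re := by simp; linarith
  have hg1 : -1 < (γ + 1).re := by simp; linarith
  have i1 := (intgl_I (δ := δ - 1) hβ hg1 hS).const_mul (β + 1)
  have i2 := (intgl_I (δ := δ - 1) hb1 hγ hS).const_mul (γ + 1)
  have i3 := (intgl_I (δ := δ - 2) hb1 hg1 hS).const_mul ((δ - 1) * S)
  have j1 := (intgl_I (δ := δ - 2) hb2 hγ hS).const_mul ((S:ℂ) * (1 + S) * (δ * (δ - 1)))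
  have j2 := (intgl_I (δ := δ - 1) hb1 hγ hS).const_mul (3/2 * (1 + 2 * (S:ℂ)) * δ)
  have j3 := (intgl_I (δ := δ) hβ hγ hS).const_mul (δ * (β + 1))
  have ht := tot_deriv (δ := δ) hβ hγ hS
  have hbase : ∀ r ∈ Ioo (0:ℝ) 1, 0 < 1 + r * S := fun r hr =>
    lt_of_lt_of_le (b := min 1 (1+S)) (by apply lt_min <;> linarith)
      (base_lo hr (min_le_left _ _) (min_le_right _ _))
  have e : (S:ℂ) * (1 + S) * (δ * (δ - 1)) * I (β + 2) γ (δ - 2) S +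
      3/2 * (1 + 2 * S) * δ * I (β + 1) γ (δ - 1) S - δ * (β + 1) * I β γ δ S =
      -δ * ((β + 1) * I β (γ + 1) (δ - 1) S - (γ + 1) * I (β + 1) γ (δ - 1) S +
      (δ - 1) * S * I (β + 1) (γ + 1) (δ - 2) S) := by
    simp only [I]
    rw [← integral_const_mul, ← integral_const_mul, ← integral_const_mul, ← integral_const_mul,
      ← integral_const_mul, ← integral_const_mul, ← int3' j1 j2 j3, ← int3 i1 i2 i3,
      ← integral_const_mul]
    refine setIntegral_congr_fun measurableSet_Ioo fun r hr => ?_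
    have hr0 : (r:ℂ) ≠ 0 := by exact_mod_cast hr.1.ne'
    have hr1 : ((1 - r : ℝ):ℂ) ≠ 0 := by
      have := hr.2
      exact_mod_cast (by linarith : (0:ℝ) < 1 - r).ne'
    have hr2 : ((1 + r * S : ℝ):ℂ) ≠ 0 := by exact_mod_cast (hbase r hr).ne'
    have p1 : (r:ℂ) ^ (β + 1) = (r:ℂ) ^ β * r := by rw [cpow_add _ _ hr0, cpow_one]
    have p2 : (r:ℂ) ^ (β + 2) = (r:ℂ) ^ β * r ^ 2 := by
      rw [cpow_add _ _ hr0]; norm_cast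
    have p3 : ((1 - r : ℝ):ℂ) ^ (γ + 1) = ((1 - r : ℝ):ℂ) ^ γ * (1 - r) := by
      rw [cpow_add _ _ hr1, cpow_one]; push_cast; rfl
    have p4 : ((1 + r * S : ℝ):ℂ) ^ (δ - 1) = ((1 + r * S : ℝ):ℂ) ^ (δ - 2) * (1 + r * S) := by
      have : δ - 1 = δ - 2 + 1 := by ring
      rw [this, cpow_add _ _ hr2, cpow_one]; push_cast; rfl
    have p5 : ((1 + r * S : ℝ):ℂ) ^ δ = ((1 + r * S : ℝ):ℂ) ^ (δ - 2) * (1 + r * S)^2 := by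
      have : δ = δ - 2 + 2 := by ring
      conv_lhs => rw [this]
      rw [cpow_add _ _ hr2]; push_cast; norm_cast
    rw [p1, p2, p3, p4, p5]
    have hγ' : γ = -1/2 - β := by linear_combination h1
    generalize (r:ℂ) ^ β = a1
    generalize ((1 - r : ℝ):ℂ) ^ γ = a2
    generalize ((1 + r * S : ℝ):ℂ) ^ (δ - 2) = a3
    subst hγ' h2
    ring
  rw [ht] at e
  linear_combination e

lemma euler_hyp {β γ δ b : ℂ} (hβ : -1 < β.re) (hγ : -1 < γ.re)
    (h1 : β + γ = -1/2) (h2 : δ = β - 1) (h3 : b = -2 * β) (hb : b ≠ 0) (θ : ℝ) :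
    b * (Real.sinh θ * Real.cosh θ) * I β γ δ (Real.sinh θ ^ 2) = I β γ δ 0 * sinh (b * θ) := by
  have hb1 : -1 < (β + 1).re := by simp; linarith
  have hS : ∀ θ : ℝ, -1 < Real.sinh θ ^ 2 := fun θ => by nlinarith [sq_nonneg (Real.sinh θ)]
  have dS : ∀ θ : ℝ, HasDerivAt (fun θ => Real.sinh θ ^ 2) (2 * (Real.sinh θ * Real.cosh θ)) θ :=
    fun θ => by
      have := (Real.hasDerivAt_sinh θ).pow 2
      refine this.congr_deriv ?_
      simp; ring
  have dE : ∀ θ : ℝ, HasDerivAt (fun θ : ℝ => I β γ δ (Real.sinh θ ^ 2))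
      (2 * (Real.sinh θ * Real.cosh θ) * (δ * I (β + 1) γ (δ - 1) (Real.sinh θ ^ 2))) θ := fun θ => by
    have := HasDerivAt.scomp θ (hasDeriv_I (δ := δ) hβ hγ (hS θ)) (dS θ)
    refine this.congr_deriv ?_
    simp
  have dE1 : ∀ θ : ℝ, HasDerivAt (fun θ : ℝ => I (β + 1) γ (δ - 1) (Real.sinh θ ^ 2))
      (2 * (Real.sinh θ * Real.cosh θ) * ((δ - 1) * I (β + 2) γ (δ - 2) (Real.sinh θ ^ 2))) θ :=
      fun θ => by
    have := HasDerivAt.scomp θ (hasDeriv_I (δ := δ - 1) hb1 hγ (hS θ)) (dS θ)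
    refine this.congr_deriv ?_
    have e1 : β + 1 + 1 = β + 2 := by ring
    have e2 : δ - 1 - 1 = δ - 2 := by ring
    simp [e1, e2]
  have ds : ∀ θ : ℝ, HasDerivAt (fun θ : ℝ => (Real.sinh θ : ℂ)) (Real.cosh θ : ℂ) θ := fun θ =>
    (Real.hasDerivAt_sinh θ).ofReal_comp
  have dc : ∀ θ : ℝ, HasDerivAt (fun θ : ℝ => (Real.cosh θ : ℂ)) (Real.sinh θ : ℂ) θ := fun θ =>
    (Real.hasDerivAt_cosh θ).ofReal_comp
  set f : ℝ → ℂ := fun θ => (Real.sinh θ : ℂ) * Real.cosh θ * I β γ δ (Real.sinh θ ^ 2) with hf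
  set g : ℝ → ℂ := fun θ => ((Real.cosh θ : ℂ) * Real.cosh θ + (Real.sinh θ : ℂ) * Real.sinh θ) *
      I β γ δ (Real.sinh θ ^ 2) + (Real.sinh θ : ℂ) * Real.cosh θ *
      (2 * (Real.sinh θ * Real.cosh θ) * (δ * I (β + 1) γ (δ - 1) (Real.sinh θ ^ 2))) with hg
  have df : ∀ θ, HasDerivAt f (g θ) θ := fun θ => ((ds θ).mul (dc θ)).mul (dE θ)
  have dg : ∀ θ, HasDerivAt g (b ^ 2 * f θ) θ := fun θ => by
    have q := ((((dc θ).mul (dc θ)).add ((ds θ).mul (ds θ))).mul (dE θ)).add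
      (((ds θ).mul (dc θ)).mul ((((ds θ).mul (dc θ)).const_mul 2).mul ((dE1 θ).const_mul δ)))
    refine q.congr_deriv ?_
    have ode := hyp_ode (δ := δ) hβ hγ (hS θ) h1 h2
    have hcs : (Real.cosh θ : ℂ) ^ 2 = 1 + (Real.sinh θ : ℂ) ^ 2 := by
      have := Real.cosh_sq θ
      norm_cast
      linarith
    simp only [hf, Pi.mul_apply, Pi.add_apply]
    push_cast at ode ⊢
    have hcs' : Complex.cosh θ ^ 2 = 1 + Complex.sinh θ ^ 2 := by
      simpa using hcs
    generalize I β γ δ (Real.sinh θ ^ 2) = E0 at *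
    generalize I (β + 1) γ (δ - 1) (Real.sinh θ ^ 2) = E1 at *
    generalize I (β + 2) γ (δ - 2) (Real.sinh θ ^ 2) = E2 at *
    generalize Complex.cosh θ = C at *
    generalize Complex.sinh θ = s at *
    subst h3 h2
    linear_combination 4 * s * C * ode + s * C * (6 * (β - 1) * E1 + 4 * s ^ 2 * (β - 1) * (β - 1 - 1) * E2) * hcs'
  have hf0 : f 0 = 0 := by simp [hf]
  have hg0 : g 0 = I β γ δ 0 := by simp [hg]
  have de : ∀ (k : ℂ) (θ : ℝ), HasDerivAt (fun θ : ℝ => cexp (k * θ)) (cexp (k * θ) * k) θ :=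
    fun k θ => by
      have : HasDerivAt (fun θ : ℝ => k * (θ:ℂ)) k θ := by
        simpa using ((hasDerivAt_id θ).ofReal_comp).const_mul k
      exact this.cexp
  have c1 : ∀ k : ℂ, k ^ 2 = b ^ 2 → (g θ - k * f θ) * cexp (k * θ) = I β γ δ 0 := by
    intro k hk
    have hd : ∀ θ : ℝ, HasDerivAt (fun θ : ℝ => (g θ - k * f θ) * cexp (k * θ)) 0 θ := fun θ => by
      refine (((dg θ).sub ((df θ).const_mul k)).mul (de k θ)).congr_deriv ?_
      rw [← hk]
      simp only [Pi.sub_apply]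
      ring
    have := is_const_of_deriv_eq_zero (fun θ => (hd θ).differentiableAt)
      (fun θ => (hd θ).deriv) θ 0
    simpa [hf0, hg0] using this
  have k1 := c1 b rfl
  have k2 := c1 (-b) (by ring)
  have hE : cexp (b * θ) * cexp (-b * θ) = 1 := by rw [← Complex.exp_add]; simp
  have : b * f θ = I β γ δ 0 * sinh (b * θ) := by
    rw [Complex.sinh]
    rw [show -(b * (θ:ℂ)) = -b * θ by ring]
    linear_combination (1/2) * cexp (b * θ) * k2 - (1/2) * cexp (-b * θ) * k1 + (- b * f θ) * hE
  rw [← this, hf]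
  push_cast
  ring

end Nich

namespace Nich

lemma integral_symm {h : ℝ → ℂ} (hh : Integrable h) :
    ∫ x, h x = ∫ x in Ioi (0:ℝ), (h x + h (-x)) := by
  rw [integral_add hh.integrableOn hh.comp_neg.integrableOn, integral_comp_neg_Ioi, neg_zero,
    add_comm, intervalIntegral.integral_Iic_add_Ioi hh.integrableOn hh.integrableOn]

lemma intgl_gauss0 (z : ℂ) {q : ℝ} (hq : 0 < q) :
    Integrable (fun v : ℝ => cexp (-(1/(2*q) : ℂ) * v ^ 2 + z * v)) := by
  have := integrable_cexp_quadratic (b := (1/(2*q) : ℂ)) (by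
    rw [show (1/(2*q) : ℂ) = ((1/(2*q) : ℝ) : ℂ) by push_cast; rfl, ofReal_re]; positivity) z 0
  simpa using this

lemma abs_le_exp (v : ℝ) : |v| ≤ Real.exp v + Real.exp (-v) := by
  have h1 := Real.add_one_le_exp v
  have h2 := Real.add_one_le_exp (-v)
  have h3 := Real.exp_pos v
  have h4 := Real.exp_pos (-v)
  rw [abs_le]; constructor <;> linarith

lemma intgl_gauss1 (z : ℂ) {q : ℝ} (hq : 0 < q) :
    Integrable (fun v : ℝ => (v:ℂ) * cexp (-(1/(2*q) : ℂ) * v ^ 2 + z * v)) := by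
  refine Integrable.mono' ((intgl_gauss0 (z + 1) hq).norm.add (intgl_gauss0 (z - 1) hq).norm)
    (Continuous.aestronglyMeasurable (by fun_prop)) (Filter.Eventually.of_forall fun v => ?_)
  have e : ∀ k : ℝ, ‖cexp (-(1/(2*q) : ℂ) * v ^ 2 + (z + k) * v)‖ =
      Real.exp (k * v) * ‖cexp (-(1/(2*q) : ℂ) * v ^ 2 + z * v)‖ := fun k => by
    rw [show -(1/(2*q) : ℂ) * v ^ 2 + (z + k) * v = ((k * v : ℝ) : ℂ) +
      (-(1/(2*q) : ℂ) * v ^ 2 + z * v) by push_cast; ring, Complex.exp_add, norm_mul,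
      Complex.norm_exp_ofReal]
  have e1 := e 1
  have e2 := e (-1)
  simp only [Pi.add_apply]
  push_cast at e1 e2
  rw [e1, sub_eq_add_neg, e2, norm_mul, Complex.norm_real, Real.norm_eq_abs, ← add_mul]
  gcongr
  simpa using abs_le_exp v

lemma sqrt_eq_cpow {x : ℝ} (hx : 0 ≤ x) : ((Real.sqrt x : ℝ) : ℂ) = (x:ℂ) ^ (1/2 : ℂ) := by
  rw [Real.sqrt_eq_rpow, Complex.ofReal_cpow hx]; norm_num

lemma gauss_val0 (z : ℂ) {q : ℝ} (hq : 0 < q) :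
    ∫ v : ℝ, cexp (-(1/(2*q) : ℂ) * v ^ 2 + z * v) =
      ((Real.sqrt (2 * Real.pi * q) : ℝ) : ℂ) * cexp (z ^ 2 * q / 2) := by
  have h := integral_cexp_quadratic (b := -(1/(2*q) : ℂ)) (by
    rw [show -(1/(2*q) : ℂ) = ((-(1/(2*q)) : ℝ) : ℂ) by push_cast; rfl, ofReal_re]
    have : 0 < 1 / (2 * q) := by positivity
    linarith) z 0
  simp only [add_zero] at h
  have hq' : (q:ℂ) ≠ 0 := by exact_mod_cast hq.ne'
  rw [h, sqrt_eq_cpow (by positivity)]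
  congr 2
  · push_cast; field_simp
  · field_simp; ring

lemma gauss_val1 (z : ℂ) {q : ℝ} (hq : 0 < q) :
    ∫ v : ℝ, (v:ℂ) * cexp (-(1/(2*q) : ℂ) * v ^ 2 + z * v) =
      q * z * (((Real.sqrt (2 * Real.pi * q) : ℝ) : ℂ) * cexp (z ^ 2 * q / 2)) := by
  have hq' : (q:ℂ) ≠ 0 := by exact_mod_cast hq.ne'
  have i0 := intgl_gauss0 z hq
  have i1 := intgl_gauss1 z hq
  have hd : ∀ v : ℝ, HasDerivAt (fun v : ℝ => cexp (-(1/(2*q) : ℂ) * v ^ 2 + z * v))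
      (-(1/q:ℂ) * ((v:ℂ) * cexp (-(1/(2*q) : ℂ) * v ^ 2 + z * v)) +
        z * cexp (-(1/(2*q) : ℂ) * v ^ 2 + z * v)) v := fun v => by
    have hv : HasDerivAt (fun v : ℝ => (v:ℂ)) 1 v := (hasDerivAt_id v).ofReal_comp
    have := (((hv.pow 2).const_mul (-(1/(2*q) : ℂ))).add (hv.const_mul z)).cexp
    refine this.congr_deriv ?_
    simp only [Pi.add_apply, Pi.pow_apply]
    field_simp
    push_cast
    ring
  have := integral_eq_zero_of_hasDerivAt_of_integrable hd
    ((i1.const_mul _).add (i0.const_mul _)) i0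
  rw [integral_add (i1.const_mul _) (i0.const_mul _), integral_const_mul, integral_const_mul,
    gauss_val0 z hq] at this
  have h1 : (q:ℂ) * (1 / q) = 1 := by field_simp
  linear_combination (-(q:ℂ)) * this -
    (∫ v : ℝ, (v:ℂ) * cexp (-(1/(2*q) : ℂ) * v ^ 2 + z * v)) * h1

lemma intgl_gauss (z : ℂ) {q : ℝ} (hq : 0 < q) :
    IntegrableOn (fun v : ℝ => (v:ℂ) * sinh (z * v) * cexp (-(1/(2*q) : ℂ) * v ^ 2)) (Ioi 0) := by
  have i1 := ((intgl_gauss1 z hq).sub (intgl_gauss1 (-z) hq)).const_mul (1/2)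
  refine (i1.congr (Filter.Eventually.of_forall fun v => ?_)).integrableOn
  simp only [Pi.sub_apply, Complex.sinh, Complex.exp_add]
  ring_nf

lemma gauss_val (z : ℂ) {q : ℝ} (hq : 0 < q) :
    ∫ v in Ioi (0:ℝ), (v:ℂ) * sinh (z * v) * cexp (-(1/(2*q) : ℂ) * v ^ 2) =
      (1/2) * (q * z * (((Real.sqrt (2 * Real.pi * q) : ℝ) : ℂ) * cexp (z ^ 2 * q / 2))) := by
  rw [← gauss_val1 z hq, integral_symm (intgl_gauss1 z hq), ← integral_const_mul]
  refine setIntegral_congr_fun measurableSet_Ioi fun v hv => ?_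
  simp only [Complex.sinh, Complex.exp_add, ofReal_neg]
  ring_nf

lemma norm_sinh_le (w : ℂ) : ‖sinh w‖ ≤ Real.sinh ‖w‖ := by
  have h1 := Complex.hasSum_sinh w
  have h2 := Real.hasSum_sinh ‖w‖
  have h3 : (fun n : ℕ => ‖w ^ (2 * n + 1) / ((2 * n + 1).factorial : ℂ)‖) =
      fun n : ℕ => ‖w‖ ^ (2 * n + 1) / ((2 * n + 1).factorial : ℝ) := by
    ext n
    rw [norm_div, norm_pow]; simp
  rw [← h3] at h2
  rw [← h1.tsum_eq, ← h2.tsum_eq]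
  exact norm_tsum_le_tsum_norm h2.summable

lemma gauss_norm (z : ℂ) {q : ℝ} (hq : 0 < q) :
    ∫ v in Ioi (0:ℝ), ‖(v:ℂ) * sinh (z * v) * cexp (-(1/(2*q) : ℂ) * v ^ 2)‖ ≤
      (1/2) * (q * ‖z‖ * (Real.sqrt (2 * Real.pi * q) * Real.exp (‖z‖ ^ 2 * q / 2))) := by
  have e : ∀ v : ℝ, ((v * Real.sinh (‖z‖ * v) * Real.exp (-(1/(2*q)) * v ^ 2) : ℝ) : ℂ) =
    (v:ℂ) * sinh ((‖z‖ : ℂ) * v) * cexp (-(1/(2*q) : ℂ) * v ^ 2) := fun v => by push_cast; rfl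
  have i := intgl_gauss (‖z‖ : ℂ) hq
  have h := gauss_val (‖z‖ : ℂ) hq
  simp_rw [← e] at h i
  have i' : IntegrableOn (fun v : ℝ => v * Real.sinh (‖z‖ * v) * Real.exp (-(1/(2*q)) * v ^ 2))
    (Ioi 0) := i.re
  rw [integral_complex_ofReal] at h
  have h' : ∫ v in Ioi (0:ℝ), v * Real.sinh (‖z‖ * v) * Real.exp (-(1/(2*q)) * v ^ 2) =
     (1/2) * (q * ‖z‖ * (Real.sqrt (2 * Real.pi * q) * Real.exp (‖z‖ ^ 2 * q / 2))) := by
    apply Complex.ofReal_injective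
    rw [h]
    push_cast
    rfl
  rw [← h']
  refine setIntegral_mono_on (intgl_gauss z hq).norm i' measurableSet_Ioi fun v hv => ?_
  have hv' : 0 < v := hv
  rw [norm_mul, norm_mul, Complex.norm_real, Real.norm_eq_abs, abs_of_pos hv']
  have h1 : ‖cexp (-(1/(2*q) : ℂ) * v ^ 2)‖ = Real.exp (-(1/(2*q)) * v ^ 2) := by
    rw [← Complex.norm_exp_ofReal]; push_cast; rfl
  rw [h1]
  gcongr
  refine (norm_sinh_le _).trans ?_
  rw [norm_mul, Complex.norm_real, Real.norm_eq_abs, abs_of_pos hv']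

end Nich

namespace Nich

lemma cpow_pos {x : ℝ} (hx : 0 < x) (p : ℂ) : (x:ℂ) ^ p = cexp (p * (Real.log x : ℝ)) := by
  rw [cpow_def_of_ne_zero (by exact_mod_cast hx.ne'), ← ofReal_log hx.le, mul_comm]

lemma pos_exp {x : ℝ} (hx : 0 < x) : (x:ℂ) = cexp ((Real.log x : ℝ)) := by
  rw [← ofReal_exp, Real.exp_log hx]

lemma subst_u {T : ℝ} (hT0 : 0 < T) (hT1 : T < 1) (g : ℝ → ℂ) :
    ∫ u in Ioo (0:ℝ) 1, g u = ∫ r in Ioo (0:ℝ) 1,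
      (((1 - T)/(1 - T + T * r)^2 : ℝ) : ℂ) * g (r / (1 - T + T * r)) := by
  have hD : ∀ r ∈ Ioo (0:ℝ) 1, 0 < 1 - T + T * r := fun r hr => by
    have := mul_pos hT0 hr.1; linarith
  have himg : (fun r => r / (1 - T + T * r)) '' Ioo (0:ℝ) 1 = Ioo 0 1 := by
    ext u
    constructor
    · rintro ⟨r, hr, rfl⟩
      have h := hD r hr
      refine ⟨div_pos hr.1 h, ?_⟩
      rw [div_lt_one h]
      nlinarith [hr.2]
    · rintro ⟨h0, h1⟩
      have hq : 0 < 1 - T * u := by nlinarith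
      refine ⟨u * (1 - T) / (1 - T * u), ⟨by apply div_pos _ hq; nlinarith, ?_⟩, ?_⟩
      · rw [div_lt_one hq]; nlinarith
      · simp only []
        have e : 1 - T + T * (u * (1 - T) / (1 - T * u)) = (1 - T) / (1 - T * u) := by
          field_simp; ring
        rw [e]
        have : (1 - T) ≠ 0 := by linarith
        rw [div_div_div_cancel_right₀ hq.ne', mul_div_cancel_right₀ _ this]
  have := integral_image_eq_integral_abs_deriv_smul (s := Ioo (0:ℝ) 1)
    (f := fun r => r / (1 - T + T * r)) (f' := fun r => (1 - T)/(1 - T + T * r)^2)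
    measurableSet_Ioo ?_ ?_ g
  · rw [himg] at this
    rw [this]
    refine setIntegral_congr_fun measurableSet_Ioo fun r hr => ?_
    have h := hD r hr
    have h' : 0 < 1 - T := by linarith
    rw [abs_of_pos (by positivity), real_smul]
  · intro r hr
    have h := hD r hr
    have d : HasDerivAt (fun r => 1 - T + T * r) T r := by
      simpa using ((hasDerivAt_id r).const_mul T).const_add (1 - T)
    refine (((hasDerivAt_id r).div d h.ne').congr_deriv ?_).hasDerivWithinAt
    simp only [id]
    congr 1
    ring
  · intro r hr r' hr' h
    have h1 := hD r hr
    have h2 := hD r' hr'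
    simp only [] at h
    rw [div_eq_div_iff h1.ne' h2.ne'] at h
    have : (1 - T) * (r - r') = 0 := by linear_combination h
    rcases mul_eq_zero.1 this with h | h <;> linarith

lemma inner_u (μ : ℂ) {T : ℝ} (hT0 : 0 < T) (hT1 : T < 1) (v : ℝ) :
    ∫ u in Ioo (0:ℝ) 1, (u:ℂ) ^ ((μ - 1)/2) * ((1 - u : ℝ):ℂ) ^ (-μ/2) *
      ((1 - T * u : ℝ) : ℂ) ^ (-3/2 : ℂ) * cexp (-(1/(2 * (1 - T * u : ℝ)) : ℂ) * v ^ 2) =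
    ((1 - T : ℝ) : ℂ) ^ (-μ/2 - 1/2) * cexp (-(v:ℂ)^2/2) *
      ∫ r in Ioo (0:ℝ) 1, (r:ℂ) ^ ((μ - 1)/2) * ((1 - r : ℝ):ℂ) ^ (-μ/2) *
        cexp (-((r * v^2/4 * (2 * (T/(1 - T))) : ℝ) : ℂ)) := by
  rw [subst_u hT0 hT1, ← integral_const_mul]
  refine setIntegral_congr_fun measurableSet_Ioo fun r hr => ?_
  have hr0 := hr.1
  have hr1 : 0 < 1 - r := by linarith [hr.2]
  have ha : 0 < 1 - T := by linarith
  have hD : 0 < 1 - T + T * r := by have := mul_pos hT0 hr.1; linarith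
  have e1 : 1 - r / (1 - T + T * r) = (1 - T) * (1 - r) / (1 - T + T * r) := by field_simp; ring
  have e2 : 1 - T * (r / (1 - T + T * r)) = (1 - T) / (1 - T + T * r) := by field_simp; ring
  rw [e1, e2]
  have e3 : -(1/(2 * ((1 - T) / (1 - T + T * r) : ℝ)) : ℂ) * v ^ 2 =
     -(v:ℂ)^2/2 + (-((r * v^2/4 * (2 * (T/(1 - T))) : ℝ) : ℂ)) := by
    have : (1 - T) / (1 - T + T * r) = 1 / (1 + r * (T / (1 - T))) := by field_simp
    rw [this]
    push_cast
    have h : (1 + (r:ℂ) * (T / (1 - T))) ≠ 0 := by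
      have : 0 < 1 + r * (T / (1 - T)) := by positivity
      exact_mod_cast this.ne'
    rw [one_div, mul_one_div, inv_div]
    ring
  rw [e3, Complex.exp_add]
  have key : (((1 - T)/(1 - T + T * r)^2 : ℝ) : ℂ) * (((r / (1 - T + T * r) : ℝ) : ℂ) ^ ((μ - 1)/2) *
      (((1 - T) * (1 - r) / (1 - T + T * r) : ℝ) : ℂ) ^ (-μ/2) *
      (((1 - T) / (1 - T + T * r) : ℝ) : ℂ) ^ (-3/2 : ℂ)) =
      ((1 - T : ℝ) : ℂ) ^ (-μ/2 - 1/2) * ((r:ℂ) ^ ((μ - 1)/2) * ((1 - r : ℝ):ℂ) ^ (-μ/2)) := by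
    generalize 1 - T + T * r = D at *
    generalize 1 - T = a at *
    generalize 1 - r = r1 at *
    rw [pos_exp (show 0 < a / D^2 by positivity), cpow_pos (show 0 < r / D by positivity),
      cpow_pos (show 0 < a * r1 / D by positivity), cpow_pos (show 0 < a / D by positivity),
      cpow_pos ha, cpow_pos hr0, cpow_pos hr1, Real.log_div ha.ne' (by positivity),
      Real.log_div hr0.ne' hD.ne', Real.log_div (by positivity) hD.ne',
      Real.log_div ha.ne' hD.ne', Real.log_mul ha.ne' hr1.ne', Real.log_pow]
    simp only [← Complex.exp_add]
    congr 1
    push_cast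
    ring
  linear_combination (cexp (-(v:ℂ)^2/2) * cexp (-((r * v^2/4 * (2 * (T/(1 - T))) : ℝ) : ℂ))) * key

lemma subst_t (g : ℝ → ℂ) :
    ∫ X in Ioi (0:ℝ), g X = ∫ t in Ioi (0:ℝ),
      ((2 * Real.exp (2 * t) : ℝ) : ℂ) * g (Real.exp (2 * t) - 1) := by
  have himg : (fun t => Real.exp (2 * t) - 1) '' Ioi (0:ℝ) = Ioi 0 := by
    ext X
    constructor
    · rintro ⟨t, ht, rfl⟩
      have ht' : 0 < t := ht
      have : 1 < Real.exp (2 * t) := Real.one_lt_exp_iff.2 (by linarith)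
      simpa using ht'
    · intro hX
      have hX' : 0 < X := hX
      refine ⟨Real.log (1 + X) / 2, ?_, ?_⟩
      · have : 0 < Real.log (1 + X) := Real.log_pos (by linarith)
        exact mem_Ioi.2 (by positivity)
      · simp only []
        rw [mul_div_cancel₀ _ two_ne_zero, Real.exp_log (by linarith)]; ring
  have := integral_image_eq_integral_abs_deriv_smul (s := Ioi (0:ℝ))
    (f := fun t => Real.exp (2 * t) - 1) (f' := fun t => 2 * Real.exp (2 * t))
    measurableSet_Ioi ?_ ?_ g
  · rw [himg] at this
    rw [this]
    refine setIntegral_congr_fun measurableSet_Ioi fun r hr => ?_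
    rw [abs_of_pos (by positivity), real_smul]
  · intro t ht
    have d : HasDerivAt (fun t : ℝ => 2 * t) 2 t := by
      simpa using (hasDerivAt_id t).const_mul (2:ℝ)
    refine ((d.exp.sub_const 1).congr_deriv ?_).hasDerivWithinAt
    ring
  · intro t _ t' _ h
    simp only [sub_left_inj] at h
    have := Real.exp_injective h
    linarith

lemma tanh_exp (t : ℝ) : Real.tanh t = (Real.exp (2 * t) - 1) / (Real.exp (2 * t) + 1) := by
  rw [Real.tanh_eq_sinh_div_cosh, Real.sinh_eq, Real.cosh_eq, Real.exp_neg, two_mul, Real.exp_add]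
  have := Real.exp_pos t
  field_simp

lemma sinh_exp (t : ℝ) : Real.sinh (2 * t) = (Real.exp (2 * t) - 1) * (Real.exp (2 * t) + 1) /
    (Real.exp (2 * t) * 2) := by
  rw [Real.sinh_eq, Real.exp_neg]
  have := Real.exp_pos (2 * t)
  field_simp
  ring

lemma one_lt_E {t : ℝ} (ht : 0 < t) : 0 < Real.exp (2 * t) - 1 := by
  have : 1 < Real.exp (2 * t) := Real.one_lt_exp_iff.2 (by linarith)
  linarith

lemma tanh_pos {t : ℝ} (ht : 0 < t) : 0 < Real.tanh t := by
  rw [tanh_exp]; have := one_lt_E ht; positivity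

lemma tanh_lt {t : ℝ} : Real.tanh t < 1 := by
  rw [tanh_exp, div_lt_one (by positivity)]; linarith

lemma key_t (μ : ℂ) {t : ℝ} (ht : 0 < t) :
    cexp ((2 - μ) * t) * ((Real.sinh (2 * t) : ℝ) : ℂ) ^ (-μ/2) *
      ((Real.sqrt (Real.tanh t) : ℝ) : ℂ) * ((1 - Real.tanh t : ℝ) : ℂ) ^ (-μ/2 - 1/2) =
    ((Real.sqrt 2 : ℝ) : ℂ)⁻¹ * ((Real.exp (2 * t) : ℝ) : ℂ) *
      ((Real.exp (2 * t) - 1 : ℝ) : ℂ) ^ ((1 - μ)/2) := by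
  have h1 := one_lt_E ht
  have h2 : 0 < Real.exp (2 * t) + 1 := by positivity
  have hE := Real.exp_pos (2 * t)
  have hq : 1 - Real.tanh t = 2 / (Real.exp (2 * t) + 1) := by
    rw [tanh_exp]; field_simp; ring
  have hl : Real.log (Real.exp (2 * t)) = 2 * t := Real.log_exp _
  rw [sqrt_eq_cpow (tanh_pos ht).le, hq, tanh_exp, sinh_exp, sqrt_eq_cpow zero_le_two]
  generalize Real.exp (2 * t) - 1 = X at *
  generalize Real.exp (2 * t) + 1 = Y at *
  generalize Real.exp (2 * t) = E at *
  rw [cpow_pos (show 0 < X * Y / (E * 2) by positivity), cpow_pos (show 0 < X / Y by positivity),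
    cpow_pos (show 0 < 2 / Y by positivity), cpow_pos h1, cpow_pos two_pos, pos_exp hE,
    Real.log_div (by positivity) (by positivity), Real.log_mul h1.ne' h2.ne',
    Real.log_mul hE.ne' two_ne_zero, Real.log_div h1.ne' h2.ne', Real.log_div two_ne_zero h2.ne',
    hl, ← Complex.exp_neg]
  simp only [← Complex.exp_add]
  congr 1
  push_cast
  ring

lemma intgl_gamma {s : ℂ} (hs : -1 < s.re) {w : ℝ} (hw : 0 < w) :
    IntegrableOn (fun x : ℝ => (x:ℂ) ^ s * cexp (-((w * x : ℝ) : ℂ))) (Ioi 0) := by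
  have h := Complex.GammaIntegral_convergent (s := s + 1) (by simp; linarith)
  have h2 := (integrableOn_Ioi_comp_mul_left_iff _ 0 hw).2 (by simpa using h)
  have h3 := h2.const_mul ((w:ℂ) ^ (-s))
  refine Integrable.congr h3 ?_
  filter_upwards [ae_restrict_mem measurableSet_Ioi] with x hx
  have hx' : 0 < x := hx
  rw [cpow_pos hw, cpow_pos (mul_pos hw hx'), cpow_pos hx', Real.log_mul hw.ne' hx'.ne']
  push_cast
  simp only [← Complex.exp_add]
  congr 1
  ring

lemma gamma_val {s : ℂ} (hs : -1 < s.re) {w : ℝ} (hw : 0 < w) :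
    ∫ x in Ioi (0:ℝ), (x:ℂ) ^ s * cexp (-((w * x : ℝ) : ℂ)) = (w:ℂ) ^ (-(s + 1)) * Gamma (s + 1) := by
  have h := integral_cpow_mul_exp_neg_mul_Ioi (a := s + 1) (r := w) (by simp; linarith)
    (by simpa using hw)
  simp only [add_sub_cancel_right] at h
  push_cast
  rw [h]
  congr 1
  rw [show (1 / w : ℂ) = ((1 / w : ℝ) : ℂ) by push_cast; rfl, cpow_pos (by positivity),
    cpow_pos hw, one_div, Real.log_inv]
  push_cast
  ring_nf

end Nich

namespace Nich

lemma M_eq {μ : ℂ} (hμ0 : -1 < μ.re) (hμ1 : μ.re < 1) {w v : ℝ} (hw : 0 < w) :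
    ∫ t in Ioi (0:ℝ), ∫ u in Ioo (0:ℝ) 1,
      (cexp ((2 - μ) * t) * ((Real.sinh (2 * t) : ℝ) : ℂ) ^ (-μ/2) *
      ((Real.sqrt (Real.tanh t) : ℝ) : ℂ) * cexp (-((w * Real.exp (2 * t) : ℝ) : ℂ))) *
      ((u:ℂ) ^ ((μ - 1)/2) * ((1 - u : ℝ):ℂ) ^ (-μ/2) *
      ((1 - Real.tanh t * u : ℝ) : ℂ) ^ (-3/2 : ℂ) *
        cexp (-(1/(2 * (1 - Real.tanh t * u : ℝ)) : ℂ) * v ^ 2)) =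
    ((Real.sqrt 2 : ℝ) : ℂ)⁻¹ / 2 * cexp (-w - (v:ℂ)^2/2) * Gamma ((3 - μ)/2) *
      ∫ r in Ioo (0:ℝ) 1, (r:ℂ) ^ ((μ - 1)/2) * ((1 - r : ℝ):ℂ) ^ (-μ/2) *
        ((w + r * v^2/4 : ℝ) : ℂ) ^ ((μ - 3)/2) := by
  have step1 : ∀ t ∈ Ioi (0:ℝ), ∫ u in Ioo (0:ℝ) 1,
      (cexp ((2 - μ) * t) * ((Real.sinh (2 * t) : ℝ) : ℂ) ^ (-μ/2) *
      ((Real.sqrt (Real.tanh t) : ℝ) : ℂ) * cexp (-((w * Real.exp (2 * t) : ℝ) : ℂ))) *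
      ((u:ℂ) ^ ((μ - 1)/2) * ((1 - u : ℝ):ℂ) ^ (-μ/2) *
      ((1 - Real.tanh t * u : ℝ) : ℂ) ^ (-3/2 : ℂ) *
        cexp (-(1/(2 * (1 - Real.tanh t * u : ℝ)) : ℂ) * v ^ 2)) =
      (((Real.sqrt 2 : ℝ) : ℂ)⁻¹ / 2 * cexp (-w - (v:ℂ)^2/2)) *
       (((2 * Real.exp (2 * t) : ℝ) : ℂ) * ∫ r in Ioo (0:ℝ) 1,
        (((Real.exp (2 * t) - 1 : ℝ) : ℂ) ^ ((1 - μ)/2) *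
          cexp (-((w * (Real.exp (2 * t) - 1) : ℝ) : ℂ))) *
        ((r:ℂ) ^ ((μ - 1)/2) * ((1 - r : ℝ):ℂ) ^ (-μ/2) *
        cexp (-((r * v^2/4 * (Real.exp (2 * t) - 1) : ℝ) : ℂ)))) := by
    intro t ht
    have ht' : 0 < t := ht
    have hq : 2 * (Real.tanh t / (1 - Real.tanh t)) = Real.exp (2 * t) - 1 := by
      rw [tanh_exp]
      have : 0 < Real.exp (2 * t) + 1 := by positivity
      field_simp
      ring
    rw [integral_const_mul, inner_u μ (tanh_pos ht') tanh_lt v, hq, integral_const_mul]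
    have k := key_t μ ht'
    have ex : cexp (-((w * Real.exp (2 * t) : ℝ) : ℂ)) * cexp (-(v:ℂ)^2/2) =
        cexp (-w - (v:ℂ)^2/2) * cexp (-((w * (Real.exp (2 * t) - 1) : ℝ) : ℂ)) := by
      rw [← Complex.exp_add, ← Complex.exp_add]; congr 1; push_cast; ring
    rw [show ((2 * Real.exp (2 * t) : ℝ) : ℂ) = 2 * ((Real.exp (2 * t) : ℝ) : ℂ) by push_cast; rfl]
    generalize (∫ r in Ioo (0:ℝ) 1, ((r:ℂ) ^ ((μ - 1)/2) * ((1 - r : ℝ):ℂ) ^ (-μ/2) *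
        cexp (-((r * v^2/4 * (Real.exp (2 * t) - 1) : ℝ) : ℂ)))) = Q
    generalize cexp (-((w * Real.exp (2 * t) : ℝ) : ℂ)) = x1 at *
    generalize cexp (-(v:ℂ)^2/2) = x2 at *
    generalize cexp (-w - (v:ℂ)^2/2) = x3 at *
    generalize cexp (-((w * (Real.exp (2 * t) - 1) : ℝ) : ℂ)) = x4 at *
    linear_combination x1 * x2 * Q * k + ((Real.sqrt 2 : ℝ) : ℂ)⁻¹ * ((Real.exp (2 * t) : ℝ) : ℂ) *
      ((Real.exp (2 * t) - 1 : ℝ) : ℂ) ^ ((1 - μ)/2) * Q * ex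
  rw [setIntegral_congr_fun measurableSet_Ioi step1, integral_const_mul]
  rw [← subst_t (fun X => ∫ r in Ioo (0:ℝ) 1, (((X : ℝ) : ℂ) ^ ((1 - μ)/2) *
          cexp (-((w * X : ℝ) : ℂ))) *
        ((r:ℂ) ^ ((μ - 1)/2) * ((1 - r : ℝ):ℂ) ^ (-μ/2) *
        cexp (-((r * v^2/4 * X : ℝ) : ℂ))))]
  rw [mul_assoc _ (Gamma _)]
  congr 1
  have hb : -1 < ((μ - 1)/2).re := by simp; linarith
  have hg : -1 < (-μ/2).re := by simp; linarith
  have hs : -1 < ((1 - μ)/2).re := by simp; linarith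
  rw [integral_integral_swap]
  · rw [← integral_const_mul]
    refine setIntegral_congr_fun measurableSet_Ioo fun r hr => ?_
    have hr0 := hr.1
    have hpos : 0 < w + r * v^2/4 := by positivity
    have gv := gamma_val hs hpos
    have e1 : (1 - μ)/2 + 1 = (3 - μ)/2 := by ring
    have e2 : -((3 - μ)/2) = (μ - 3)/2 := by ring
    rw [e1, e2] at gv
    calc _ = ∫ X in Ioi (0:ℝ), ((r:ℂ) ^ ((μ - 1)/2) * ((1 - r : ℝ):ℂ) ^ (-μ/2)) *
          ((X:ℂ) ^ ((1 - μ)/2) * cexp (-(((w + r * v^2/4) * X : ℝ) : ℂ))) := by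
          refine setIntegral_congr_fun measurableSet_Ioi fun X _ => ?_
          have : cexp (-(((w + r * v^2/4) * X : ℝ) : ℂ)) = cexp (-((w * X : ℝ) : ℂ)) *
              cexp (-((r * v^2/4 * X : ℝ) : ℂ)) := by
            rw [← Complex.exp_add]; congr 1; push_cast; ring
          simp only [this]
          ring
      _ = _ := by
          rw [integral_const_mul, gv]; ring
  · have hi := (intgl_gamma hs hw).mul_prod (intgl_beta hb hg)
    refine Integrable.mono hi ?_ ?_
    · exact Measurable.aestronglyMeasurable (by fun_prop)
    · rw [Measure.prod_restrict]
      filter_upwards [ae_restrict_mem (measurableSet_Ioi.prod measurableSet_Ioo)] with p hp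
      have h1 : 0 < p.1 := hp.1
      have h2 : 0 < p.2 := hp.2.1
      simp only [Function.uncurry]
      have h3 : ‖cexp (-((p.2 * v^2/4 * p.1 : ℝ) : ℂ))‖ ≤ 1 := by
        rw [← ofReal_neg, Complex.norm_exp_ofReal]
        refine Real.exp_le_one_iff.2 ?_
        have : 0 ≤ p.2 * v^2/4 * p.1 := by positivity
        linarith
      rw [← mul_assoc, norm_mul]
      exact mul_le_of_le_one_right (norm_nonneg _) h3

end Nich

namespace Nich

lemma img_s {w : ℝ} (hw : 0 < w) : (fun θ => Real.sqrt w * Real.exp (-θ)) '' univ = Ioi 0 := by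
  have h := Real.sqrt_pos.2 hw
  ext s
  constructor
  · rintro ⟨θ, _, rfl⟩
    exact mem_Ioi.2 (by positivity)
  · intro hs
    have hs' : 0 < s := hs
    refine ⟨-Real.log (s / Real.sqrt w), mem_univ _, ?_⟩
    simp only [neg_neg]
    rw [Real.exp_log (by positivity)]
    field_simp

lemma der_s (w : ℝ) (θ : ℝ) : HasDerivWithinAt (fun θ => Real.sqrt w * Real.exp (-θ))
    (-(Real.sqrt w * Real.exp (-θ))) univ θ := by
  refine (((hasDerivAt_neg θ).exp.const_mul (Real.sqrt w)).congr_deriv ?_).hasDerivWithinAt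
  ring

lemma inj_s {w : ℝ} (hw : 0 < w) : InjOn (fun θ => Real.sqrt w * Real.exp (-θ)) univ := by
  intro a _ b _ h
  have h' := mul_left_cancel₀ (Real.sqrt_pos.2 hw).ne' h
  have := Real.exp_injective h'
  linarith

lemma subst_s {w : ℝ} (hw : 0 < w) (g : ℝ → ℂ) :
    ∫ s in Ioi (0:ℝ), g s = ∫ θ : ℝ, ((Real.sqrt w * Real.exp (-θ) : ℝ) : ℂ) *
      g (Real.sqrt w * Real.exp (-θ)) := by
  have := integral_image_eq_integral_abs_deriv_smul MeasurableSet.univ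
    (fun θ _ => der_s w θ) (inj_s hw) g
  rw [img_s hw, setIntegral_univ] at this
  rw [this]
  congr 1
  ext θ
  have h := Real.sqrt_pos.2 hw
  rw [abs_neg, abs_of_pos (by positivity), real_smul]

lemma subst_s_int {w : ℝ} (hw : 0 < w) {g : ℝ → ℂ} (hg : IntegrableOn g (Ioi 0)) :
    Integrable (fun θ : ℝ => ((Real.sqrt w * Real.exp (-θ) : ℝ) : ℂ) *
      g (Real.sqrt w * Real.exp (-θ))) := by
  have := integrableOn_image_iff_integrableOn_abs_deriv_smul MeasurableSet.univ
    (fun θ _ => der_s w θ) (inj_s hw) g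
  rw [img_s hw, integrableOn_univ] at this
  refine (this.1 hg).congr (Filter.Eventually.of_forall fun θ => ?_)
  have h := Real.sqrt_pos.2 hw
  simp only []
  rw [abs_neg, abs_of_pos (by positivity), real_smul]

lemma prod_subst {f g : ℝ → ℂ} (mf : Measurable f) (mg : Measurable g)
    (hf : IntegrableOn f (Ioi 0)) (hg : IntegrableOn g (Ioi 0)) :
    ((∫ s in Ioi (0:ℝ), f s) * (∫ t in Ioi (0:ℝ), g t) = ∫ w in Ioi (0:ℝ), ∫ θ : ℝ,
      f (Real.sqrt w * Real.exp (-θ)) * g (Real.sqrt w * Real.exp θ)) ∧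
    IntegrableOn (fun w : ℝ => ∫ θ : ℝ,
      f (Real.sqrt w * Real.exp (-θ)) * g (Real.sqrt w * Real.exp θ)) (Ioi 0) ∧
    ∀ᵐ w ∂(volume.restrict (Ioi (0:ℝ))), Integrable (fun θ : ℝ =>
      f (Real.sqrt w * Real.exp (-θ)) * g (Real.sqrt w * Real.exp θ)) := by
  set K : ℝ × ℝ → ℂ := fun p => f p.1 * g (p.1⁻¹ * p.2) * ((p.1⁻¹ : ℝ) : ℂ) with hK
  have e1 : ∀ s ∈ Ioi (0:ℝ), ∫ w in Ioi (0:ℝ), K (s, w) = f s * ∫ t in Ioi (0:ℝ), g t := by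
    intro s hs
    have hs' : 0 < s := hs
    have hs0 : (s:ℂ) ≠ 0 := by exact_mod_cast hs'.ne'
    simp only [hK]
    rw [integral_mul_const, integral_const_mul, integral_comp_mul_left_Ioi _ _ (inv_pos.2 hs')]
    simp
    field_simp
  have e2 : ∀ s ∈ Ioi (0:ℝ), ∫ w in Ioi (0:ℝ), ‖K (s, w)‖ = ‖f s‖ * ∫ t in Ioi (0:ℝ), ‖g t‖ := by
    intro s hs
    have hs' : 0 < s := hs
    simp only [hK, norm_mul, Complex.norm_real, Real.norm_eq_abs, abs_of_pos (inv_pos.2 hs')]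
    rw [integral_mul_const, integral_const_mul,
      integral_comp_mul_left_Ioi (fun x => ‖g x‖) _ (inv_pos.2 hs')]
    simp
    field_simp
  have iK : Integrable K ((volume.restrict (Ioi 0)).prod (volume.restrict (Ioi 0))) := by
    rw [integrable_prod_iff (Measurable.aestronglyMeasurable (by fun_prop))]
    constructor
    · filter_upwards [ae_restrict_mem measurableSet_Ioi] with s hs
      have hs' : 0 < s := hs
      have : IntegrableOn (fun w => g (s⁻¹ * w)) (Ioi 0) :=
        (integrableOn_Ioi_comp_mul_left_iff g 0 (inv_pos.2 hs')).2 (by simpa using hg)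
      exact (this.const_mul (f s)).mul_const ((s⁻¹:ℝ):ℂ)
    · refine Integrable.congr (hf.norm.mul_const (∫ t in Ioi (0:ℝ), ‖g t‖)) ?_
      filter_upwards [ae_restrict_mem measurableSet_Ioi] with s hs
      exact (e2 s hs).symm
  have key : ∀ w ∈ Ioi (0:ℝ), ∀ θ : ℝ, ((Real.sqrt w * Real.exp (-θ) : ℝ) : ℂ) *
      K (Real.sqrt w * Real.exp (-θ), w) =
      f (Real.sqrt w * Real.exp (-θ)) * g (Real.sqrt w * Real.exp θ) := by
    intro w hw θ
    have hw' : 0 < w := hw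
    have h := Real.sqrt_pos.2 hw'
    simp only [hK]
    have a1 : (Real.sqrt w * Real.exp (-θ))⁻¹ * w = Real.sqrt w * Real.exp θ := by
      rw [Real.exp_neg]
      have := Real.sq_sqrt hw'.le
      field_simp
      linarith
    rw [a1]
    have : ((Real.sqrt w * Real.exp (-θ) : ℝ) : ℂ) ≠ 0 := by
      have : 0 < Real.sqrt w * Real.exp (-θ) := by positivity
      exact_mod_cast this.ne'
    rw [ofReal_inv]
    field_simp
  have e3 : ∀ w ∈ Ioi (0:ℝ), ∫ s in Ioi (0:ℝ), K (s, w) = ∫ θ : ℝ,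
      f (Real.sqrt w * Real.exp (-θ)) * g (Real.sqrt w * Real.exp θ) := by
    intro w hw
    rw [subst_s (show 0 < w from hw)]
    congr 1
    ext θ
    exact key w hw θ
  refine ⟨?_, ?_, ?_⟩
  · rw [← integral_mul_const, ← setIntegral_congr_fun measurableSet_Ioi e1,
      integral_integral_swap (f := fun s w => K (s, w)) iK]
    exact setIntegral_congr_fun measurableSet_Ioi e3
  · refine Integrable.congr iK.integral_prod_right ?_
    filter_upwards [ae_restrict_mem measurableSet_Ioi] with w hw
    exact e3 w hw
  · filter_upwards [ae_restrict_mem measurableSet_Ioi, iK.prod_left_ae] with w hw hi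
    refine (subst_s_int (show 0 < w from hw) hi).congr (Filter.Eventually.of_forall fun θ => ?_)
    exact key w hw θ

lemma intgl_D (z : ℂ) {p : ℂ} (hp : -1 < p.re) :
    IntegrableOn (fun s : ℝ => cexp (z * s - (s:ℂ)^2/2) * (s:ℂ) ^ p) (Ioi 0) := by
  have h := intgl_gamma hp one_pos
  refine Integrable.mono (h.const_mul (Real.exp ((‖z‖ + 1)^2/2) : ℂ))
    (Measurable.aestronglyMeasurable (by fun_prop)) ?_
  filter_upwards [ae_restrict_mem measurableSet_Ioi] with s hs
  have hs' : 0 < s := hs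
  rw [mul_comm, norm_mul, norm_mul, norm_mul, mul_left_comm]
  gcongr
  rw [Complex.norm_real, Real.norm_eq_abs, abs_of_pos (Real.exp_pos _), ← ofReal_neg,
    Complex.norm_exp_ofReal, ← Real.exp_add, Complex.norm_exp]
  gcongr
  have h1 : (z * s - (s:ℂ)^2/2).re = z.re * s - s^2/2 := by
    rw [show z * s - (s:ℂ)^2/2 = z * s - ((s^2/2 : ℝ) : ℂ) by push_cast; rfl]
    rw [sub_re, re_mul_ofReal, ofReal_re]
  rw [h1]
  have h2 := Complex.re_le_norm z
  have h3 : z.re * s ≤ ‖z‖ * s := by gcongr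
  nlinarith [sq_nonneg (s - (‖z‖ + 1))]

lemma J_eq {ν μ : ℂ} (z : ℂ) (hν : ν.re < 0) (hμ1 : μ.re < 1) :
    (∫ s in Ioi (0:ℝ), cexp (-z * s - (s:ℂ)^2 / 2) * (s:ℂ) ^ (-ν - 1)) *
        (∫ t in Ioi (0:ℝ), cexp (z * t - (t:ℂ)^2 / 2) * (t:ℂ) ^ (-ν - μ)) -
       (∫ s in Ioi (0:ℝ), cexp (z * s - (s:ℂ)^2 / 2) * (s:ℂ) ^ (-ν - 1)) *
        (∫ t in Ioi (0:ℝ), cexp (-z * t - (t:ℂ)^2 / 2) * (t:ℂ) ^ (-ν - μ)) =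
    ∫ w in Ioi (0:ℝ), ∫ θ in Ioi (0:ℝ), 4 * sinh ((1 - μ) * θ) *
      sinh (z * ((2 * Real.sqrt w * Real.sinh θ : ℝ) : ℂ)) *
      cexp (-w - ((2 * Real.sqrt w * Real.sinh θ : ℝ) : ℂ)^2 / 2) * (w:ℂ) ^ (-ν - 1/2 - μ/2) := by
  have hp : -1 < (-ν - 1).re := by simp; linarith
  have hq : -1 < (-ν - μ).re := by simp; linarith
  have key : ∀ (z : ℂ) (w : ℝ), 0 < w → ∀ θ : ℝ,
      (cexp (-z * ((Real.sqrt w * Real.exp (-θ) : ℝ) : ℂ) -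
        ((Real.sqrt w * Real.exp (-θ) : ℝ) : ℂ)^2 / 2) *
        ((Real.sqrt w * Real.exp (-θ) : ℝ) : ℂ) ^ (-ν - 1)) *
      (cexp (z * ((Real.sqrt w * Real.exp θ : ℝ) : ℂ) -
        ((Real.sqrt w * Real.exp θ : ℝ) : ℂ)^2 / 2) *
        ((Real.sqrt w * Real.exp θ : ℝ) : ℂ) ^ (-ν - μ)) =
      cexp ((1 - μ) * θ) * cexp (z * ((2 * Real.sqrt w * Real.sinh θ : ℝ) : ℂ)) *
      cexp (-w - ((2 * Real.sqrt w * Real.sinh θ : ℝ) : ℂ)^2 / 2) *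
        (w:ℂ) ^ (-ν - 1/2 - μ/2) := by
    intro z w hw θ
    have h := Real.sqrt_pos.2 hw
    have hl : Real.log (Real.sqrt w) = Real.log w / 2 := Real.log_sqrt hw.le
    rw [cpow_pos (show 0 < Real.sqrt w * Real.exp (-θ) by positivity),
      cpow_pos (show 0 < Real.sqrt w * Real.exp θ by positivity), cpow_pos hw,
      Real.log_mul h.ne' (Real.exp_pos _).ne', Real.log_mul h.ne' (Real.exp_pos _).ne',
      Real.log_exp, Real.log_exp, hl, Real.sinh_eq]
    have hw2 : ((Real.sqrt w : ℝ) : ℂ)^2 = w := by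
      rw [← ofReal_pow, Real.sq_sqrt hw.le]
    have hee : ((Real.exp θ : ℝ) : ℂ) * ((Real.exp (-θ) : ℝ) : ℂ) = 1 := by
      rw [← ofReal_mul, ← Real.exp_add]; simp
    simp only [← Complex.exp_add]
    congr 1
    simp only [ofReal_mul, ofReal_add, ofReal_sub, ofReal_div, ofReal_ofNat, ofReal_neg]
    generalize ((Real.exp θ : ℝ) : ℂ) = E1 at *
    generalize ((Real.exp (-θ) : ℝ) : ℂ) = E2 at *
    rw [← hw2]
    linear_combination (-((Real.sqrt w : ℝ) : ℂ)^2) * hee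
  have mk : ∀ (z p : ℂ), Measurable (fun s : ℝ => cexp (z * s - (s:ℂ)^2/2) * (s:ℂ) ^ p) :=
    fun z p => by fun_prop
  obtain ⟨a1, a2, a3⟩ := prod_subst (mk (-z) _) (mk z _) (intgl_D (-z) hp) (intgl_D z hq)
  obtain ⟨b1, b2, b3⟩ := prod_subst (mk z _) (mk (-z) _) (intgl_D z hp) (intgl_D (-z) hq)
  rw [a1, b1, ← integral_sub a2 b2]
  refine integral_congr_ae ?_
  filter_upwards [ae_restrict_mem measurableSet_Ioi, a3, b3] with w hw ia ib
  have hw' : 0 < w := hw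
  rw [← integral_sub ia ib]
  refine (integral_symm (ia.sub ib)).trans ?_
  refine setIntegral_congr_fun measurableSet_Ioi fun θ _ => ?_
  simp only [Pi.sub_apply]
  have k1 := key z w hw'
  have k2 := key (-z) w hw'
  simp only [neg_neg] at k2
  rw [k1 θ, k1 (-θ), k2 θ, k2 (-θ)]
  simp only [Real.sinh_neg, Complex.sinh, mul_neg, neg_mul, ofReal_neg, neg_neg, neg_sq]
  ring

end Nich

namespace Nich

noncomputable def P (μ : ℂ) (t : ℝ) : ℂ :=
  cexp ((2-μ)*t) * ((Real.sinh (2*t):ℝ):ℂ)^(-μ/2) * ((Real.sqrt (Real.tanh t):ℝ):ℂ)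

noncomputable def Q (μ : ℂ) (t u : ℝ) : ℂ :=
  (u:ℂ)^((μ-1)/2) * ((1-u:ℝ):ℂ)^(-μ/2) * ((1-Real.tanh t*u:ℝ):ℂ)^(-3/2:ℂ)

noncomputable def Wf (c : ℂ) (t w : ℝ) : ℂ :=
  (w:ℂ)^(c-1) * cexp (-((Real.exp (2*t)*w:ℝ):ℂ))

noncomputable def Vf (z : ℂ) (q v : ℝ) : ℂ :=
  (v:ℂ)*Complex.sinh (z*v)*cexp (-(1/(2*q):ℂ)*v^2)

noncomputable def FF (μ c z : ℂ) (p : (ℝ×ℝ)×(ℝ×ℝ)) : ℂ :=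
  (P μ p.1.1 * Q μ p.1.1 p.1.2) * (Wf c p.1.1 p.2.1 * Vf z (1-Real.tanh p.1.1*p.1.2) p.2.2)

@[fun_prop]
lemma meas_tanh : Measurable Real.tanh := by
  have : Real.tanh = fun x => Real.sinh x / Real.cosh x := by
    funext x; exact Real.tanh_eq_sinh_div_cosh x
  rw [this]
  exact Real.measurable_sinh.div Real.measurable_cosh

lemma meas_FF (μ c z : ℂ) : Measurable (FF μ c z) := by
  have h : Measurable Complex.sinh := Complex.measurable_sinh
  unfold FF P Q Wf Vf
  fun_prop

lemma normP {μ c ν : ℂ} (hμ1 : μ.re < 1) (hc : c = 1 - ν - μ) {t : ℝ} (ht : 0 < t) :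
    ‖P μ t‖ * Real.exp (-2*c.re*t) ≤ Real.sqrt 2 * Real.exp (2*ν.re*t) := by
  have hs : 0 < Real.sinh (2*t) := Real.sinh_pos_iff.2 (by linarith)
  have hs1 : 0 < Real.sinh t := Real.sinh_pos_iff.2 (by linarith)
  have hc1 : 0 < Real.cosh t := Real.cosh_pos t
  have hT := tanh_pos ht
  have hP : ‖P μ t‖ = Real.exp ((2-μ.re)*t) * Real.sinh (2*t)^(-μ.re/2) * Real.sqrt (Real.tanh t) := by
    unfold P
    rw [norm_mul, norm_mul, Complex.norm_exp, Complex.norm_cpow_eq_rpow_re_of_pos hs,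
      Complex.norm_real, Real.norm_of_nonneg (Real.sqrt_nonneg _)]
    simp
  set R := Real.exp (2*t) / Real.sinh (2*t) with hR
  have hRpos : 0 < R := div_pos (Real.exp_pos _) hs
  have hR1 : 1 ≤ R := by
    rw [hR, le_div_iff₀ hs, Real.sinh_eq]
    have := Real.exp_pos (2*t)
    have := Real.exp_pos (-(2*t))
    linarith
  have hRT : R * Real.tanh t ≤ 2 := by
    rw [hR, Real.tanh_eq_sinh_div_cosh, Real.sinh_two_mul]
    have e : Real.exp (2*t) = Real.exp t ^ 2 := by rw [sq, ← Real.exp_add]; ring_nf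
    rw [e, div_mul_div_comm, div_le_iff₀ (by positivity)]
    have h2 : Real.exp t ≤ 2 * Real.cosh t := by
      rw [Real.cosh_eq]; have := Real.exp_pos (-t); linarith
    have h3 : Real.exp t ^2 ≤ (2 * Real.cosh t)^2 := by gcongr
    nlinarith
  have e1 : Real.sinh (2*t)^(-μ.re/2) = R^(μ.re/2) * Real.exp (-μ.re*t) := by
    rw [hR, Real.div_rpow (Real.exp_pos _).le hs.le, ← Real.exp_mul, neg_div, Real.rpow_neg hs.le,
      div_mul_eq_mul_div, ← Real.exp_add, show 2*t*(μ.re/2) + -μ.re*t = 0 by ring, Real.exp_zero, one_div]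
  have e2 : R^(μ.re/2) ≤ R^(1/2:ℝ) := Real.rpow_le_rpow_of_exponent_le hR1 (by linarith)
  have e3 : R^(1/2:ℝ) * Real.sqrt (Real.tanh t) ≤ Real.sqrt 2 := by
    rw [← Real.sqrt_eq_rpow, ← Real.sqrt_mul hRpos.le]
    exact Real.sqrt_le_sqrt hRT
  have e4 : Real.exp ((2-μ.re)*t) * Real.exp (-μ.re*t) * Real.exp (-2*c.re*t) = Real.exp (2*ν.re*t) := by
    rw [← Real.exp_add, ← Real.exp_add, hc]; congr 1; simp; ring
  rw [hP, e1]
  calc _ = (R^(μ.re/2) * Real.sqrt (Real.tanh t)) * (Real.exp ((2-μ.re)*t) * Real.exp (-μ.re*t) * Real.exp (-2*c.re*t)) := by ring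
    _ ≤ (R^(1/2:ℝ) * Real.sqrt (Real.tanh t)) * (Real.exp ((2-μ.re)*t) * Real.exp (-μ.re*t) * Real.exp (-2*c.re*t)) := by gcongr
    _ ≤ _ := by rw [e4]; gcongr

lemma q_mem {t u : ℝ} (ht : 0 < t) (hu : u ∈ Ioo (0:ℝ) 1) :
    0 < 1 - Real.tanh t * u ∧ 1 - Real.tanh t * u ≤ 1 := by
  have h1 := tanh_pos ht
  have h2 : Real.tanh t < 1 := tanh_lt
  obtain ⟨h3, h4⟩ := hu
  constructor <;> nlinarith

lemma normW {c : ℂ} (hc : 0 < c.re) (t : ℝ) :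
    ∫ w in Ioi (0:ℝ), ‖Wf c t w‖ = Real.exp (-2*c.re*t) * Real.Gamma c.re := by
  have : ∀ w ∈ Ioi (0:ℝ), ‖Wf c t w‖ = w^(c.re-1) * Real.exp (-(Real.exp (2*t)*w)) := by
    intro w hw
    unfold Wf
    rw [norm_mul, Complex.norm_cpow_eq_rpow_re_of_pos hw, Complex.norm_exp, ← ofReal_neg, ofReal_re]
    simp
  rw [setIntegral_congr_fun measurableSet_Ioi this,
    Real.integral_rpow_mul_exp_neg_mul_Ioi hc (Real.exp_pos _), one_div, ← Real.exp_neg, ← Real.exp_mul]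
  ring_nf

lemma intgl_FF {μ c ν : ℂ} (z : ℂ) (hν : ν.re < 0) (hμ0 : -1 < μ.re) (hμ1 : μ.re < 1)
    (hc : c = 1 - ν - μ) :
    Integrable (FF μ c z) (((volume.restrict (Ioi (0:ℝ))).prod (volume.restrict (Ioo (0:ℝ) 1))).prod
      ((volume.restrict (Ioi (0:ℝ))).prod (volume.restrict (Ioi (0:ℝ))))) := by
  have hcre : 0 < c.re := by rw [hc]; simp; linarith
  have hae : ∀ᵐ p ∂((volume.restrict (Ioi (0:ℝ))).prod (volume.restrict (Ioo (0:ℝ) 1))),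
      p ∈ Ioi (0:ℝ) ×ˢ Ioo (0:ℝ) 1 := by
    rw [Measure.prod_restrict]
    exact ae_restrict_mem (measurableSet_Ioi.prod measurableSet_Ioo)
  have mF := (meas_FF μ c z).aestronglyMeasurable (μ := ((volume.restrict (Ioi (0:ℝ))).prod (volume.restrict (Ioo (0:ℝ) 1))).prod
      ((volume.restrict (Ioi (0:ℝ))).prod (volume.restrict (Ioi (0:ℝ)))))
  rw [integrable_prod_iff mF]
  constructor
  · filter_upwards [hae] with p hp
    obtain ⟨ht, hu⟩ := hp
    have iW : IntegrableOn (Wf c p.1) (Ioi 0) :=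
      intgl_gamma (by simp; linarith) (Real.exp_pos _)
    have iV : IntegrableOn (Vf z (1-Real.tanh p.1*p.2)) (Ioi 0) :=
      intgl_gauss z (q_mem ht hu).1
    exact (iW.mul_prod iV).const_mul (P μ p.1 * Q μ p.1 p.2)
  · set C : ℝ := Real.sqrt 2 * Real.Gamma c.re * ((1/2) * ‖z‖ * Real.sqrt (2*Real.pi) * Real.exp (‖z‖^2/2)) with hC
    have i1 : IntegrableOn (fun t : ℝ => Real.exp (2*ν.re*t)) (Ioi 0) :=
      integrableOn_exp_mul_Ioi (by linarith) 0
    have i2 := (intgl_beta (β := (μ-1)/2) (γ := -μ/2) (by simp; linarith) (by simp; linarith)).norm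
    have i3 := (i1.mul_prod i2).const_mul C
    refine i3.mono' mF.norm.integral_prod_right' ?_
    filter_upwards [hae] with p hp
    obtain ⟨ht, hu⟩ := hp
    have hq := q_mem ht hu
    obtain ⟨t, u⟩ := p
    simp only at ht hu hq ⊢
    rw [Real.norm_of_nonneg (integral_nonneg fun _ => norm_nonneg _)]
    have e1 : ∫ y, ‖FF μ c z ((t,u), y)‖ ∂((volume.restrict (Ioi (0:ℝ))).prod (volume.restrict (Ioi (0:ℝ)))) =
        ‖P μ t * Q μ t u‖ * ((∫ w in Ioi (0:ℝ), ‖Wf c t w‖) * ∫ v in Ioi (0:ℝ), ‖Vf z (1-Real.tanh t*u) v‖) := by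
      simp only [FF, norm_mul]
      rw [integral_const_mul, ← integral_prod_mul]
    rw [e1, normW hcre]
    have hg : ∫ v in Ioi (0:ℝ), ‖Vf z (1-Real.tanh t*u) v‖ ≤ _ := gauss_norm z hq.1
    have hP := normP hμ1 hc ht
    have hQ : ‖Q μ t u‖ = ‖(u:ℂ)^((μ-1)/2) * ((1-u:ℝ):ℂ)^(-μ/2)‖ * (1-Real.tanh t*u)^(-3/2:ℝ) := by
      unfold Q
      rw [norm_mul, Complex.norm_cpow_eq_rpow_re_of_pos hq.1]
      norm_num
    rw [norm_mul, hQ]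
    set q := 1 - Real.tanh t * u
    set U := ‖(u:ℂ)^((μ-1)/2) * ((1-u:ℝ):ℂ)^(-μ/2)‖
    have hU : 0 ≤ U := norm_nonneg _
    have hqq : q^(-3/2:ℝ) * ((1/2)*(q*‖z‖*(Real.sqrt (2*Real.pi*q)*Real.exp (‖z‖^2*q/2)))) ≤
        (1/2) * ‖z‖ * Real.sqrt (2*Real.pi) * Real.exp (‖z‖^2/2) := by
      have a1 : q^(-3/2:ℝ) * q * Real.sqrt q = 1 := by
        rw [Real.sqrt_eq_rpow]
        nth_rewrite 2 [← Real.rpow_one q]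
        rw [← Real.rpow_add hq.1, ← Real.rpow_add hq.1]; norm_num
      have a2 : Real.exp (‖z‖^2*q/2) ≤ Real.exp (‖z‖^2/2) := by
        apply Real.exp_le_exp.2
        have := mul_le_mul_of_nonneg_left hq.2 (sq_nonneg ‖z‖)
        linarith
      rw [Real.sqrt_mul (by positivity)]
      calc _ = (q^(-3/2:ℝ) * q * Real.sqrt q) * ((1/2) * ‖z‖ * Real.sqrt (2*Real.pi) * Real.exp (‖z‖^2*q/2)) := by ring
        _ ≤ _ := by rw [a1, one_mul]; gcongr
    have hG : 0 < Real.Gamma c.re := Real.Gamma_pos_of_pos hcre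
    have hq0 : 0 ≤ q^(-3/2:ℝ) := Real.rpow_nonneg hq.1.le _
    calc _ = (‖P μ t‖ * Real.exp (-2*c.re*t)) * U * Real.Gamma c.re *
          (q^(-3/2:ℝ) * ∫ v in Ioi (0:ℝ), ‖Vf z q v‖) := by ring
      _ ≤ (Real.sqrt 2 * Real.exp (2*ν.re*t)) * U * Real.Gamma c.re *
          (q^(-3/2:ℝ) * ((1/2)*(q*‖z‖*(Real.sqrt (2*Real.pi*q)*Real.exp (‖z‖^2*q/2))))) := by
          gcongr
      _ ≤ (Real.sqrt 2 * Real.exp (2*ν.re*t)) * U * Real.Gamma c.re *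
          ((1/2) * ‖z‖ * Real.sqrt (2*Real.pi) * Real.exp (‖z‖^2/2)) := by gcongr
      _ = _ := by rw [hC]; ring

end Nich

namespace Nich

lemma img_v {w : ℝ} (hw : 0 < w) : (fun θ => 2 * Real.sqrt w * Real.sinh θ) '' Ioi 0 = Ioi 0 := by
  have h := Real.sqrt_pos.2 hw
  ext v
  simp only [mem_image, mem_Ioi]
  constructor
  · rintro ⟨θ, hθ, rfl⟩
    have := Real.sinh_pos_iff.2 hθ
    positivity
  · intro hv
    refine ⟨Real.arsinh (v / (2 * Real.sqrt w)), ?_, ?_⟩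
    · rw [← Real.sinh_pos_iff, Real.sinh_arsinh]; positivity
    · rw [Real.sinh_arsinh]; field_simp

lemma subst_v {w : ℝ} (hw : 0 < w) (f : ℝ → ℂ) :
    ∫ v in Ioi (0:ℝ), f v = ∫ θ in Ioi (0:ℝ), ((2 * Real.sqrt w * Real.cosh θ : ℝ):ℂ) *
      f (2 * Real.sqrt w * Real.sinh θ) := by
  have h := Real.sqrt_pos.2 hw
  have := integral_image_eq_integral_abs_deriv_smul (s := Ioi (0:ℝ)) (f := fun θ => 2 * Real.sqrt w * Real.sinh θ)
    (f' := fun θ => 2 * Real.sqrt w * Real.cosh θ) measurableSet_Ioi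
    (fun θ _ => ((Real.hasDerivAt_sinh θ).const_mul _).hasDerivWithinAt)
    (fun a _ b _ hab => by
      have : Real.sinh a = Real.sinh b := by
        simpa [h.ne'] using hab
      exact Real.sinh_injective this) f
  rw [img_v hw] at this
  rw [this]
  refine setIntegral_congr_fun measurableSet_Ioi fun θ _ => ?_
  have := Real.cosh_pos θ
  beta_reduce
  rw [abs_of_pos (by positivity), Complex.real_smul]

lemma I_scale {β γ δ : ℂ} {w : ℝ} (hw : 0 < w) (θ : ℝ) :
    ∫ r in Ioo (0:ℝ) 1, (r:ℂ)^β*((1-r:ℝ):ℂ)^γ*((w+r*(2*Real.sqrt w*Real.sinh θ)^2/4:ℝ):ℂ)^δ =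
    (w:ℂ)^δ * I β γ δ (Real.sinh θ^2) := by
  unfold I
  rw [← integral_const_mul]
  refine setIntegral_congr_fun measurableSet_Ioo fun r hr => ?_
  have hs : Real.sqrt w ^2 = w := Real.sq_sqrt hw.le
  have e : w+r*(2*Real.sqrt w*Real.sinh θ)^2/4 = w * (1 + r * Real.sinh θ^2) := by
    rw [mul_pow, mul_pow, hs]; ring
  have hp : 0 < 1 + r * Real.sinh θ^2 := by
    have := mul_nonneg hr.1.le (sq_nonneg (Real.sinh θ)); linarith
  beta_reduce
  rw [e, ofReal_mul, Complex.mul_cpow_ofReal_nonneg hw.le hp.le]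
  ring

noncomputable def Jg (ν μ z : ℂ) (w θ : ℝ) : ℂ :=
  4*Complex.sinh ((1-μ)*θ)*Complex.sinh (z*((2*Real.sqrt w*Real.sinh θ:ℝ):ℂ))*
    cexp (-w-((2*Real.sqrt w*Real.sinh θ:ℝ):ℂ)^2/2)*(w:ℂ)^(-ν-1/2-μ/2)

noncomputable def Mv (μ : ℂ) (w v : ℝ) : ℂ :=
    ((Real.sqrt 2 : ℝ) : ℂ)⁻¹ / 2 * cexp (-w - (v:ℂ)^2/2) * Gamma ((3 - μ)/2) *
      ∫ r in Ioo (0:ℝ) 1, (r:ℂ) ^ ((μ - 1)/2) * ((1 - r : ℝ):ℂ) ^ (-μ/2) *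
        ((w + r * v^2/4 : ℝ) : ℂ) ^ ((μ - 3)/2)

lemma v_int {ν μ c : ℂ} (z : ℂ) (hμ0 : -1 < μ.re) (hμ1 : μ.re < 1) (hc : c = 1 - ν - μ)
    {w : ℝ} (hw : 0 < w) :
    ∫ v in Ioi (0:ℝ), ((w:ℂ)^(c-1) * ((v:ℂ)*Complex.sinh (z*v))) * Mv μ w v =
    (((Real.sqrt 2 : ℝ) : ℂ)⁻¹ / 4 * Gamma ((1-μ)/2) * I ((μ-1)/2) (-μ/2) ((μ-3)/2) 0) *
      ∫ θ in Ioi (0:ℝ), Jg ν μ z w θ := by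
  have hb : (1 - μ) ≠ 0 := by
    intro h; have := congrArg Complex.re h; simp at this; linarith
  have hG : Gamma ((3-μ)/2) = (1-μ)/2 * Gamma ((1-μ)/2) := by
    rw [← Complex.Gamma_add_one _ (div_ne_zero hb two_ne_zero)]; congr 1; ring
  rw [subst_v hw, ← integral_const_mul]
  refine setIntegral_congr_fun measurableSet_Ioi fun θ _ => ?_
  have hE := euler_hyp (β := (μ-1)/2) (γ := -μ/2) (δ := (μ-3)/2) (b := 1-μ) (by simp; linarith)
    (by simp; linarith) (by ring) (by ring) (by ring) hb θ
  have hwc : (w:ℂ) ≠ 0 := by exact_mod_cast hw.ne'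
  have hpw : (w:ℂ)^(-ν-1/2-μ/2) = (w:ℂ)^(c-1) * w * (w:ℂ)^((μ-3)/2) := by
    nth_rewrite 3 [← Complex.cpow_one (w:ℂ)]
    rw [← Complex.cpow_add _ _ hwc, ← Complex.cpow_add _ _ hwc, hc]; congr 1; ring
  have hs : ((Real.sqrt w:ℝ):ℂ)^2 = w := by rw [← ofReal_pow, Real.sq_sqrt hw.le]
  simp only [Mv, Jg]
  rw [I_scale hw, hG, hpw]
  generalize cexp (-w-((2*Real.sqrt w*Real.sinh θ:ℝ):ℂ)^2/2) = e1
  generalize Complex.sinh (z*((2*Real.sqrt w*Real.sinh θ:ℝ):ℂ)) = e2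
  generalize (w:ℂ)^(c-1) = e3
  generalize (w:ℂ)^((μ-3)/2) = e4
  generalize I ((μ-1)/2) (-μ/2) ((μ-3)/2) (Real.sinh θ^2) = e5 at *
  generalize I ((μ-1)/2) (-μ/2) ((μ-3)/2) 0 = e6 at *
  simp only [ofReal_mul, ofReal_ofNat] at *
  generalize ((Real.sqrt w:ℝ):ℂ) = sw at *
  rw [← hs]
  linear_combination (sw^2 * e1 * e2 * e3 * e4 * (((Real.sqrt 2 : ℝ) : ℂ)⁻¹) * Gamma ((1-μ)/2)) * hE

lemma ae_pp : ∀ᵐ p ∂((volume.restrict (Ioi (0:ℝ))).prod (volume.restrict (Ioo (0:ℝ) 1))),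
      p ∈ Ioi (0:ℝ) ×ˢ Ioo (0:ℝ) 1 := by
  rw [Measure.prod_restrict]
  exact ae_restrict_mem (measurableSet_Ioi.prod measurableSet_Ioo)

lemma ae_yy : ∀ᵐ p ∂((volume.restrict (Ioi (0:ℝ))).prod (volume.restrict (Ioi (0:ℝ)))),
      p ∈ Ioi (0:ℝ) ×ˢ Ioi (0:ℝ) := by
  rw [Measure.prod_restrict]
  exact ae_restrict_mem (measurableSet_Ioi.prod measurableSet_Ioi)

lemma right_side {ν μ c : ℂ} (z : ℂ) (hν : ν.re < 0) (hμ0 : -1 < μ.re) (hμ1 : μ.re < 1) (hc : c = 1 - ν - μ) :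
    ∫ p, FF μ c z p ∂(((volume.restrict (Ioi (0:ℝ))).prod (volume.restrict (Ioo (0:ℝ) 1))).prod
      ((volume.restrict (Ioi (0:ℝ))).prod (volume.restrict (Ioi (0:ℝ))))) =
    (((Real.sqrt 2 : ℝ) : ℂ)⁻¹ / 4 * Gamma ((1-μ)/2) * I ((μ-1)/2) (-μ/2) ((μ-3)/2) 0) *
      ∫ w in Ioi (0:ℝ), ∫ θ in Ioi (0:ℝ), Jg ν μ z w θ := by
  have iF := intgl_FF z hν hμ0 hμ1 hc
  rw [integral_prod_symm _ iF]
  have hcon : (fun y => ∫ x, FF μ c z (x, y) ∂((volume.restrict (Ioi (0:ℝ))).prod (volume.restrict (Ioo (0:ℝ) 1))))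
     =ᵐ[(volume.restrict (Ioi (0:ℝ))).prod (volume.restrict (Ioi (0:ℝ)))]
     fun y => (((y.1:ℝ):ℂ)^(c-1) * ((y.2:ℂ)*Complex.sinh (z*y.2))) * Mv μ y.1 y.2 := by
    filter_upwards [ae_yy, iF.prod_left_ae] with y hy iy
    obtain ⟨w, v⟩ := y
    have hw : 0 < w := hy.1
    rw [integral_prod _ iy]
    simp only [Mv]
    rw [← M_eq hμ0 hμ1 hw, ← integral_const_mul]
    refine integral_congr_ae (Filter.Eventually.of_forall fun t => ?_)
    beta_reduce
    rw [← integral_const_mul]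
    refine integral_congr_ae (Filter.Eventually.of_forall fun u => ?_)
    simp only [FF, P, Q, Wf, Vf]
    rw [mul_comm (Real.exp (2*t)) w]
    ring
  rw [integral_congr_ae hcon, integral_prod _ (iF.integral_prod_right.congr hcon), ← integral_const_mul]
  exact setIntegral_congr_fun measurableSet_Ioi fun w hw => v_int z hμ0 hμ1 hc hw

lemma left_pt {ν μ c : ℂ} (z : ℂ) (hν : ν.re < 0) (hμ1 : μ.re < 1) (hc : c = 1 - ν - μ)
    {t u : ℝ} (ht : 0 < t) (hu : u ∈ Ioo (0:ℝ) 1) :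
    ∫ y, FF μ c z ((t,u),y) ∂((volume.restrict (Ioi (0:ℝ))).prod (volume.restrict (Ioi (0:ℝ)))) =
    (Gamma c * (((Real.sqrt (2*Real.pi):ℝ):ℂ)/2) * z * cexp (z^2/2)) *
    ((Complex.exp ((2 * ν + μ) * t) * ((Real.sinh (2 * t) : ℝ) : ℂ) ^ (-μ/2) *
          ((Real.sqrt (Real.tanh t) : ℝ) : ℂ)) *
      (Complex.exp (-(z^2 / 2) * (Real.tanh t : ℝ) * u) *
                (u:ℂ) ^ ((μ - 1)/2) * ((1:ℂ) - (u:ℂ)) ^ (-μ/2))) := by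
  have hcre : 0 < c.re := by rw [hc]; simp; linarith
  have hq := (q_mem ht hu).1
  have e1 : ∫ w in Ioi (0:ℝ), Wf c t w = cexp (-2*c*t) * Gamma c := by
    have := gamma_val (s := c - 1) (by simp; linarith) (Real.exp_pos (2*t))
    rw [sub_add_cancel, cpow_pos (Real.exp_pos _), Real.log_exp] at this
    unfold Wf
    rw [this]; congr 2; push_cast; ring
  have e2 : ∫ v in Ioi (0:ℝ), Vf z (1 - Real.tanh t * u) v = _ := gauss_val z hq
  simp only [FF]
  rw [integral_const_mul, integral_prod_mul, e1, e2]
  have a1 : ((1-Real.tanh t*u:ℝ):ℂ)^(-3/2:ℂ) * ((1-Real.tanh t*u:ℝ):ℂ) * ((Real.sqrt (1-Real.tanh t*u):ℝ):ℂ) = 1 := by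
    have hn : ((1-Real.tanh t*u:ℝ):ℂ) ≠ 0 := by exact_mod_cast hq.ne'
    rw [sqrt_eq_cpow hq.le]
    nth_rewrite 2 [← Complex.cpow_one ((1-Real.tanh t*u:ℝ):ℂ)]
    rw [← Complex.cpow_add _ _ hn, ← Complex.cpow_add _ _ hn]; norm_num
  have a2 : cexp (z^2*((1-Real.tanh t*u:ℝ):ℂ)/2) = cexp (z^2/2) * Complex.exp (-(z^2 / 2) * (Real.tanh t : ℝ) * u) := by
    rw [← Complex.exp_add]; congr 1; push_cast; ring
  have a3 : Complex.exp ((2 * ν + μ) * t) = cexp ((2-μ)*t) * cexp (-2*c*t) := by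
    rw [← Complex.exp_add, hc]; congr 1; ring
  have a4 : ((1-u:ℝ):ℂ) = 1 - (u:ℂ) := by push_cast; rfl
  rw [a2, a3, Real.sqrt_mul (by positivity), ofReal_mul]
  unfold P Q
  rw [a4]
  generalize ((1-Real.tanh t*u:ℝ):ℂ) = q at *
  linear_combination (cexp ((2-μ)*t) * ((Real.sinh (2*t):ℝ):ℂ)^(-μ/2) * ((Real.sqrt (Real.tanh t):ℝ):ℂ) *
    (u:ℂ)^((μ-1)/2) * (1-(u:ℂ))^(-μ/2) * cexp (-2*c*t) * Gamma c * (1/2) * z * ((Real.sqrt (2*Real.pi):ℝ):ℂ) *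
    cexp (z^2/2) * Complex.exp (-(z^2 / 2) * (Real.tanh t : ℝ) * u)) * a1

lemma left_side {ν μ c : ℂ} (z : ℂ) (hν : ν.re < 0) (hμ0 : -1 < μ.re) (hμ1 : μ.re < 1) (hc : c = 1 - ν - μ) :
    ∫ p, FF μ c z p ∂(((volume.restrict (Ioi (0:ℝ))).prod (volume.restrict (Ioo (0:ℝ) 1))).prod
      ((volume.restrict (Ioi (0:ℝ))).prod (volume.restrict (Ioi (0:ℝ))))) =
    (Gamma c * (((Real.sqrt (2*Real.pi):ℝ):ℂ)/2) * z * cexp (z^2/2)) *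
      ∫ t in Ioi (0:ℝ), (Complex.exp ((2 * ν + μ) * t) * ((Real.sinh (2 * t) : ℝ) : ℂ) ^ (-μ/2) *
          ((Real.sqrt (Real.tanh t) : ℝ) : ℂ)) *
       ∫ u in Ioo (0:ℝ) 1, (Complex.exp (-(z^2 / 2) * (Real.tanh t : ℝ) * u) *
                (u:ℂ) ^ ((μ - 1)/2) * ((1:ℂ) - (u:ℂ)) ^ (-μ/2)) := by
  have iF := intgl_FF z hν hμ0 hμ1 hc
  rw [integral_prod _ iF, integral_prod _ iF.integral_prod_left, ← integral_const_mul]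
  refine setIntegral_congr_fun measurableSet_Ioi fun t ht => ?_
  beta_reduce
  rw [← integral_const_mul, ← integral_const_mul]
  exact setIntegral_congr_fun measurableSet_Ioo fun u hu => left_pt z hν hμ1 hc ht hu

end Nich

theorem nicholson_type_integral_odd_part
    (ν μ z : ℂ) (hν : ν.re < 0) (hμ0 : -1 < μ.re) (hμ1 : μ.re < 1) :
    (1 / Complex.Gamma (1 - ν - μ)) *
      ((∫ s in Ioi (0:ℝ), Complex.exp (-z * s - (s:ℂ)^2 / 2) * (s:ℂ) ^ (-ν - 1)) *
        (∫ t in Ioi (0:ℝ), Complex.exp (z * t - (t:ℂ)^2 / 2) * (t:ℂ) ^ (-ν - μ)) -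
       (∫ s in Ioi (0:ℝ), Complex.exp (z * s - (s:ℂ)^2 / 2) * (s:ℂ) ^ (-ν - 1)) *
        (∫ t in Ioi (0:ℝ), Complex.exp (-z * t - (t:ℂ)^2 / 2) * (t:ℂ) ^ (-ν - μ))) =
    (4 * z * ((Real.sqrt Real.pi : ℝ) : ℂ) / Complex.Gamma ((1 - μ)/2)) *
      Complex.exp (z^2 / 2) *
      ∫ t in Ioi (0:ℝ),
        Complex.exp ((2 * ν + μ) * t) * ((Real.sinh (2 * t) : ℝ) : ℂ) ^ (-μ/2) *
          ((Real.sqrt (Real.tanh t) : ℝ) : ℂ) *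
          ((Complex.Gamma (3/2) /
              (Complex.Gamma ((1 + μ)/2) * Complex.Gamma (1 - μ/2))) *
            ∫ u in Ioo (0:ℝ) 1,
              Complex.exp (-(z^2 / 2) * (Real.tanh t : ℝ) * u) *
                (u:ℂ) ^ ((μ - 1)/2) * ((1:ℂ) - (u:ℂ)) ^ (-μ/2)) := by
  have hR := Nich.right_side z hν hμ0 hμ1 rfl
  rw [Nich.left_side z hν hμ0 hμ1 rfl] at hR
  rw [Nich.J_eq z hν hμ1]
  simp only [Nich.Jg] at hR
  have g1 : Complex.Gamma (1 - ν - μ) ≠ 0 := Complex.Gamma_ne_zero_of_re_pos (by simp; linarith)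
  have g2 : Complex.Gamma ((1 - μ)/2) ≠ 0 := Complex.Gamma_ne_zero_of_re_pos (by simp; linarith)
  have g3 : Complex.Gamma ((1 + μ)/2) ≠ 0 := Complex.Gamma_ne_zero_of_re_pos (by simp; linarith)
  have g4 : Complex.Gamma (1 - μ/2) ≠ 0 := Complex.Gamma_ne_zero_of_re_pos (by simp; linarith)
  have g5 : Complex.Gamma (3/2) ≠ 0 := Complex.Gamma_ne_zero_of_re_pos (by norm_num)
  have hB : Nich.I ((μ-1)/2) (-μ/2) ((μ-3)/2) 0 =
      Complex.Gamma ((1 + μ)/2) * Complex.Gamma (1 - μ/2) / Complex.Gamma (3/2) := by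
    have := Nich.beta_eq (β := (μ-1)/2) (γ := -μ/2) (by simp; linarith) (by simp; linarith)
    rw [show (μ-1)/2+1 = (1+μ)/2 by ring, show -μ/2+1 = 1-μ/2 by ring,
      show (1+μ)/2 + (1-μ/2) = 3/2 by ring] at this
    rw [← this]
    simp [Nich.I]
  rw [hB] at hR
  have hsum : ∀ (a : ℝ → ℂ) (k : ℂ) (b : ℝ → ℂ), ∫ t in Ioi (0:ℝ), a t * (k * b t) =
      k * ∫ t in Ioi (0:ℝ), a t * b t := by
    intro a k b
    rw [← integral_const_mul]; congr 1; funext t; ring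
  rw [hsum]
  have h2 : ((Real.sqrt 2 : ℝ):ℂ) ≠ 0 := by
    have : Real.sqrt 2 ≠ 0 := by positivity
    exact_mod_cast this
  have h22 : ((Real.sqrt 2 : ℝ):ℂ)^2 = 2 := by
    rw [← ofReal_pow, Real.sq_sqrt zero_le_two]; norm_num
  rw [Real.sqrt_mul zero_le_two, ofReal_mul] at hR
  generalize (∫ w in Ioi (0:ℝ), ∫ θ in Ioi (0:ℝ), _ : ℂ) = J at *
  generalize (∫ t in Ioi (0:ℝ), _ : ℂ) = X at *
  generalize ((Real.sqrt 2 : ℝ):ℂ) = s at *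
  generalize Complex.Gamma (1 - μ/2) = G4 at *
  generalize Complex.Gamma (3/2) = G5 at *
  generalize Complex.Gamma ((1 + μ)/2) = G3 at *
  generalize Complex.Gamma ((1 - μ)/2) = G2 at *
  generalize Complex.Gamma (1 - ν - μ) = G1 at *
  field_simp at hR ⊢
  linear_combination (-1/2) * hR + (2 * G1 * ((Real.sqrt Real.pi : ℝ) : ℂ) * z * cexp (z^2/2) * X * G5) * h22
end

section
/- Let ν, z ∈ ℂ with Re ν < 0, and define A = ∫₀^∞ e^(−z·t − t²/2) t^(−ν−1) dt, B = ∫₀^∞ e^(z·t − t²/2) t^(−ν−1) dt, A' = ∫₀^∞ (ln t)·e^(−z·t − t²/2) t^(−ν−1) dt, B' = ∫₀^∞ (ln t)·e^(z·t − t²/2) t^(−ν−1) dt (so that e^(−z²/2)·(B·A' − A·B')/Γ(−ν)² equals D_ν(z)·∂D_ν(−z)/∂ν − D_ν(−z)·∂D_ν(z)/∂ν). Then B·A' − A·B' = −(√(2π)/2) · z · Γ(−ν) · e^(z²/2) · ∫₀^∞ (e^((2ν+1)·t)/cosh t) · (∫₀^1 e^(−(z²/2)·tanh(t)·u) · (1−u)^(−1/2)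 du) dt. (This is identity (55): D_ν(z)·∂_ν D_ν(−z) − D_ν(−z)·∂_ν D_ν(z) = −(√(2π)·z/Γ(−ν)) ∫₀^∞ (e^((2ν+1)t)/cosh t) · Φ(1, 3/2; −(z²/2) tanh t) dt, using Φ(1,3/2;w) = (1/2)∫₀^1 e^(wu)(1−u)^(−1/2) du and the Laplace-integral representation of D_ν.) -/
open MeasureTheory Complex Set

lemma W_gauss_bigO (w : ℂ) (A : ℝ) :
    (fun t : ℝ => Complex.exp (w * t - (t:ℂ)^2 / 2)) =O[Filter.atTop] fun x : ℝ => x ^ (-A) := by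
  have h1 := (rpow_mul_exp_neg_mul_sq_isLittleO_exp_neg (b := 1/4) (by norm_num) A).isBigO
  have h1' : (fun x : ℝ => x ^ A * Real.exp (-(1/4) * x ^ 2)) =O[Filter.atTop] fun _ : ℝ => (1:ℝ) := by
    refine h1.trans ?_
    refine Asymptotics.IsBigO.of_bound 1 ?_
    filter_upwards [Filter.eventually_ge_atTop 0] with x hx
    rw [Real.norm_eq_abs, abs_of_pos (Real.exp_pos _)]
    simp only [norm_one, mul_one, Real.exp_le_one_iff]; linarith
  obtain ⟨C, hC⟩ := h1'.bound
  refine Asymptotics.IsBigO.of_bound (Real.exp (w.re ^ 2) * C) ?_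
  filter_upwards [hC, Filter.eventually_gt_atTop 0] with x hx hx0
  have hn : ‖Complex.exp (w * x - (x:ℂ)^2 / 2)‖ = Real.exp (w.re * x - x ^ 2 / 2) := by
    rw [Complex.norm_exp]; congr 1
    simp [pow_two]
  rw [hn, Real.norm_eq_abs, abs_of_pos (Real.rpow_pos_of_pos hx0 _), Real.rpow_neg hx0.le]
  rw [Real.norm_eq_abs, abs_of_pos (mul_pos (Real.rpow_pos_of_pos hx0 _) (Real.exp_pos _))] at hx
  simp only [norm_one, mul_one] at hx
  have hp := Real.rpow_pos_of_pos hx0 A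
  have : Real.exp (w.re * x - x ^ 2 / 2) ≤ Real.exp (w.re ^ 2) * Real.exp (-(1/4) * x^2) := by
    rw [← Real.exp_add]; apply Real.exp_le_exp.2
    nlinarith [sq_nonneg (w.re - x / 2)]
  refine this.trans ?_
  rw [mul_assoc]
  gcongr
  rw [← div_eq_mul_inv, le_div_iff₀ hp]; linarith

lemma W_int (w a : ℂ) (ha : 0 < a.re) :
    IntegrableOn (fun t : ℝ => Complex.exp (w * t - (t:ℂ)^2 / 2) * (t:ℂ) ^ (a - 1)) (Ioi 0) ∧
    IntegrableOn (fun t : ℝ => (Real.log t : ℂ) * Complex.exp (w * t - (t:ℂ)^2 / 2) * (t:ℂ) ^ (a - 1)) (Ioi 0) := by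
  have hc : Continuous (fun t : ℝ => Complex.exp (w * t - (t:ℂ)^2 / 2)) := by fun_prop
  have h0 : (fun t : ℝ => Complex.exp (w * t - (t:ℂ)^2 / 2)) =O[nhdsWithin 0 (Set.Ioi 0)] fun x : ℝ => x ^ (-(0:ℝ)) := by
    simp only [neg_zero, Real.rpow_zero]
    exact (hc.tendsto 0).isBigO_one ℝ |>.mono nhdsWithin_le_nhds
  have hl : LocallyIntegrableOn (fun t : ℝ => Complex.exp (w * t - (t:ℂ)^2 / 2)) (Ioi 0) :=
    hc.locallyIntegrable.locallyIntegrableOn _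
  constructor
  · have := mellinConvergent_of_isBigO_rpow hl (W_gauss_bigO w (a.re + 1)) (by linarith) h0 ha
    refine this.congr_fun (fun t _ => ?_) measurableSet_Ioi
    simp [mul_comm]
  · have := (mellin_hasDerivAt_of_isBigO_rpow hl (W_gauss_bigO w (a.re + 1)) (by linarith) h0 ha).1
    refine this.congr_fun (fun t _ => ?_) measurableSet_Ioi
    simp only [smul_eq_mul, Complex.real_smul]; ring

/-- scaling substitution with Fubini -/
lemma W_scale (F : ℝ × ℝ → ℂ) (hm : Measurable F)
    (hF : Integrable F ((volume.restrict (Ioi 0)).prod (volume.restrict (Ioi 0)))) :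
    ∫ s in Ioi (0:ℝ), ∫ t in Ioi (0:ℝ), F (s, t) =
      ∫ m in Ioi (0:ℝ), ∫ s in Ioi (0:ℝ), F (s, m * s⁻¹) * ((s⁻¹ : ℝ) : ℂ) := by
  have hs : ∀ s ∈ Ioi (0:ℝ), ∫ t in Ioi (0:ℝ), F (s, t) =
      ∫ m in Ioi (0:ℝ), F (s, m * s⁻¹) * ((s⁻¹ : ℝ) : ℂ) := by
    intro s hs
    have hs : 0 < s := hs
    rw [integral_mul_const, integral_comp_mul_right_Ioi (fun t => F (s, t)) 0 (inv_pos.2 hs)]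
    have : (s:ℂ) ≠ 0 := by exact_mod_cast hs.ne'
    simp; field_simp
  have hns : ∀ s ∈ Ioi (0:ℝ), ∫ t in Ioi (0:ℝ), ‖F (s, t)‖ =
      ∫ m in Ioi (0:ℝ), ‖F (s, m * s⁻¹) * ((s⁻¹ : ℝ) : ℂ)‖ := by
    intro s hs
    have hs : 0 < s := hs
    simp_rw [norm_mul]
    rw [integral_mul_const, integral_comp_mul_right_Ioi (fun t => ‖F (s, t)‖) 0 (inv_pos.2 hs)]
    simp [abs_of_pos hs]; field_simp
  rw [setIntegral_congr_fun measurableSet_Ioi hs]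
  apply integral_integral_swap
  rw [integrable_prod_iff]
  · constructor
    · filter_upwards [hF.prod_right_ae, ae_restrict_mem measurableSet_Ioi] with s h1 h2
      have h2 : 0 < s := h2
      simp only [Function.uncurry_apply_pair]
      refine Integrable.mul_const ?_ _
      have := (integrableOn_Ioi_comp_mul_right_iff (fun t => F (s, t)) 0 (inv_pos.2 h2)).2 (by simpa [IntegrableOn] using h1)
      exact this
    · have := hF.norm.integral_prod_left
      refine this.congr ?_
      filter_upwards [ae_restrict_mem measurableSet_Ioi] with s h2
      exact hns s h2
  · apply Measurable.aestronglyMeasurable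
    unfold Function.uncurry
    apply Measurable.mul
    · exact hm.comp (by fun_prop)
    · fun_prop

lemma W_subst (m : ℝ) (hm : 0 < m) (f : ℝ → ℂ) :
    ∫ s in Ioi (0:ℝ), ((1 + m / s ^ 2 : ℝ) : ℂ) * f (s - m / s) = ∫ p, f p := by
  have himg : (fun s : ℝ => s - m / s) '' Ioi 0 = univ := by
    refine eq_univ_of_forall fun p => ?_
    have h4 : 0 < p ^ 2 + 4 * m := by positivity
    have hq := Real.sq_sqrt h4.le
    set q := Real.sqrt (p ^ 2 + 4 * m)
    have hpq : |p| < q := by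
      apply Real.lt_sqrt_of_sq_lt; rw [sq_abs]; linarith
    have h := abs_lt.1 hpq
    refine ⟨(p + q) / 2, by simp only [mem_Ioi]; linarith, ?_⟩
    have : p + q ≠ 0 := by linarith
    simp only
    field_simp
    linarith [hq]
  have hd : ∀ x ∈ Ioi (0:ℝ), HasDerivWithinAt (fun s : ℝ => s - m / s) (1 + m / x ^ 2) (Ioi 0) x := by
    intro x hx
    have hx : x ≠ 0 := (ne_of_gt hx)
    have := (hasDerivAt_id x).sub (((hasDerivAt_inv hx)).const_mul m)
    convert! this.hasDerivWithinAt using 1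
    ring
  have hmono : MonotoneOn (fun s : ℝ => s - m / s) (Ioi 0) := by
    intro x hx y hy hxy
    have hx : 0 < x := hx
    simp only
    have : m / y ≤ m / x := by gcongr
    linarith
  have := integral_image_eq_integral_deriv_smul_of_monotoneOn measurableSet_Ioi hd hmono f
  rw [himg, setIntegral_univ] at this
  rw [this]
  simp [Complex.real_smul]

lemma W_beta_int : IntegrableOn (fun v : ℝ => (1 - v) ^ (-(1/2) : ℝ)) (Ioo 0 1) := by
  have := (intervalIntegral.intervalIntegrable_rpow' (a := 1) (b := 0) (r := -(1/2)) (by norm_num)).comp_sub_left 1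
  rw [intervalIntegrable_iff_integrableOn_Ioo_of_le (by norm_num)] at this
  simpa using this

lemma W_kernel (s t : ℝ) (hs : 0 < s) (ht : 0 < t) :
    ∫ v in Ioo (0:ℝ) 1, (1 - v) ^ (-(1/2) : ℝ) * ((s - t) / (4 * (s * t) + (s - t) ^ 2 * v)) =
      (Real.log s - Real.log t) / (s + t) := by
  have hpos : ∀ v ∈ Icc (0:ℝ) 1, 0 < 4 * (s * t) + (s - t) ^ 2 * v := by
    intro v hv; have := hv.1; positivity
  have hx : ∀ v ∈ Icc (0:ℝ) 1, 0 < (s + t) + (s - t) * √(1 - v) ∧ 0 < (s + t) - (s - t) * √(1 - v) := by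
    intro v hv
    have h0 := Real.sqrt_nonneg (1 - v)
    have h1 : √(1 - v) ≤ 1 := Real.sqrt_le_one.2 (by linarith [hv.1])
    constructor <;> nlinarith
  rw [← integral_Ioc_eq_integral_Ioo, ← intervalIntegral.integral_of_le (by norm_num)]
  rw [intervalIntegral.integral_eq_sub_of_hasDerivAt_of_le (by norm_num)
    (f := fun v => -(1 / (s + t)) * (Real.log ((s + t) + (s - t) * √(1 - v)) - Real.log ((s + t) - (s - t) * √(1 - v))))]
  · have h1 : s + t + (s - t) = 2 * s := by ring
    have h2 : s + t - (s - t) = 2 * t := by ring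
    simp only [sub_self, Real.sqrt_zero, mul_zero, add_zero, sub_zero, Real.sqrt_one, mul_one, h1, h2]
    rw [Real.log_mul (by norm_num) hs.ne', Real.log_mul (by norm_num) ht.ne']
    ring
  · apply ContinuousOn.mul continuousOn_const
    apply ContinuousOn.sub
    · exact ContinuousOn.log (by fun_prop) fun v hv => (hx v hv).1.ne'
    · exact ContinuousOn.log (by fun_prop) fun v hv => (hx v hv).2.ne'
  · intro v hv
    have hv' := Ioo_subset_Icc_self hv
    have h1v : 0 < 1 - v := by linarith [hv.2]
    have hsq : HasDerivAt (fun v : ℝ => √(1 - v)) (-1 / (2 * √(1 - v))) v := by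
      have := ((hasDerivAt_id v).const_sub 1).sqrt h1v.ne'
      simpa using this
    have ha := ((hsq.const_mul (s - t)).const_add (s + t)).log (hx v hv').1.ne'
    have hb := ((hsq.const_mul (s - t)).const_sub (s + t)).log (hx v hv').2.ne'
    have := (ha.sub hb).const_mul (-(1 / (s + t)))
    convert! this using 1
    have e : (1 - v) ^ (-(1/2) : ℝ) = (√(1 - v))⁻¹ := by
      rw [Real.sqrt_eq_rpow, ← Real.rpow_neg h1v.le]
    rw [e]
    have hr : 0 < √(1 - v) := Real.sqrt_pos.2 h1v
    have hrs := Real.sq_sqrt h1v.le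
    have e2 := (hx v hv').1.ne'
    have e3 := (hx v hv').2.ne'
    have e4 : 4 * (s * t) + (s - t) ^ 2 * v = ((s + t) + (s - t) * √(1 - v)) * ((s + t) - (s - t) * √(1 - v)) := by
      linear_combination (s - t) ^ 2 * hrs
    rw [e4]
    have e5 : s + t ≠ 0 := by positivity
    have e6 : ((s + t) + (s - t) * √(1 - v)) + ((s + t) - (s - t) * √(1 - v)) = 2 * (s + t) := by ring
    generalize (s + t) + (s - t) * √(1 - v) = X at *
    generalize (s + t) - (s - t) * √(1 - v) = Y at *
    clear hsq ha hb this
    generalize √(1 - v) = r at *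
    field_simp
    linear_combination (-(s - t)) * e6
  · rw [intervalIntegrable_iff_integrableOn_Ioo_of_le (by norm_num)]
    have hc : ContinuousOn (fun v : ℝ => (s - t) / (4 * (s * t) + (s - t) ^ 2 * v)) (Icc 0 1) :=
      ContinuousOn.div (by fun_prop) (by fun_prop) fun v hv => (hpos v hv).ne'
    obtain ⟨C, hC⟩ := isCompact_Icc.exists_bound_of_continuousOn hc
    refine Integrable.mul_bdd W_beta_int (c := C) ?_ ?_
    · exact (hc.mono Ioo_subset_Icc_self).aestronglyMeasurable measurableSet_Ioo
    · filter_upwards [ae_restrict_mem measurableSet_Ioo] with v hv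
      exact hC v (Ioo_subset_Icc_self hv)

/-- The four-variable kernel. -/
noncomputable def WG (a z : ℂ) (x : (ℝ × ℝ) × (ℝ × ℝ)) : ℂ :=
  (((x.1.1 : ℂ) ^ (a - 1) * Complex.exp (-((1 + x.2.2 : ℝ) * (x.1.1 : ℂ)))) *
    ((x.1.2 : ℂ) * Complex.exp (z * x.1.2 - ((1 + x.2.2 * x.2.1 / 2 : ℝ) : ℂ) * (x.1.2 : ℂ) ^ 2 / 2))) *
    (((1 - x.2.1) ^ (-(1/2) : ℝ) : ℝ) : ℂ)

noncomputable def WY : Measure (ℝ × ℝ) := (volume.restrict (Ioo (0:ℝ) 1)).prod (volume.restrict (Ioi (0:ℝ)))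
noncomputable def WX : Measure (ℝ × ℝ) := (volume.restrict (Ioi (0:ℝ))).prod volume

lemma W_inner (a z : ℂ) (m p : ℝ) (hm : 0 < m) :
    ∫ Y, WG a z ((m, p), Y) ∂WY =
      (m:ℂ) ^ (a - 1) * Complex.exp (-m) * Complex.exp (z * p - (p:ℂ) ^ 2 / 2) *
       ((4 * ∫ v in Ioo (0:ℝ) 1, (1 - v) ^ (-(1/2) : ℝ) * (p / (4 * m + p ^ 2 * v)) : ℝ) : ℂ) := by
  have e : ∀ Y : ℝ × ℝ, WG a z ((m, p), Y) =
      (m:ℂ) ^ (a - 1) * Complex.exp (-m) * Complex.exp (z * p - (p:ℂ) ^ 2 / 2) *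
       (((1 - Y.1) ^ (-(1/2) : ℝ) * (p * Real.exp (-(m + p ^ 2 * Y.1 / 4) * Y.2)) : ℝ) : ℂ) := by
    intro Y
    have : Complex.exp (-((1 + Y.2 : ℝ) * (m : ℂ))) * Complex.exp (z * p - ((1 + Y.2 * Y.1 / 2 : ℝ) : ℂ) * (p : ℂ) ^ 2 / 2)
      = Complex.exp (-m) * Complex.exp (z * p - (p:ℂ) ^ 2 / 2) * Complex.exp (((-(m + p ^ 2 * Y.1 / 4) * Y.2 : ℝ) : ℂ)) := by
      rw [← Complex.exp_add, ← Complex.exp_add, ← Complex.exp_add]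
      congr 1
      push_cast; ring
    unfold WG
    simp only
    push_cast at *
    linear_combination ((m:ℂ) ^ (a - 1) * p * (((1 - Y.1) ^ (-(1/2) : ℝ) : ℝ) : ℂ)) * this
  simp_rw [e]
  rw [integral_const_mul, integral_complex_ofReal]
  congr 2
  have hint : Integrable (fun Y : ℝ × ℝ => (1 - Y.1) ^ (-(1/2) : ℝ) * (p * Real.exp (-(m + p ^ 2 * Y.1 / 4) * Y.2))) WY := by
    have h1 : Integrable (fun Y : ℝ × ℝ => (1 - Y.1) ^ (-(1/2) : ℝ) * (|p| * Real.exp (-m * Y.2))) WY :=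
      Integrable.mul_prod (f := fun v : ℝ => (1 - v) ^ (-(1/2) : ℝ)) (g := fun y : ℝ => |p| * Real.exp (-m * y))
        W_beta_int ((exp_neg_integrableOn_Ioi 0 hm).const_mul _)
    refine h1.mono' ?_ ?_
    · apply Measurable.aestronglyMeasurable; fun_prop
    · have : ∀ᵐ Y ∂WY, Y ∈ Ioo (0:ℝ) 1 ×ˢ Ioi (0:ℝ) := by
        rw [WY, Measure.prod_restrict]
        exact ae_restrict_mem (measurableSet_Ioo.prod measurableSet_Ioi)
      filter_upwards [this] with Y hY
      have h1 := hY.1.1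
      have h2 := hY.1.2
      have h3 : 0 < Y.2 := hY.2
      have h4 : 0 < 1 - Y.1 := by linarith
      rw [norm_mul, norm_mul, Real.norm_eq_abs, Real.norm_eq_abs, Real.norm_eq_abs, abs_of_pos (Real.exp_pos _),
        abs_of_pos (Real.rpow_pos_of_pos h4 _)]
      gcongr
      have : 0 ≤ p ^ 2 * Y.1 / 4 := by positivity
      linarith
  rw [WY, integral_prod _ hint, ← integral_const_mul]
  refine setIntegral_congr_fun measurableSet_Ioo fun v hv => ?_
  have hk : 0 < m + p ^ 2 * v / 4 := by have := hv.1; positivity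
  simp only
  rw [integral_const_mul, integral_const_mul, integral_exp_mul_Ioi (by linarith)]
  have : 4 * m + p ^ 2 * v ≠ 0 := by linarith
  have e : m + p ^ 2 * v / 4 = (4 * m + p ^ 2 * v) / 4 := by ring
  rw [e]
  simp
  field_simp

lemma W_lhs (a z : ℂ) (ha : 0 < a.re) :
    (∫ t in Ioi (0:ℝ), Complex.exp (z * t - (t:ℂ)^2 / 2) * (t:ℂ) ^ (a - 1)) *
    (∫ t in Ioi (0:ℝ), (Real.log t : ℂ) * Complex.exp (-z * t - (t:ℂ)^2 / 2) * (t:ℂ) ^ (a - 1)) -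
    (∫ t in Ioi (0:ℝ), Complex.exp (-z * t - (t:ℂ)^2 / 2) * (t:ℂ) ^ (a - 1)) *
    (∫ t in Ioi (0:ℝ), (Real.log t : ℂ) * Complex.exp (z * t - (t:ℂ)^2 / 2) * (t:ℂ) ^ (a - 1)) =
    ∫ m in Ioi (0:ℝ), ∫ p, -(1/4 : ℂ) * ∫ Y, WG a z ((m, p), Y) ∂WY := by
  set P := fun t : ℝ => Complex.exp (z * t - (t:ℂ)^2 / 2) * (t:ℂ) ^ (a - 1) with hP
  set Q := fun t : ℝ => Complex.exp (-z * t - (t:ℂ)^2 / 2) * (t:ℂ) ^ (a - 1) with hQ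
  set P' := fun t : ℝ => (Real.log t : ℂ) * Complex.exp (z * t - (t:ℂ)^2 / 2) * (t:ℂ) ^ (a - 1) with hP'
  set Q' := fun t : ℝ => (Real.log t : ℂ) * Complex.exp (-z * t - (t:ℂ)^2 / 2) * (t:ℂ) ^ (a - 1) with hQ'
  have iP := W_int z a ha
  have iQ := W_int (-z) a ha
  have i1 := Integrable.mul_prod (f := P) (g := Q') iP.1 iQ.2
  have i2 := Integrable.mul_prod (f := P') (g := Q) iP.2 iQ.1
  rw [mul_comm (∫ t in Ioi (0:ℝ), Q t), ← integral_prod_mul, ← integral_prod_mul, ← integral_sub i1 i2,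
    integral_prod (fun x : ℝ × ℝ => P x.1 * Q' x.2 - P' x.1 * Q x.2) (i1.sub i2)]
  have mP : Measurable P := by fun_prop
  have mQ : Measurable Q := by fun_prop
  have mP' : Measurable P' := by fun_prop
  have mQ' : Measurable Q' := by fun_prop
  rw [W_scale (fun x => P x.1 * Q' x.2 - P' x.1 * Q x.2) (by fun_prop) (i1.sub i2)]
  refine setIntegral_congr_fun measurableSet_Ioi fun m hm => ?_
  have hm : 0 < m := hm
  try simp only
  rw [← W_subst m hm]
  refine setIntegral_congr_fun measurableSet_Ioi fun s hs => ?_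
  have hs : 0 < s := hs
  try simp only
  rw [W_inner a z m _ hm]
  obtain ⟨t, ht, rfl⟩ : ∃ t, 0 < t ∧ m = s * t := ⟨m / s, by positivity, by field_simp⟩
  have e1 : s * t * s⁻¹ = t := by field_simp
  have e2 : s * t / s = t := by field_simp
  rw [e1, e2, W_kernel s t hs ht]
  have e3 : 1 + s * t / s ^ 2 = (s + t) * s⁻¹ := by field_simp
  rw [e3]
  simp only [hP, hQ, hP', hQ']
  have e4 : ((s * t : ℝ) : ℂ) ^ (a - 1) = (s:ℂ) ^ (a - 1) * (t:ℂ) ^ (a - 1) := by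
    rw [Complex.ofReal_mul, Complex.mul_cpow_ofReal_nonneg hs.le ht.le]
  rw [e4]
  have e5 : Complex.exp (z * s - (s:ℂ)^2 / 2) * Complex.exp (-z * t - (t:ℂ)^2 / 2) =
    Complex.exp (-((s * t : ℝ) : ℂ)) * Complex.exp (z * ((s - t : ℝ) : ℂ) - ((s - t : ℝ) : ℂ)^2 / 2) := by
    rw [← Complex.exp_add, ← Complex.exp_add]
    congr 1
    push_cast; ring
  have hs' : (s:ℂ) ≠ 0 := by exact_mod_cast hs.ne'
  have hst : (s:ℂ) + t ≠ 0 := by exact_mod_cast (by positivity : s + t ≠ 0)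
  have e6 : (((s + t) * s⁻¹ : ℝ) : ℂ) * ((4 * ((Real.log s - Real.log t) / (s + t)) : ℝ) : ℂ)
      = 4 * (s:ℂ)⁻¹ * (Real.log s - Real.log t) := by
    push_cast; field_simp
  have e7 : ((s⁻¹ : ℝ) : ℂ) = (s:ℂ)⁻¹ := by push_cast; rfl
  rw [e7]
  linear_combination ((Real.log t : ℂ) - Real.log s) * (s:ℂ)⁻¹ * ((s:ℂ) ^ (a - 1) * (t:ℂ) ^ (a - 1)) * e5 +
    (1/4 : ℂ) * ((s:ℂ) ^ (a - 1) * (t:ℂ) ^ (a - 1)) * (Complex.exp (-((s * t : ℝ) : ℂ)) * Complex.exp (z * ((s - t : ℝ) : ℂ) - ((s - t : ℝ) : ℂ)^2 / 2)) * e6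

lemma W_exp_le (x δ : ℝ) (hx : 0 < x) (h0 : 0 ≤ δ) (h1 : δ ≤ 1) : Real.exp (-x) ≤ x ^ (-δ) := by
  rw [Real.exp_neg, Real.rpow_neg hx.le]
  apply inv_anti₀ (Real.rpow_pos_of_pos hx _)
  have := Real.add_one_le_exp x
  rcases le_total x 1 with h | h
  · exact (Real.rpow_le_one hx.le h h0).trans (by linarith)
  · calc x ^ δ ≤ x ^ (1:ℝ) := Real.rpow_le_rpow_of_exponent_le h h1
      _ ≤ _ := by rw [Real.rpow_one]; linarith

lemma W_even (g : ℝ → ℝ) (hg : IntegrableOn g (Ioi 0)) : Integrable (fun p : ℝ => g |p|) := by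
  have h1 : Integrable ((Ioi (0:ℝ)).indicator g) := (integrable_indicator_iff measurableSet_Ioi).2 hg
  have h2 := h1.comp_neg
  refine (h1.add h2).congr ?_
  filter_upwards [compl_mem_ae_iff.2 (measure_singleton (μ := (volume : Measure ℝ)) (0:ℝ))] with p hp
  rcases lt_or_gt_of_ne (show p ≠ 0 from hp) with h | h
  · have h' : ¬ (0 < p) := by linarith
    simp [Set.indicator, h, h', abs_of_neg h]
  · have h' : ¬ (p < 0) := by linarith
    simp [Set.indicator, h, h', abs_of_pos h]

lemma W_F1 (α ε : ℝ) (h : 2 * ε < α) :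
    IntegrableOn (fun m : ℝ => m ^ (α - 1) * (Real.exp (-m / 2) * (m / 2) ^ (-(2 * ε)))) (Ioi 0) := by
  have := (integrableOn_rpow_mul_exp_neg_mul_rpow (p := 1) (s := α - 1 - 2 * ε) (b := 1/2) (by linarith) (by norm_num) (by norm_num)).const_mul
    ((2:ℝ) ^ (2 * ε))
  refine IntegrableOn.congr_fun this (fun m hm => ?_) measurableSet_Ioi
  have hm : 0 < m := hm
  rw [Real.rpow_one, Real.div_rpow hm.le (by norm_num), Real.rpow_sub hm (α - 1),
    Real.rpow_neg hm.le, Real.rpow_neg (by norm_num : (0:ℝ) ≤ 2)]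
  have := Real.rpow_pos_of_pos (show (0:ℝ) < 2 by norm_num) (2 * ε)
  have := Real.rpow_pos_of_pos hm (2 * ε)
  have e : -(1/2) * m = -m / 2 := by ring
  rw [e]
  field_simp

lemma W_F2 (ξ ε : ℝ) (h : 0 < ε) :
    Integrable (fun p : ℝ => |p| * ((p ^ 2 / 4) ^ (-(1 - ε)) * Real.exp (ξ * p - p ^ 2 / 4))) := by
  have h0 := W_even _ (integrableOn_rpow_mul_exp_neg_mul_sq (b := 1/8) (s := -1 + 2 * ε) (by norm_num) (by linarith))
  have := h0.const_mul ((4:ℝ) ^ (1 - ε) * Real.exp (2 * ξ ^ 2))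
  refine this.mono' (by apply Measurable.aestronglyMeasurable; fun_prop) ?_
  filter_upwards [compl_mem_ae_iff.2 (measure_singleton (μ := (volume : Measure ℝ)) (0:ℝ))] with p hp
  have hp : p ≠ 0 := hp
  have hp' : 0 < |p| := abs_pos.2 hp
  have e1 : (p ^ 2 / 4) ^ (-(1 - ε)) = (4:ℝ) ^ (1 - ε) * |p| ^ (-2 + 2 * ε) := by
    rw [Real.div_rpow (by positivity) (by norm_num), ← sq_abs, ← Real.rpow_natCast, ← Real.rpow_mul hp'.le,
      Real.rpow_neg (by norm_num) (1 - ε)]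
    have := Real.rpow_pos_of_pos (show (0:ℝ) < 4 by norm_num) (1 - ε)
    have e : ((2:ℕ):ℝ) * -(1 - ε) = -2 + 2 * ε := by push_cast; ring
    rw [e]
    field_simp
  have e2 : |p| ^ (-1 + 2 * ε) = |p| * |p| ^ (-2 + 2 * ε) := by
    have : -1 + 2 * ε = 1 + (-2 + 2 * ε) := by ring
    rw [this, Real.rpow_add hp', Real.rpow_one]
  rw [Real.norm_eq_abs, abs_of_nonneg (by positivity), e1, e2]
  have e3 : Real.exp (ξ * p - p ^ 2 / 4) ≤ Real.exp (2 * ξ ^ 2) * Real.exp (-(1/8) * |p| ^ 2) := by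
    rw [← Real.exp_add, sq_abs]
    apply Real.exp_le_exp.2
    nlinarith [sq_nonneg (4 * ξ - p)]
  calc |p| * ((4:ℝ) ^ (1 - ε) * |p| ^ (-2 + 2 * ε) * Real.exp (ξ * p - p ^ 2 / 4))
      ≤ |p| * ((4:ℝ) ^ (1 - ε) * |p| ^ (-2 + 2 * ε) * (Real.exp (2 * ξ ^ 2) * Real.exp (-(1/8) * |p| ^ 2))) := by gcongr
    _ = _ := by ring

lemma W_F3 (ε : ℝ) (h : 0 < ε) :
    IntegrableOn (fun v : ℝ => v ^ (-(1 - ε)) * (1 - v) ^ (-(1/2) : ℝ)) (Ioo 0 1) := by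
  have := Complex.betaIntegral_convergent (u := ε) (v := (1/2 : ℝ)) (by simpa using h) (by simp)
  rw [intervalIntegrable_iff_integrableOn_Ioo_of_le (by norm_num)] at this
  refine IntegrableOn.congr_fun this.norm (fun v hv => ?_) measurableSet_Ioo
  have h1 : 0 < 1 - v := by linarith [hv.2]
  have e : (1:ℂ) - v = ((1 - v : ℝ) : ℂ) := by push_cast; rfl
  rw [norm_mul, e, Complex.norm_cpow_eq_rpow_re_of_pos hv.1, Complex.norm_cpow_eq_rpow_re_of_pos h1]
  congr 2
  · simp
  · simp; norm_num

lemma W_F4 (ε : ℝ) (h : 0 < ε) :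
    IntegrableOn (fun y : ℝ => (1 + y) ^ (-(1 + ε))) (Ioi 0) := by
  have := integrableOn_add_rpow_Ioi_of_lt (a := -(1 + ε)) (c := 0) (m := 1) (by linarith) (by norm_num)
  simpa [add_comm] using this

lemma W_G_int (a z : ℂ) (ha : 0 < a.re) : Integrable (WG a z) (WX.prod WY) := by
  obtain ⟨ε, he0, he1, he2⟩ : ∃ ε : ℝ, 0 < ε ∧ 2 * ε < a.re ∧ 2 * ε ≤ 1 := by
    refine ⟨min (a.re / 4) (1 / 4), by positivity, ?_, ?_⟩
    · linarith [min_le_left (a.re / 4) (1 / 4)]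
    · linarith [min_le_right (a.re / 4) (1 / 4)]
  have b := Integrable.mul_prod (Integrable.mul_prod (W_F1 a.re ε he1) (W_F2 z.re ε he0))
    (Integrable.mul_prod (W_F3 ε he0) (W_F4 ε he0))
  refine Integrable.mono' b ?_ ?_
  · apply Measurable.aestronglyMeasurable
    unfold WG
    fun_prop
  · have hae : ∀ᵐ x ∂(WX.prod WY), x ∈ (Ioi (0:ℝ) ×ˢ (univ : Set ℝ)) ×ˢ (Ioo (0:ℝ) 1 ×ˢ Ioi (0:ℝ)) := by
      have e : WX = volume.restrict (Ioi (0:ℝ) ×ˢ (univ : Set ℝ)) := by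
        rw [WX, Measure.volume_eq_prod, ← Measure.prod_restrict, Measure.restrict_univ]
      have e' : WY = volume.restrict (Ioo (0:ℝ) 1 ×ˢ Ioi (0:ℝ)) := by
        rw [WY, Measure.volume_eq_prod, ← Measure.prod_restrict]
      rw [e, e', Measure.prod_restrict]
      exact ae_restrict_mem ((measurableSet_Ioi.prod MeasurableSet.univ).prod (measurableSet_Ioo.prod measurableSet_Ioi))
    filter_upwards [hae] with x hx
    obtain ⟨⟨m, p⟩, ⟨v, y⟩⟩ := x
    obtain ⟨⟨hm, -⟩, ⟨⟨hv0, hv1⟩, hy⟩⟩ := hx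
    simp only [mem_Ioi] at hm hv0 hv1 hy
    simp only [WG]
    have h1v : 0 < 1 - v := by linarith
    have h1y : 0 < 1 + y := by linarith
    rcases eq_or_ne p 0 with rfl | hp
    · simp
    have n1 : ‖(m:ℂ) ^ (a - 1)‖ = m ^ (a.re - 1) := by
      rw [Complex.norm_cpow_eq_rpow_re_of_pos hm]; simp
    have n2 : ‖Complex.exp (-((1 + y : ℝ) * (m : ℂ)))‖ = Real.exp (-((1 + y) * m)) := by
      rw [Complex.norm_exp]; congr 1; rw [← Complex.ofReal_mul, Complex.neg_re, Complex.ofReal_re]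
    have n3 : ‖Complex.exp (z * p - ((1 + y * v / 2 : ℝ) : ℂ) * (p : ℂ) ^ 2 / 2)‖ =
        Real.exp (z.re * p - (1 + y * v / 2) * p ^ 2 / 2) := by
      rw [Complex.norm_exp]; congr 1
      have : ((1 + y * v / 2 : ℝ) : ℂ) * (p : ℂ) ^ 2 / 2 = (((1 + y * v / 2) * p ^ 2 / 2 : ℝ) : ℂ) := by push_cast; rfl
      rw [this, Complex.sub_re, Complex.ofReal_re, Complex.re_mul_ofReal]
    rw [norm_mul, norm_mul, norm_mul, norm_mul, n1, n2, n3, Complex.norm_real, Complex.norm_real, Real.norm_eq_abs,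
      Real.norm_eq_abs, abs_of_pos (Real.rpow_pos_of_pos h1v _)]
    have b1 : Real.exp (-((1 + y) * m)) ≤ Real.exp (-m / 2) * (m / 2) ^ (-(2 * ε)) * (1 + y) ^ (-(2 * ε)) := by
      have := W_exp_le ((m / 2) * (1 + y)) (2 * ε) (by positivity) (by linarith) he2
      rw [Real.mul_rpow (by positivity) h1y.le] at this
      rw [mul_assoc]
      refine le_trans ?_ (mul_le_mul_of_nonneg_left this (Real.exp_pos _).le)
      rw [← Real.exp_add]
      apply Real.exp_le_exp.2
      nlinarith [mul_pos hy hm]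
    have b2 : Real.exp (z.re * p - (1 + y * v / 2) * p ^ 2 / 2) ≤
        Real.exp (z.re * p - p ^ 2 / 4) * ((p ^ 2 / 4) ^ (-(1 - ε)) * v ^ (-(1 - ε)) * (1 + y) ^ (-(1 - ε))) := by
      have := W_exp_le ((p ^ 2 / 4) * v * (1 + y)) (1 - ε) (by positivity) (by linarith) (by linarith)
      rw [Real.mul_rpow (by positivity) h1y.le, Real.mul_rpow (by positivity) hv0.le] at this
      refine le_trans ?_ (mul_le_mul_of_nonneg_left this (Real.exp_pos _).le)
      rw [← Real.exp_add]
      apply Real.exp_le_exp.2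
      nlinarith [mul_nonneg (sq_nonneg p) h1v.le]
    have b3 : (1 + y) ^ (-(1 + ε)) = (1 + y) ^ (-(2 * ε)) * (1 + y) ^ (-(1 - ε)) := by
      rw [← Real.rpow_add h1y]; congr 1; ring
    rw [b3]
    calc _ ≤ m ^ (a.re - 1) * (Real.exp (-m / 2) * (m / 2) ^ (-(2 * ε)) * (1 + y) ^ (-(2 * ε))) *
          (|p| * (Real.exp (z.re * p - p ^ 2 / 4) * ((p ^ 2 / 4) ^ (-(1 - ε)) * v ^ (-(1 - ε)) * (1 + y) ^ (-(1 - ε))))) *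
          (1 - v) ^ (-(1/2) : ℝ) := by
          gcongr
      _ = _ := by ring

lemma W_gauss (z : ℂ) (b : ℝ) (hb : 0 < b) :
    ∫ p : ℝ, (p:ℂ) * Complex.exp (z * p - (b:ℂ) * (p:ℂ) ^ 2 / 2) =
      z * (Real.sqrt (2 * Real.pi) : ℝ) * ((b⁻¹ * (√b)⁻¹ : ℝ) : ℂ) * Complex.exp (z ^ 2 / 2 * (b⁻¹ : ℝ)) := by
  have hb' : (b:ℂ) ≠ 0 := by exact_mod_cast hb.ne'
  have e : ∀ p : ℝ, z * p - (b:ℂ) * (p:ℂ) ^ 2 / 2 = (-b/2 : ℂ) * (p:ℂ) ^ 2 + z * p + 0 := by intro p; ring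
  have hre : (-b/2 : ℂ).re < 0 := by
    have : (-b/2 : ℂ) = ((-b/2 : ℝ) : ℂ) := by push_cast; rfl
    rw [this, Complex.ofReal_re]; linarith
  have i1 : Integrable (fun p : ℝ => Complex.exp (z * p - (b:ℂ) * (p:ℂ) ^ 2 / 2)) := by
    simp_rw [e]; exact integrable_cexp_quadratic' hre _ _
  have i2 : Integrable (fun p : ℝ => (p:ℂ) * Complex.exp (z * p - (b:ℂ) * (p:ℂ) ^ 2 / 2)) := by
    have h0 := W_even _ (integrableOn_rpow_mul_exp_neg_mul_sq (b := b/4) (s := 1) (by positivity) (by linarith))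
    refine (h0.const_mul (Real.exp (z.re ^ 2 / b))).mono' (by fun_prop) ?_
    filter_upwards with p
    have n3 : ‖Complex.exp (z * p - (b : ℂ) * (p : ℂ) ^ 2 / 2)‖ =
        Real.exp (z.re * p - b * p ^ 2 / 2) := by
      rw [Complex.norm_exp]; congr 1
      have : (b : ℂ) * (p : ℂ) ^ 2 / 2 = ((b * p ^ 2 / 2 : ℝ) : ℂ) := by push_cast; rfl
      rw [this, Complex.sub_re, Complex.ofReal_re, Complex.re_mul_ofReal]
    rw [norm_mul, n3, Complex.norm_real, Real.norm_eq_abs, Real.rpow_one, sq_abs, mul_left_comm, ← Real.exp_add]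
    gcongr
    have : z.re ^ 2 / b + -(b/4) * p ^ 2 - (z.re * p - b * p ^ 2 / 2) = (z.re - b * p / 2) ^ 2 / b := by
      field_simp; ring
    have : 0 ≤ (z.re - b * p / 2) ^ 2 / b := by positivity
    linarith
  have hd : ∀ p : ℝ, HasDerivAt (fun p : ℝ => Complex.exp (z * p - (b:ℂ) * (p:ℂ) ^ 2 / 2))
      (z * Complex.exp (z * p - (b:ℂ) * (p:ℂ) ^ 2 / 2) - b * ((p:ℂ) * Complex.exp (z * p - (b:ℂ) * (p:ℂ) ^ 2 / 2))) p := by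
    intro p
    have h1 : HasDerivAt (fun w : ℂ => Complex.exp (z * w - (b:ℂ) * w ^ 2 / 2))
      (Complex.exp (z * p - (b:ℂ) * (p:ℂ) ^ 2 / 2) * (z * 1 - (b:ℂ) * (2 * p) / 2)) (p:ℂ) := by
      refine HasDerivAt.cexp ?_
      refine ((hasDerivAt_id _).const_mul z).sub ?_
      have := (((hasDerivAt_pow 2 (p:ℂ))).const_mul (b:ℂ)).div_const 2
      simpa using this
    have := h1.comp_ofReal
    refine this.congr_deriv ?_
    ring
  have h0 := integral_eq_zero_of_hasDerivAt_of_integrable hd ((i1.const_mul z).sub (i2.const_mul (b:ℂ))) i1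
  rw [integral_sub (i1.const_mul z) (i2.const_mul (b:ℂ)), integral_const_mul, integral_const_mul] at h0
  have h1 : ∫ p : ℝ, Complex.exp (z * p - (b:ℂ) * (p:ℂ) ^ 2 / 2) =
     ((Real.sqrt (2 * Real.pi) : ℝ) : ℂ) * (((√b)⁻¹ : ℝ) : ℂ) * Complex.exp (z ^ 2 / 2 * (b⁻¹ : ℝ)) := by
    simp_rw [e]
    rw [integral_cexp_quadratic hre]
    congr 1
    · have : (Real.pi : ℂ) / -(-b/2) = ((2 * Real.pi / b : ℝ) : ℂ) := by push_cast; field_simp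
      have e2 : (1/2 : ℂ) = ((1/2 : ℝ) : ℂ) := by push_cast; rfl
      rw [this, e2, ← Complex.ofReal_cpow (by positivity), ← Real.sqrt_eq_rpow, Real.sqrt_div (by positivity), ← Complex.ofReal_mul]
      rfl
    · congr 1; push_cast; field_simp; ring
  rw [h1] at h0
  have : ((b⁻¹ * (√b)⁻¹ : ℝ) : ℂ) = (b:ℂ)⁻¹ * (((√b)⁻¹ : ℝ) : ℂ) := by push_cast; rfl
  rw [this]
  apply mul_left_cancel₀ hb'
  have hbb : (b:ℂ) * (b:ℂ)⁻¹ = 1 := mul_inv_cancel₀ hb'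
  linear_combination -h0 - z * ((Real.sqrt (2 * Real.pi) : ℝ) : ℂ) * (((√b)⁻¹ : ℝ) : ℂ) * Complex.exp (z ^ 2 / 2 * (b⁻¹ : ℝ)) * hbb

/-- Moebius substitution in the inner integral. -/
lemma W_mobius (z : ℂ) (y : ℝ) (hy : 0 < y) :
    ∫ u in Ioo (0:ℝ) 1, Complex.exp (-(z^2 / 2) * (y / (2 + y) : ℝ) * u) * ((1:ℂ) - (u:ℂ)) ^ (-(1:ℂ)/2) =
    ((2 + y) / 2 : ℝ) * Complex.exp (-(z ^ 2 / 2)) * ∫ v in Ioo (0:ℝ) 1,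
      (((1 + y * v / 2)⁻¹ * (√(1 + y * v / 2))⁻¹ : ℝ) : ℂ) * Complex.exp (z ^ 2 / 2 * ((1 + y * v / 2)⁻¹ : ℝ)) *
        (((1 - v) ^ (-(1/2) : ℝ) : ℝ) : ℂ) := by
  set f : ℝ → ℝ := fun v => (2 + y) * v / (2 + y * v) with hf
  have hpos : ∀ v ∈ Ioo (0:ℝ) 1, 0 < 2 + y * v := by
    intro v hv; have := hv.1; positivity
  have himg : f '' Ioo 0 1 = Ioo 0 1 := by
    ext u
    constructor
    · rintro ⟨v, hv, rfl⟩
      have := hpos v hv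
      have h0 := hv.1
      have h1 := hv.2
      constructor
      · simp only [hf]; positivity
      · simp only [hf]; rw [div_lt_one this]; nlinarith
    · intro hu
      have h0 := hu.1
      have h1 := hu.2
      have hd : 0 < 2 + y * (1 - u) := by
        have : 0 < 1 - u := by linarith
        positivity
      refine ⟨2 * u / (2 + y * (1 - u)), ⟨by positivity, ?_⟩, ?_⟩
      · rw [div_lt_one hd]; nlinarith
      · simp only [hf]
        have e : 2 + y * (2 * u / (2 + y * (1 - u))) = 2 * (2 + y) / (2 + y * (1 - u)) := by
          field_simp; ring
        rw [e]
        field_simp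
  have hd : ∀ v ∈ Ioo (0:ℝ) 1, HasDerivWithinAt f (2 * (2 + y) / (2 + y * v) ^ 2) (Ioo 0 1) v := by
    intro v hv
    have h := hpos v hv
    have h1 : HasDerivAt (fun v : ℝ => (2 + y) * v) ((2 + y) * 1) v := (hasDerivAt_id v).const_mul _
    have h2 : HasDerivAt (fun v : ℝ => 2 + y * v) (y * 1) v := ((hasDerivAt_id v).const_mul y).const_add 2
    refine ((h1.div h2 h.ne').congr_deriv ?_).hasDerivWithinAt
    congr 1; ring
  have hmono : MonotoneOn f (Ioo 0 1) := by
    intro v hv w hw hvw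
    have h1 := hpos v hv
    have h2 := hpos w hw
    simp only [hf]
    rw [div_le_div_iff₀ h1 h2]
    nlinarith
  have key := integral_image_eq_integral_deriv_smul_of_monotoneOn measurableSet_Ioo hd hmono
    (fun u : ℝ => Complex.exp (-(z^2 / 2) * (y / (2 + y) : ℝ) * u) * ((1:ℂ) - (u:ℂ)) ^ (-(1:ℂ)/2))
  rw [himg] at key
  rw [key, ← integral_const_mul]
  refine setIntegral_congr_fun measurableSet_Ioo fun v hv => ?_
  have h := hpos v hv
  have h1v : 0 < 1 - v := by linarith [hv.2]
  set b := 1 + y * v / 2 with hb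
  have hb0 : 0 < b := by rw [hb]; have := hv.1; positivity
  have e2b : 2 + y * v = 2 * b := by rw [hb]; ring
  have e1 : 1 - f v = (1 - v) / b := by
    simp only [hf]; rw [e2b]; field_simp; rw [hb]; ring
  have e2 : ((1:ℂ) - (f v:ℂ)) ^ (-(1:ℂ)/2) = ((√b * (1 - v) ^ (-(1/2) : ℝ) : ℝ) : ℂ) := by
    have : (1:ℂ) - (f v:ℂ) = (((1 - v) / b : ℝ) : ℂ) := by rw [← e1]; push_cast; rfl
    have e' : (-(1:ℂ)/2) = ((-(1/2) : ℝ) : ℂ) := by push_cast; ring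
    rw [this, e', ← Complex.ofReal_cpow (by positivity), Real.div_rpow h1v.le hb0.le, Real.rpow_neg hb0.le, ← Real.sqrt_eq_rpow]
    congr 1
    have := Real.sqrt_pos.2 hb0
    field_simp
  have e3 : y / (2 + y) * f v = 1 - b⁻¹ := by
    simp only [hf]; rw [e2b]; field_simp; rw [hb]; ring
  have e4 : Complex.exp (-(z^2 / 2) * (y / (2 + y) : ℝ) * (f v : ℝ)) =
      Complex.exp (-(z ^ 2 / 2)) * Complex.exp (z ^ 2 / 2 * (b⁻¹ : ℝ)) := by
    rw [← Complex.exp_add, mul_assoc, ← Complex.ofReal_mul, e3]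
    congr 1; push_cast; ring
  have e5 : (2 * (2 + y) / (2 + y * v) ^ 2) * √b = (2 + y) / 2 * (b⁻¹ * (√b)⁻¹) := by
    rw [e2b]
    have := Real.sqrt_pos.2 hb0
    have hs := Real.sq_sqrt hb0.le
    field_simp
    rw [hs]
  have e5' : ((2 * (2 + y) / (2 + y * v) ^ 2 : ℝ) : ℂ) * ((√b : ℝ) : ℂ) = (((2 + y) / 2 : ℝ) : ℂ) * ((b⁻¹ * (√b)⁻¹ : ℝ) : ℂ) := by
    rw [← Complex.ofReal_mul, e5, Complex.ofReal_mul]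
  simp only [Complex.real_smul]
  rw [e2, e4, Complex.ofReal_mul (√b)]
  linear_combination (Complex.exp (-(z ^ 2 / 2)) * Complex.exp (z ^ 2 / 2 * (b⁻¹ : ℝ))) * (((1 - v) ^ (-(1/2) : ℝ) : ℝ) : ℂ) * e5'

lemma W_expsub (f : ℝ → ℂ) :
    ∫ y in Ioi (0:ℝ), f y = ∫ t in Ioi (0:ℝ), ((2 * Real.exp (2 * t) : ℝ) : ℂ) * f (Real.exp (2 * t) - 1) := by
  have himg : (fun t : ℝ => Real.exp (2 * t) - 1) '' Ioi 0 = Ioi 0 := by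
    ext y
    constructor
    · rintro ⟨t, ht, rfl⟩
      have ht : 0 < t := ht
      have : 1 < Real.exp (2 * t) := Real.one_lt_exp_iff.2 (by linarith)
      simp only [mem_Ioi]; linarith
    · intro hy
      have hy : 0 < y := hy
      refine ⟨Real.log (1 + y) / 2, ?_, ?_⟩
      · have := Real.log_pos (show 1 < 1 + y by linarith)
        simp only [mem_Ioi]; linarith
      · have : 2 * (Real.log (1 + y) / 2) = Real.log (1 + y) := by ring
        simp only [this]
        rw [Real.exp_log (by linarith)]; ring
  have hd : ∀ t ∈ Ioi (0:ℝ), HasDerivWithinAt (fun t : ℝ => Real.exp (2 * t) - 1) (2 * Real.exp (2 * t)) (Ioi 0) t := by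
    intro t _
    have := ((((hasDerivAt_id t).const_mul 2).exp).sub_const 1)
    refine (this.congr_deriv ?_).hasDerivWithinAt
    simp; ring
  have hmono : MonotoneOn (fun t : ℝ => Real.exp (2 * t) - 1) (Ioi 0) := by
    intro s _ t _ hst
    simp only
    gcongr
  have key := integral_image_eq_integral_deriv_smul_of_monotoneOn measurableSet_Ioi hd hmono f
  rw [himg] at key
  rw [key]
  simp only [Complex.real_smul]

theorem wronskian_type_identity_derivative_parameter
    (ν z : ℂ) (hν : ν.re < 0)
    (A B A' B' : ℂ)
    (hA : A = ∫ t in Ioi (0:ℝ), Complex.exp (-z * t - (t:ℂ)^2 / 2) * (t:ℂ) ^ (-ν - 1))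
    (hB : B = ∫ t in Ioi (0:ℝ), Complex.exp (z * t - (t:ℂ)^2 / 2) * (t:ℂ) ^ (-ν - 1))
    (hA' : A' = ∫ t in Ioi (0:ℝ),
        (Real.log t : ℂ) * Complex.exp (-z * t - (t:ℂ)^2 / 2) * (t:ℂ) ^ (-ν - 1))
    (hB' : B' = ∫ t in Ioi (0:ℝ),
        (Real.log t : ℂ) * Complex.exp (z * t - (t:ℂ)^2 / 2) * (t:ℂ) ^ (-ν - 1)) :
    B * A' - A * B' =
      -(((Real.sqrt (2 * Real.pi) : ℝ) : ℂ) / 2) * z * Complex.Gamma (-ν) *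
        Complex.exp (z^2 / 2) *
        ∫ t in Ioi (0:ℝ),
          (Complex.exp ((2 * ν + 1) * t) / ((Real.cosh t : ℝ) : ℂ)) *
            (∫ u in Ioo (0:ℝ) 1,
              Complex.exp (-(z^2 / 2) * (Real.tanh t : ℝ) * u) *
                ((1:ℂ) - (u:ℂ)) ^ (-(1:ℂ)/2)) := by
  have ha : 0 < (-ν).re := by simpa using hν
  rw [hA, hB, hA', hB', W_lhs (-ν) z ha]
  have hG := W_G_int (-ν) z ha
  have : SFinite WX := by unfold WX; infer_instance
  have : SFinite WY := by unfold WY; infer_instance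
  have hGX : Integrable (fun X => ∫ Y, WG (-ν) z (X, Y) ∂WY) WX := hG.integral_prod_left
  have hGY : Integrable (fun Y => ∫ X, WG (-ν) z (X, Y) ∂WX) WY := hG.integral_prod_right
  have s1 : ∫ m in Ioi (0:ℝ), ∫ p, -(1/4 : ℂ) * ∫ Y, WG (-ν) z ((m, p), Y) ∂WY =
      -(1/4 : ℂ) * ∫ X, ∫ Y, WG (-ν) z (X, Y) ∂WY ∂WX := by
    rw [← integral_const_mul]
    exact (integral_prod (fun X => -(1/4 : ℂ) * ∫ Y, WG (-ν) z (X, Y) ∂WY) (hGX.const_mul _)).symm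
  have s2 : ∫ X, ∫ Y, WG (-ν) z (X, Y) ∂WY ∂WX = ∫ Y, ∫ X, WG (-ν) z (X, Y) ∂WX ∂WY :=
    integral_integral_swap (f := fun X Y => WG (-ν) z (X, Y)) hG
  have s3 : ∫ Y, ∫ X, WG (-ν) z (X, Y) ∂WX ∂WY =
      ∫ y in Ioi (0:ℝ), ∫ v in Ioo (0:ℝ) 1, ∫ X, WG (-ν) z (X, (v, y)) ∂WX :=
    integral_prod_symm (fun Y => ∫ X, WG (-ν) z (X, Y) ∂WX) hGY
  have s4 : ∀ y ∈ Ioi (0:ℝ), ∫ v in Ioo (0:ℝ) 1, ∫ X, WG (-ν) z (X, (v, y)) ∂WX =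
      ((1 / ((1 + y : ℝ) : ℂ)) ^ (-ν) * Complex.Gamma (-ν)) * (z * (Real.sqrt (2 * Real.pi) : ℝ)) *
      ∫ v in Ioo (0:ℝ) 1,
      (((1 + y * v / 2)⁻¹ * (√(1 + y * v / 2))⁻¹ : ℝ) : ℂ) * Complex.exp (z ^ 2 / 2 * ((1 + y * v / 2)⁻¹ : ℝ)) *
        (((1 - v) ^ (-(1/2) : ℝ) : ℝ) : ℂ) := by
    intro y hy
    have hy : 0 < y := hy
    rw [← integral_const_mul]
    refine setIntegral_congr_fun measurableSet_Ioo fun v hv => ?_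
    have hb : 0 < 1 + y * v / 2 := by have := hv.1; positivity
    have := integral_prod_mul (μ := volume.restrict (Ioi (0:ℝ))) (ν := (volume : Measure ℝ))
      (fun m : ℝ => (m : ℂ) ^ (-ν - 1) * Complex.exp (-((1 + y : ℝ) * (m : ℂ))))
      (fun p : ℝ => (p : ℂ) * Complex.exp (z * p - ((1 + y * v / 2 : ℝ) : ℂ) * (p : ℂ) ^ 2 / 2))
    simp only [WG]
    rw [integral_mul_const]
    rw [WX, this, Complex.integral_cpow_mul_exp_neg_mul_Ioi ha (by linarith : (0:ℝ) < 1 + y), W_gauss z _ hb]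
    ring
  rw [s1, s2, s3, setIntegral_congr_fun measurableSet_Ioi s4, W_expsub, ← integral_const_mul, ← integral_const_mul]
  refine setIntegral_congr_fun measurableSet_Ioi fun t ht => ?_
  have ht : 0 < t := ht
  have hE : 1 < Real.exp (2 * t) := Real.one_lt_exp_iff.2 (by linarith)
  have hy : 0 < Real.exp (2 * t) - 1 := by linarith
  have e1 : Real.exp (2 * t) = Real.exp t * Real.exp t := by rw [← Real.exp_add]; congr 1; ring
  have htanh : Real.tanh t = (Real.exp (2 * t) - 1) / (2 + (Real.exp (2 * t) - 1)) := by
    have e' : 2 + (Real.exp (2 * t) - 1) = 1 + Real.exp (2 * t) := by ring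
    rw [e', Real.tanh_eq_sinh_div_cosh, Real.sinh_eq, Real.cosh_eq, Real.exp_neg, e1]
    have := Real.exp_pos t
    field_simp
    ring
  have hcosh : Real.cosh t = (1 + Real.exp (2 * t)) / (2 * Real.exp t) := by
    rw [Real.cosh_eq, Real.exp_neg, e1]
    have := Real.exp_pos t
    field_simp
    ring
  rw [htanh, W_mobius z _ hy, hcosh]
  have e2 : (1 / ((1 + (Real.exp (2 * t) - 1) : ℝ) : ℂ)) ^ (-ν) = Complex.exp (2 * ν * t) := by
    have : (1 / ((1 + (Real.exp (2 * t) - 1) : ℝ) : ℂ)) = Complex.exp ((-2 * t : ℝ)) := by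
      rw [← Complex.ofReal_exp]
      have : (-2 * t) = -(2 * t) := by ring
      rw [this, Real.exp_neg]; push_cast; ring
    rw [this, ← Complex.ofReal_exp, Complex.cpow_def_of_ne_zero (by exact_mod_cast (Real.exp_pos _).ne'),
      ← Complex.ofReal_log (Real.exp_pos _).le, Real.log_exp]
    congr 1; push_cast; ring
  rw [e2]
  have e3 : Complex.exp ((2 * ν + 1) * t) = Complex.exp (2 * ν * t) * (Real.exp t : ℝ) := by
    rw [Complex.ofReal_exp, ← Complex.exp_add]; congr 1; ring
  have e4 : Complex.exp (z ^ 2 / 2) * Complex.exp (-(z ^ 2 / 2)) = 1 := by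
    rw [← Complex.exp_add]; simp
  rw [e3]
  have e5 : ((Real.exp t : ℝ) : ℂ) / (((1 + Real.exp (2 * t)) / (2 * Real.exp t) : ℝ) : ℂ) * (((2 + (Real.exp (2 * t) - 1)) / 2 : ℝ) : ℂ)
      = ((Real.exp (2 * t) : ℝ) : ℂ) := by
    rw [← Complex.ofReal_div, ← Complex.ofReal_mul]
    congr 1
    rw [e1]
    have := Real.exp_pos t
    have : 0 < 1 + Real.exp t * Real.exp t := by positivity
    field_simp
    ring
  have e6 : ((2 * Real.exp (2 * t) : ℝ) : ℂ) = 2 * ((Real.exp (2 * t) : ℝ) : ℂ) := by push_cast; rfl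
  rw [e6]
  generalize (∫ v in Ioo (0:ℝ) 1,
      (((1 + (Real.exp (2 * t) - 1) * v / 2)⁻¹ * (√(1 + (Real.exp (2 * t) - 1) * v / 2))⁻¹ : ℝ) : ℂ) * Complex.exp (z ^ 2 / 2 * ((1 + (Real.exp (2 * t) - 1) * v / 2)⁻¹ : ℝ)) *
        (((1 - v) ^ (-(1/2) : ℝ) : ℝ) : ℂ)) = I
  rw [← e5, mul_div_assoc]
  generalize ((Real.exp t : ℝ) : ℂ) / (((1 + Real.exp (2 * t)) / (2 * Real.exp t) : ℝ) : ℂ) = q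
  generalize (((2 + (Real.exp (2 * t) - 1)) / 2 : ℝ) : ℂ) = r
  linear_combination ((Real.sqrt (2 * Real.pi) : ℝ) : ℂ) / 2 * z * Complex.Gamma (-ν) * Complex.exp (2 * ν * t) * q * r * I * e4
end

section
/- Let z ∈ ℝ and ν ∈ ℂ with Re ν > 0. Then (∫₀^∞ e^(−z·t − t²/2) t^(ν−1) dt) · (∫₀^∞ e^(z·t − t²/2) t^(ν−1) dt) = Γ(ν) · Σ_{n=0}^∞ He_n(z)² / (n!·(n+ν)), where the series converges. (This is the series expansion (61) for D₋ν(z)·D₋ν(−z) = (1/Γ(ν)) Σ_{n≥0} D_n(z)²/(n!(n+ν)), written using D₋ν(±z) = (e^(−z²/4)/Γ(ν)) ∫₀^∞ e^(∓zt−t²/2) t^(ν−1) dt and D_n(z) = e^(−z²/4)·He_n(z).) -/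
open MeasureTheory Complex Set

namespace PCH

lemma gauss (b : ℝ) (hb : 0 < b) (c d : ℂ) :
    ∫ x : ℝ, cexp (-(b:ℂ) * (x:ℂ)^2 + c * x + d) =
      ((√(Real.pi / b) : ℝ) : ℂ) * cexp (d + c^2 / (4 * b)) := by
  rw [integral_cexp_quadratic (by simpa using hb)]
  congr 1
  · rw [neg_neg, Real.sqrt_eq_rpow, Complex.ofReal_cpow (by positivity)]
    push_cast
    rfl
  · congr 1
    have : (b:ℂ) ≠ 0 := by exact_mod_cast hb.ne'
    field_simp
    ring

lemma derivative_hermite (n : ℕ) :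
    Polynomial.derivative (Polynomial.hermite (n+1)) = ((n:Polynomial ℤ)+1) * Polynomial.hermite n := by
  induction n with
  | zero => simp
  | succ n ih =>
    rw [Polynomial.hermite_succ (n+1), Polynomial.derivative_sub, Polynomial.derivative_mul, ih]
    have h2 : Polynomial.derivative (((n:Polynomial ℤ)+1) * Polynomial.hermite n)
      = ((n:Polynomial ℤ)+1) * Polynomial.derivative (Polynomial.hermite n) := by
      rw [Polynomial.derivative_mul]; simp
    rw [h2, Polynomial.hermite_succ n]
    simp
    ring

/-- Hermite value -/
noncomputable def H (z : ℝ) (n : ℕ) : ℝ := (Polynomial.aeval z) (Polynomial.hermite n)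

lemma H_rec (z : ℝ) (n : ℕ) : H z (n+2) = z * H z (n+1) - (n+1) * H z n := by
  unfold H
  rw [Polynomial.hermite_succ (n+1), derivative_hermite]
  simp

noncomputable def W (z y : ℝ) : ℂ := (z:ℂ) + y * I

lemma norm_W_sq (z y : ℝ) : ‖W z y‖^2 = z^2 + y^2 := by
  rw [← Complex.normSq_eq_norm_sq]; unfold W
  rw [Complex.normSq_add_mul_I]

lemma continuous_W (z : ℝ) : Continuous (W z) := by unfold W; fun_prop

noncomputable def G (y : ℝ) : ℂ := cexp (-(y:ℂ)^2/2)

lemma continuous_G : Continuous G := by unfold G; fun_prop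

lemma norm_G (y : ℝ) : ‖G y‖ = Real.exp (-y^2/2) := by
  unfold G
  rw [Complex.norm_exp]
  congr 1
  rw [show (-(y:ℂ)^2/2) = ((-y^2/2 : ℝ) : ℂ) by push_cast; rfl, Complex.ofReal_re]

lemma int_WG (z : ℝ) (n : ℕ) : Integrable (fun y => W z y ^ n * G y) := by
  have h := (integrable_exp_neg_mul_sq (b := 1/4) (by norm_num)).const_mul
    ((n.factorial : ℝ) * Real.exp (1 + z^2/4))
  refine h.mono' ?_ ?_
  · exact ((continuous_W z).pow n |>.mul continuous_G).aestronglyMeasurable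
  · refine Filter.Eventually.of_forall fun y => ?_
    rw [norm_mul, norm_pow, norm_G]
    have h1 := Real.pow_div_factorial_le_exp ‖W z y‖ (norm_nonneg _) n
    rw [div_le_iff₀ (by positivity)] at h1
    have h2 : Real.exp ‖W z y‖ ≤ Real.exp (1 + z^2/4 + y^2/4) := by
      apply Real.exp_le_exp.mpr
      nlinarith [sq_nonneg (‖W z y‖ - 2), norm_W_sq z y]
    calc ‖W z y‖ ^ n * Real.exp (-y^2/2)
        ≤ (Real.exp (1 + z^2/4 + y^2/4) * n.factorial) * Real.exp (-y^2/2) := by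
          gcongr
          exact h1.trans (by gcongr)
      _ = _ := by
          rw [show (1 + z^2/4 + y^2/4) = (1+z^2/4) + y^2/4 by ring, Real.exp_add (1+z^2/4),
            show -(1/4) * y^2 = y^2/4 + (-y^2/2) by ring, Real.exp_add (y^2/4)]
          ring

noncomputable def c (z : ℝ) (n : ℕ) : ℂ := ∫ y : ℝ, W z y ^ n * G y

lemma c_zero (z : ℝ) : c z 0 = ((√(2 * Real.pi) : ℝ) : ℂ) := by
  unfold c G
  have := gauss (1/2) (by norm_num) 0 0
  simp at this
  simp
  rw [mul_comm, ← this]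
  congr 1; ext y; congr 1; ring

lemma hasDeriv_W (z y : ℝ) : HasDerivAt (W z) I y := by
  unfold W
  have := ((hasDerivAt_id y).ofReal_comp.mul_const I).const_add (z:ℂ)
  simpa using this

lemma hasDeriv_G (y : ℝ) : HasDerivAt G (-(y:ℂ) * G y) y := by
  have h : HasDerivAt (fun y : ℝ => -((y:ℂ))^2/2) (-(y:ℂ)) y := by
    have := (((hasDerivAt_id y).ofReal_comp.pow 2).neg).div_const 2
    refine this.congr_deriv ?_
    simp
    ring
  have := h.cexp
  unfold G
  refine this.congr_deriv ?_
  ring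

lemma yW (z y : ℝ) : (y:ℂ) = -I * (W z y - z) := by
  unfold W
  linear_combination (y:ℂ) * I_sq

lemma ibp (z : ℝ) (n : ℕ) :
    c z (n+1) - z * c z n - ∫ y : ℝ, (-((n:ℂ) * W z y ^ (n-1) * G y)) = 0 := by
  have key := integral_eq_zero_of_hasDerivAt_of_integrable
    (f := fun y => W z y ^ n * G y)
    (f' := fun y => I * (W z y ^ (n+1) * G y - z * (W z y ^ n * G y) - -((n:ℂ) * W z y ^ (n-1) * G y)))
    ?_ ?_ (int_WG z n)
  · rw [integral_const_mul, integral_sub, integral_sub, integral_const_mul] at key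
    · exact (mul_eq_zero.mp key).resolve_left I_ne_zero
    · exact int_WG z (n+1)
    · exact (int_WG z n).const_mul _
    · exact (int_WG z (n+1)).sub ((int_WG z n).const_mul _)
    · simpa [mul_assoc] using ((int_WG z (n-1)).const_mul (n:ℂ)).neg
  · intro y
    refine (((hasDeriv_W z y).pow n).mul (hasDeriv_G y)).congr_deriv ?_
    simp only [Pi.pow_apply]
    rw [yW z y]
    ring
  · refine Integrable.const_mul ?_ _
    refine ((int_WG z (n+1)).sub ((int_WG z n).const_mul _)).sub ?_
    simpa [mul_assoc] using ((int_WG z (n-1)).const_mul (n:ℂ)).neg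

lemma c_eq (z : ℝ) (n : ℕ) : c z n = ((√(2 * Real.pi) : ℝ) : ℂ) * (H z n : ℂ) ∧
    c z (n+1) = ((√(2 * Real.pi) : ℝ) : ℂ) * (H z (n+1) : ℂ) := by
  induction n with
  | zero =>
    refine ⟨by rw [c_zero]; simp [H], ?_⟩
    have := ibp z 0
    simp [c_zero] at this
    rw [sub_eq_zero] at this
    simp [this, H, mul_comm]
  | succ n ih =>
    refine ⟨ih.2, ?_⟩
    have := ibp z (n+1)
    rw [integral_neg] at this
    simp only [mul_assoc] at this
    rw [integral_const_mul, Nat.add_sub_cancel] at this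
    change _ - _ - -(_ * c z n) = 0 at this
    rw [show n + 1 + 1 = n + 2 from rfl] at *
    rw [H_rec]
    push_cast at *
    rw [ih.1, ih.2] at this
    linear_combination this

noncomputable def M (z x : ℝ) : ℝ := (√(1 - x^2))⁻¹ * Real.exp (z^2 * x / (1 + x))

lemma mehler_int (z x : ℝ) (hx0 : 0 < x) (hx1 : x < 1) :
    HasSum (fun n : ℕ => c z n * c z n * (x:ℂ)^n / n.factorial)
      (∫ p : ℝ × ℝ, cexp (x * W z p.1 * W z p.2) * (G p.1 * G p.2)) := by
  have hcW1 : Continuous fun p : ℝ × ℝ => W z p.1 := (continuous_W z).comp continuous_fst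
  have hcW2 : Continuous fun p : ℝ × ℝ => W z p.2 := (continuous_W z).comp continuous_snd
  have hcG1 : Continuous fun p : ℝ × ℝ => G p.1 := continuous_G.comp continuous_fst
  have hcG2 : Continuous fun p : ℝ × ℝ => G p.2 := continuous_G.comp continuous_snd
  have hr : ∀ p : ℝ × ℝ, HasSum (fun n : ℕ => (x * ‖W z p.1‖ * ‖W z p.2‖)^n / n.factorial * (‖G p.1‖ * ‖G p.2‖))
      (Real.exp (x * ‖W z p.1‖ * ‖W z p.2‖) * (‖G p.1‖ * ‖G p.2‖)) := fun p => by
    refine HasSum.mul_right _ ?_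
    rw [Real.exp_eq_exp_ℝ]
    exact NormedSpace.expSeries_div_hasSum_exp _
  have hC : ∀ n : ℕ, c z n * c z n * (x:ℂ)^n / n.factorial =
      ∫ p : ℝ × ℝ, (x * W z p.1 * W z p.2)^n / n.factorial * (G p.1 * G p.2) := fun n => by
    unfold c
    rw [← integral_prod_mul, mul_div_assoc, ← integral_mul_const]
    congr 1; ext p; ring
  simp_rw [hC]
  refine hasSum_integral_of_dominated_convergence
    (fun n p => (x * ‖W z p.1‖ * ‖W z p.2‖)^n / n.factorial * (‖G p.1‖ * ‖G p.2‖)) ?_ ?_ ?_ ?_ ?_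
  · intro n
    exact Continuous.aestronglyMeasurable (by fun_prop)
  · intro n
    refine Filter.Eventually.of_forall fun p => ?_
    simp [abs_of_pos hx0]
  · exact Filter.Eventually.of_forall fun p => (hr p).summable
  · have h0 := integrable_exp_neg_mul_sq (b := (1-x)/2) (by linarith)
    refine ((h0.mul_prod h0).const_mul (Real.exp (x * z^2))).mono' ?_ ?_
    · simp_rw [fun p => (hr p).tsum_eq]
      exact Continuous.aestronglyMeasurable (by fun_prop)
    · refine Filter.Eventually.of_forall fun p => ?_
      rw [(hr p).tsum_eq, Real.norm_of_nonneg (by positivity), norm_G, norm_G, ← Real.exp_add,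
        ← Real.exp_add, ← Real.exp_add, ← Real.exp_add]
      apply Real.exp_le_exp.mpr
      have h1 := norm_W_sq z p.1
      have h2 := norm_W_sq z p.2
      have h3 : ‖W z p.1‖ * ‖W z p.2‖ ≤ (2*z^2 + p.1^2 + p.2^2)/2 := by
        nlinarith [sq_nonneg (‖W z p.1‖ - ‖W z p.2‖)]
      have := mul_le_mul_of_nonneg_left h3 hx0.le
      nlinarith
  · refine Filter.Eventually.of_forall fun p => ?_
    refine HasSum.mul_right _ ?_
    rw [Complex.exp_eq_exp_ℂ]
    exact NormedSpace.expSeries_div_hasSum_exp _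

lemma mehler_int_integrable (z x : ℝ) (hx0 : 0 < x) (hx1 : x < 1) :
    Integrable (fun p : ℝ × ℝ => cexp (x * W z p.1 * W z p.2) * (G p.1 * G p.2)) := by
  have hcW1 : Continuous fun p : ℝ × ℝ => W z p.1 := (continuous_W z).comp continuous_fst
  have hcW2 : Continuous fun p : ℝ × ℝ => W z p.2 := (continuous_W z).comp continuous_snd
  have hcG1 : Continuous fun p : ℝ × ℝ => G p.1 := continuous_G.comp continuous_fst
  have hcG2 : Continuous fun p : ℝ × ℝ => G p.2 := continuous_G.comp continuous_snd
  have h0 := integrable_exp_neg_mul_sq (b := (1-x)/2) (by linarith)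
  refine ((h0.mul_prod h0).const_mul (Real.exp (x * z^2))).mono' ?_ ?_
  · exact Continuous.aestronglyMeasurable (by fun_prop)
  · refine Filter.Eventually.of_forall fun p => ?_
    rw [norm_mul, norm_mul, norm_G, norm_G, ← Real.exp_add, ← Real.exp_add, ← Real.exp_add]
    have h4 : ‖cexp (x * W z p.1 * W z p.2)‖ ≤ Real.exp (x * ‖W z p.1‖ * ‖W z p.2‖) := by
      rw [Complex.norm_exp]
      apply Real.exp_le_exp.mpr
      refine (Complex.re_le_norm _).trans ?_
      simp [abs_of_pos hx0]
    refine (mul_le_mul_of_nonneg_right h4 (by positivity)).trans ?_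
    rw [← Real.exp_add]
    apply Real.exp_le_exp.mpr
    have h1 := norm_W_sq z p.1
    have h2 := norm_W_sq z p.2
    have h3 : ‖W z p.1‖ * ‖W z p.2‖ ≤ (2*z^2 + p.1^2 + p.2^2)/2 := by
      nlinarith [sq_nonneg (‖W z p.1‖ - ‖W z p.2‖)]
    have := mul_le_mul_of_nonneg_left h3 hx0.le
    nlinarith

lemma mehler_val (z x : ℝ) (hx0 : 0 < x) (hx1 : x < 1) :
    ∫ p : ℝ × ℝ, cexp (x * W z p.1 * W z p.2) * (G p.1 * G p.2) = 2 * Real.pi * M z x := by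
  have hI := mehler_int_integrable z x hx0 hx1
  rw [Measure.volume_eq_prod] at hI ⊢
  rw [integral_prod _ hI]
  have hb : 0 < (1 - x^2)/2 := by nlinarith
  have h1 : ∀ y : ℝ, ∫ y' : ℝ, cexp (x * W z y * W z y') * (G y * G y') =
      ((√(Real.pi / (1/2)) : ℝ) : ℂ) * cexp (-(((1-x^2)/2 : ℝ) : ℂ) * (y:ℂ)^2 + (I * x * z * (1-x)) * y
        + (x*z^2 - x^2*z^2/2)) := fun y => by
    have := gauss (1/2) (by norm_num) (x * W z y * I) (x * W z y * z - (y:ℂ)^2/2)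
    have e : x * W z y * z - (y:ℂ)^2/2 + (x * W z y * I)^2/(4 * ((1/2:ℝ):ℂ)) =
       (-(((1-x^2)/2 : ℝ) : ℂ) * (y:ℂ)^2 + (I * x * z * (1-x)) * y
        + (x*z^2 - x^2*z^2/2)) := by
      unfold W
      push_cast
      ring_nf
      rw [show I^4 = 1 by exact I_pow_four, show I^3 = -I by exact I_pow_three, I_sq]
      ring
    rw [e] at this
    rw [← this]
    congr 1; ext y'
    unfold G
    rw [← Complex.exp_add, ← Complex.exp_add]
    congr 1
    conv_lhs => rw [show W z y' = z + y' * I from rfl]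
    push_cast
    ring
  simp only [h1]
  rw [integral_const_mul, gauss _ hb]
  unfold M
  rw [← mul_assoc, ← Complex.ofReal_mul]
  have e2 : √(Real.pi / (1/2)) * √(Real.pi / ((1 - x^2)/2)) = 2 * Real.pi * (√(1-x^2))⁻¹ := by
    rw [← Real.sqrt_mul (by positivity), ← Real.sqrt_inv,
      show Real.pi / (1/2) * (Real.pi / ((1-x^2)/2)) = (2 * Real.pi)^2 * (1-x^2)⁻¹ by field_simp,
      Real.sqrt_mul (by positivity), Real.sqrt_sq (by positivity)]
  rw [e2]
  push_cast
  rw [mul_assoc (2 * (Real.pi:ℂ))]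
  congr 3
  have h3 : (1:ℂ) + x ≠ 0 := by exact_mod_cast (by linarith : 1 + x ≠ 0)
  have h4 : (1:ℂ) - x ≠ 0 := by exact_mod_cast (by linarith : 1 - x ≠ 0)
  have h5 : (1:ℂ) - x^2 ≠ 0 := by
    rw [show (1:ℂ) - x^2 = (1+x)*(1-x) by ring]; exact mul_ne_zero h3 h4
  simp only [mul_pow, I_sq]
  rw [show (1:ℂ) - x^2 = (1+x)*(1-x) by ring]
  field_simp
  ring

lemma mehler (z x : ℝ) (hx0 : 0 < x) (hx1 : x < 1) :
    HasSum (fun n : ℕ => H z n ^ 2 / n.factorial * x^n) (M z x) := by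
  have h := mehler_int z x hx0 hx1
  rw [mehler_val z x hx0 hx1] at h
  have h2 := h.mul_left ((2 * Real.pi : ℂ)⁻¹)
  have hp : (2 * (Real.pi:ℂ)) ≠ 0 := by simp [Real.pi_ne_zero]
  rw [inv_mul_cancel_left₀ hp] at h2
  rw [← Complex.hasSum_ofReal]
  refine Eq.mp (congrArg (fun g : ℕ → ℂ => HasSum g (M z x : ℂ)) (funext fun n => ?_)) h2
  rw [(c_eq z n).1]
  have : ((√(2 * Real.pi) : ℝ) : ℂ) * ((√(2 * Real.pi) : ℝ) : ℂ) = 2 * Real.pi := by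
    rw [← Complex.ofReal_mul, Real.mul_self_sqrt (by positivity)]; simp
  push_cast
  rw [show ((√(2 * Real.pi) : ℝ) : ℂ) * (H z n:ℂ) * (((√(2 * Real.pi) : ℝ) : ℂ) * (H z n:ℂ)) =
    (2 * Real.pi) * (H z n:ℂ)^2 by rw [← this]; ring]
  field_simp

lemma M_nonneg (z x : ℝ) : 0 ≤ M z x := by unfold M; positivity

lemma measurable_M (z : ℝ) : Measurable (M z) := by unfold M; fun_prop

lemma kernel_int (z : ℝ) (ν : ℂ) (hν : 0 < ν.re) :
    IntegrableOn (fun x : ℝ => (x:ℂ)^(ν-1) * (M z x : ℂ)) (Ioo 0 1) := by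
  have hb := Complex.betaIntegral_convergent (u := ν) (v := 1/2) hν (by norm_num)
  rw [intervalIntegrable_iff_integrableOn_Ioo_of_le zero_le_one] at hb
  refine (hb.norm.const_mul (Real.exp (z^2))).mono' ?_ ?_
  · have := measurable_M z
    exact Measurable.aestronglyMeasurable (by fun_prop)
  · refine (ae_restrict_iff' measurableSet_Ioo).mpr (Filter.Eventually.of_forall fun x hx => ?_)
    obtain ⟨h0, h1⟩ := hx
    rw [norm_mul, norm_mul, mul_left_comm]
    refine mul_le_mul_of_nonneg_left ?_ (norm_nonneg _)
    rw [Complex.norm_real, Real.norm_of_nonneg (M_nonneg z x)]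
    have e : ‖(1 - (x:ℂ))^((1:ℂ)/2 - 1)‖ = (√(1-x))⁻¹ := by
      rw [show (1 - (x:ℂ)) = ((1-x:ℝ):ℂ) by push_cast; rfl,
        Complex.norm_cpow_eq_rpow_re_of_pos (by linarith), Real.sqrt_eq_rpow, ← Real.rpow_neg (by linarith)]
      norm_num
    rw [e, mul_comm]
    unfold M
    have : 0 < √(1-x) := Real.sqrt_pos.mpr (by linarith)
    gcongr
    · nlinarith
    · rw [div_le_iff₀ (by linarith)]
      nlinarith [sq_nonneg z]

lemma int_pow (ν : ℂ) (hν : 0 < ν.re) (n : ℕ) :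
    ∫ x in Ioo (0:ℝ) 1, (x:ℂ)^n * (x:ℂ)^(ν-1) = 1 / ((n:ℂ) + ν) := by
  have h := integral_cpow (a := 0) (b := 1) (r := (n:ℂ) + ν - 1) (Or.inl (by
    simp; have : (0:ℝ) ≤ n := by positivity
    linarith))
  rw [intervalIntegral.integral_of_le zero_le_one, integral_Ioc_eq_integral_Ioo] at h
  have hne : (n:ℂ) + ν ≠ 0 := by
    intro h0
    have := congrArg Complex.re h0
    simp at this
    have : (0:ℝ) ≤ n := by positivity
    linarith
  have e : ∫ x in Ioo (0:ℝ) 1, (x:ℂ)^n * (x:ℂ)^(ν-1) = ∫ x in Ioo (0:ℝ) 1, (x:ℂ)^((n:ℂ)+ν-1) := by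
    refine setIntegral_congr_fun measurableSet_Ioo fun x hx => ?_
    have : (x:ℂ) ≠ 0 := by exact_mod_cast hx.1.ne'
    rw [add_sub_assoc, Complex.cpow_add _ _ this, Complex.cpow_natCast]
  rw [e, h]
  simp [Complex.zero_cpow hne]

lemma series (z : ℝ) (ν : ℂ) (hν : 0 < ν.re) :
    HasSum (fun n : ℕ => (H z n : ℂ)^2 / ((n.factorial : ℂ) * ((n : ℂ) + ν)))
      (∫ x in Ioo (0:ℝ) 1, (x:ℂ)^(ν-1) * (M z x : ℂ)) := by
  have hC : ∀ n : ℕ, (H z n : ℂ)^2 / ((n.factorial : ℂ) * ((n : ℂ) + ν)) =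
      ∫ x in Ioo (0:ℝ) 1, (x:ℂ)^(ν-1) * ((H z n ^ 2 / n.factorial * x^n : ℝ) : ℂ) := fun n => by
    rw [div_mul_eq_div_mul_one_div, ← int_pow ν hν n, ← integral_const_mul]
    congr 1; ext x; push_cast; ring
  have hs : ∀ x ∈ Ioo (0:ℝ) 1, HasSum (fun n : ℕ => ‖(x:ℂ)^(ν-1)‖ * (H z n ^ 2 / n.factorial * x^n))
      (‖(x:ℂ)^(ν-1)‖ * M z x) := fun x hx => (mehler z x hx.1 hx.2).mul_left _
  simp_rw [hC]
  refine hasSum_integral_of_dominated_convergence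
    (fun n x => ‖(x:ℂ)^(ν-1)‖ * (H z n ^ 2 / n.factorial * x^n)) ?_ ?_ ?_ ?_ ?_
  · intro n
    exact Measurable.aestronglyMeasurable (by fun_prop)
  · intro n
    refine (ae_restrict_iff' measurableSet_Ioo).mpr (Filter.Eventually.of_forall fun x hx => ?_)
    have := hx.1
    rw [norm_mul, Complex.norm_real, Real.norm_of_nonneg (by positivity)]
  · refine (ae_restrict_iff' measurableSet_Ioo).mpr (Filter.Eventually.of_forall fun x hx => ?_)
    exact (hs x hx).summable
  · refine (kernel_int z ν hν).norm.congr ?_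
    refine (ae_restrict_iff' measurableSet_Ioo).mpr (Filter.Eventually.of_forall fun x hx => ?_)
    simp only
    rw [(hs x hx).tsum_eq, norm_mul, Complex.norm_real, Real.norm_of_nonneg (M_nonneg z x)]
  · refine (ae_restrict_iff' measurableSet_Ioo).mpr (Filter.Eventually.of_forall fun x hx => ?_)
    exact (Complex.hasSum_ofReal.mpr (mehler z x hx.1 hx.2)).mul_left _

noncomputable def φ (r : ℝ) : ℝ := (1 + 4 * r^2)⁻¹

noncomputable def R (z r : ℝ) : ℝ := 2 * √2 * (√(1 + 2 * r^2))⁻¹ * Real.exp (z^2 / (2 * (1 + 2 * r^2)))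

lemma φ_pos (r : ℝ) : 0 < φ r := by unfold φ; positivity

lemma φ_deriv (r : ℝ) : HasDerivAt φ (-(8 * r) / (1 + 4 * r^2)^2) r := by
  have h : HasDerivAt (fun r : ℝ => 1 + 4 * r^2) (8 * r) r := by
    refine (((hasDerivAt_id r).pow 2).const_mul 4 |>.const_add 1).congr_deriv ?_
    simp; ring
  exact h.inv (by positivity)

lemma φ_inj : InjOn φ (Ioi 0) := by
  intro a ha b hb hab
  unfold φ at hab
  have h := inv_injective hab
  simp only [mem_Ioi] at ha hb
  nlinarith

lemma φ_image : φ '' Ioi 0 = Ioo 0 1 := by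
  ext x
  constructor
  · rintro ⟨r, hr, rfl⟩
    simp only [mem_Ioi] at hr
    refine ⟨φ_pos r, ?_⟩
    unfold φ
    apply inv_lt_one_of_one_lt₀
    nlinarith
  · rintro ⟨h0, h1⟩
    have : 0 < (1 - x) / (4 * x) := by apply div_pos <;> linarith
    refine ⟨√((1-x)/(4*x)), Real.sqrt_pos.mpr this, ?_⟩
    unfold φ
    rw [Real.sq_sqrt this.le]
    field_simp
    ring

lemma φ_M (z r : ℝ) (hr : 0 < r) : |-(8 * r) / (1 + 4 * r^2)^2| * M z (φ r) = φ r * R z r := by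
  have h1 : |-(8 * r) / (1 + 4 * r^2)^2| = 8 * r * φ r ^ 2 := by
    rw [neg_div, abs_neg, abs_of_pos (by positivity)]; unfold φ; field_simp
  have h2 : √(1 - φ r ^2) = φ r * r * (2 * √2 * √(1 + 2 * r^2)) := by
    have : 1 - φ r ^2 = (φ r * r * 2)^2 * (2 * (1 + 2 * r^2)) := by
      unfold φ; field_simp; ring
    rw [this, Real.sqrt_mul (by positivity), Real.sqrt_sq (by have := φ_pos r; positivity),
      Real.sqrt_mul (by norm_num)]
    ring
  have h3 : z^2 * φ r / (1 + φ r) = z^2 / (2 * (1 + 2 * r^2)) := by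
    unfold φ; field_simp; ring
  rw [h1]
  unfold M R
  rw [h2, h3]
  have := φ_pos r
  have h4 : √2 * √2 = 2 := Real.mul_self_sqrt (by norm_num)
  have h5 : 0 < √(1 + 2 * r^2) := by positivity
  field_simp
  nlinarith

lemma subst_eq (z : ℝ) (ν : ℂ) (r : ℝ) (hr : r ∈ Ioi (0:ℝ)) :
    |-(8 * r) / (1 + 4 * r^2)^2| • (((φ r : ℝ) : ℂ)^(ν-1) * (M z (φ r) : ℂ)) =
      (φ r : ℂ)^ν * (R z r : ℂ) := by
  have h := φ_M z r hr
  have hne : (φ r : ℂ) ≠ 0 := by exact_mod_cast (φ_pos r).ne'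
  rw [Complex.real_smul, mul_left_comm, ← Complex.ofReal_mul, h, Complex.cpow_sub _ _ hne]
  push_cast
  rw [Complex.cpow_one]
  field_simp

lemma subst_int (z : ℝ) (ν : ℂ) :
    ∫ x in Ioo (0:ℝ) 1, (x:ℂ)^(ν-1) * (M z x : ℂ) = ∫ r in Ioi (0:ℝ), (φ r : ℂ)^ν * (R z r : ℂ) := by
  rw [← φ_image, integral_image_eq_integral_abs_deriv_smul measurableSet_Ioi
    (fun r _ => (φ_deriv r).hasDerivWithinAt) φ_inj]
  exact setIntegral_congr_fun measurableSet_Ioi fun r hr => subst_eq z ν r hr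

lemma subst_integrable (z : ℝ) (ν : ℂ) (hν : 0 < ν.re) :
    IntegrableOn (fun r : ℝ => (φ r : ℂ)^ν * (R z r : ℂ)) (Ioi 0) := by
  have h := kernel_int z ν hν
  rw [← φ_image, integrableOn_image_iff_integrableOn_abs_deriv_smul measurableSet_Ioi
    (fun r _ => (φ_deriv r).hasDerivWithinAt) φ_inj] at h
  exact h.congr_fun (fun r hr => subst_eq z ν r hr) measurableSet_Ioi

noncomputable def L (z : ℝ) (ν : ℂ) (r : ℝ) (p : ℝ × ℝ) : ℂ :=
  ((p.1:ℂ)^(ν-1) * cexp (-(((1 + 4 * r^2 : ℝ) : ℂ) * (p.1:ℂ)))) *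
    cexp (-(((1/2 + r^2 : ℝ)) : ℂ) * (p.2:ℂ)^2 + z * p.2 + 0)

lemma L_fac1 (ν : ℂ) (hν : 0 < ν.re) (a : ℝ) (ha : 1 ≤ a) :
    IntegrableOn (fun q : ℝ => (q:ℂ)^(ν-1) * cexp (-((a:ℂ) * (q:ℂ)))) (Ioi 0) := by
  refine Integrable.mono (Complex.GammaIntegral_convergent hν) ?_ ?_
  · exact Measurable.aestronglyMeasurable (by fun_prop)
  · refine (ae_restrict_iff' measurableSet_Ioi).mpr (Filter.Eventually.of_forall fun q hq => ?_)
    simp only [mem_Ioi] at hq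
    rw [norm_mul, norm_mul, mul_comm]
    gcongr
    rw [← Complex.ofReal_mul, ← Complex.ofReal_neg, ← Complex.ofReal_exp, Complex.norm_real, Complex.norm_real,
      Real.norm_of_nonneg (by positivity), Real.norm_of_nonneg (by positivity)]
    apply Real.exp_le_exp.mpr
    nlinarith

lemma L_integrable_slice (z : ℝ) (ν : ℂ) (hν : 0 < ν.re) (r : ℝ) :
    Integrable (L z ν r) ((volume.restrict (Ioi 0)).prod volume) := by
  unfold L
  have h2 : Integrable (fun u : ℝ => cexp (-(((1/2 + r^2 : ℝ)) : ℂ) * (u:ℂ)^2 + z * u + 0)) := by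
    refine integrable_cexp_quadratic ?_ _ _
    rw [Complex.ofReal_re]; positivity
  exact Integrable.mul_prod (L_fac1 ν hν (1 + 4 * r^2) (by nlinarith [sq_nonneg r])) h2

lemma L_integral_slice (z : ℝ) (ν : ℂ) (hν : 0 < ν.re) (r : ℝ) :
    ∫ p, L z ν r p ∂((volume.restrict (Ioi 0)).prod volume) =
      ((√Real.pi / 2 : ℝ) : ℂ) * Complex.Gamma ν * ((φ r : ℂ)^ν * (R z r : ℂ)) := by
  unfold L
  rw [integral_prod_mul (f := fun q : ℝ => (q:ℂ)^(ν-1) * cexp (-(((1 + 4 * r^2 : ℝ) : ℂ) * (q:ℂ))))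
    (g := fun u : ℝ => cexp (-(((1/2 + r^2 : ℝ)) : ℂ) * (u:ℂ)^2 + z * u + 0)),
    gauss _ (by positivity), Complex.integral_cpow_mul_exp_neg_mul_Ioi hν (by positivity)]
  have h1 : (1 / ((1 + 4 * r^2 : ℝ) : ℂ)) = (φ r : ℂ) := by unfold φ; push_cast; simp
  have h2 : √(Real.pi / (1/2 + r^2)) = √Real.pi / 2 * (2 * √2 * (√(1 + 2 * r^2))⁻¹) := by
    rw [show Real.pi / (1/2 + r^2) = Real.pi * (2 * (1 + 2 * r^2)⁻¹) by field_simp,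
      Real.sqrt_mul (by positivity), Real.sqrt_mul (by norm_num), Real.sqrt_inv]
    ring
  have h3 : (0:ℂ) + (z:ℂ)^2 / (4 * ((1/2 + r^2 : ℝ) : ℂ)) = ((z^2 / (2 * (1 + 2 * r^2)) : ℝ) : ℂ) := by
    rw [zero_add, show 2 * (1 + 2 * r^2) = 4 * (1/2 + r^2) by ring]
    push_cast; rfl
  rw [h1, h2, h3]
  unfold R
  push_cast
  ring

lemma L_norm (z : ℝ) (ν : ℂ) (r : ℝ) (p : ℝ × ℝ) (hp : 0 < p.1) :
    ((‖L z ν r p‖ : ℝ) : ℂ) = L z (ν.re : ℂ) r p := by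
  unfold L
  rw [norm_mul, norm_mul, Complex.norm_cpow_eq_rpow_re_of_pos hp, Complex.norm_exp, Complex.norm_exp]
  rw [show (-(((1 + 4 * r^2 : ℝ) : ℂ) * (p.1:ℂ))) = ((-((1 + 4 * r^2) * p.1) : ℝ) : ℂ) by push_cast; rfl,
    show (-(((1/2 + r^2 : ℝ)) : ℂ) * (p.2:ℂ)^2 + z * p.2 + 0) = ((-(1/2 + r^2) * p.2^2 + z * p.2 : ℝ) : ℂ) by
      push_cast; ring, Complex.ofReal_re, Complex.ofReal_re]
  push_cast
  rw [Complex.ofReal_cpow hp.le]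
  simp

lemma L_integrable (z : ℝ) (ν : ℂ) (hν : 0 < ν.re) :
    Integrable (Function.uncurry (L z ν))
      ((volume.restrict (Ioi 0)).prod ((volume.restrict (Ioi (0:ℝ))).prod volume)) := by
  rw [integrable_prod_iff]
  · refine ⟨Filter.Eventually.of_forall fun r => L_integrable_slice z ν hν r, ?_⟩
    have h := ((subst_integrable z (ν.re:ℂ) (by simpa using hν)).const_mul
      (((√Real.pi / 2 : ℝ) : ℂ) * Complex.Gamma (ν.re:ℂ))).re
    refine h.congr (Filter.Eventually.of_forall fun r => ?_)
    simp only
    rw [← L_integral_slice z (ν.re:ℂ) (by simpa using hν) r]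
    have : ∫ p, L z (ν.re:ℂ) r p ∂((volume.restrict (Ioi 0)).prod volume) =
        ∫ p, ((‖L z ν r p‖ : ℝ) : ℂ) ∂((volume.restrict (Ioi 0)).prod volume) := by
      refine integral_congr_ae ?_
      have h0 : ∀ᵐ q ∂(volume.restrict (Ioi (0:ℝ))), 0 < q := ae_restrict_mem measurableSet_Ioi
      filter_upwards [Measure.quasiMeasurePreserving_fst.ae h0] with p hp
      exact (L_norm z ν r p hp).symm
    rw [this, integral_complex_ofReal]
    simp [Function.uncurry]
  · refine Measurable.aestronglyMeasurable ?_
    unfold L Function.uncurry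
    fun_prop

noncomputable def P (z : ℝ) (ν : ℂ) (p : ℝ × ℝ) : ℂ :=
  ((p.1:ℂ)^(ν-1) * cexp (-(p.1:ℂ))) * (cexp (z * p.2 - (p.2:ℂ)^2/2) * (((√(p.2^2 + 4 * p.1))⁻¹ : ℝ) : ℂ))

lemma L_r (z : ℝ) (ν : ℂ) (p : ℝ × ℝ) :
    ∫ r in Ioi (0:ℝ), L z ν r p = ((√Real.pi / 2 : ℝ) : ℂ) * P z ν p := by
  have h := integral_gaussian_Ioi (p.2^2 + 4 * p.1)
  have e : ∀ r : ℝ, L z ν r p = (((p.1:ℂ)^(ν-1) * cexp (-(p.1:ℂ))) * cexp (z * p.2 - (p.2:ℂ)^2/2)) *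
      ((Real.exp (-(p.2^2 + 4 * p.1) * r^2) : ℝ) : ℂ) := fun r => by
    unfold L
    push_cast
    simp only [mul_assoc]
    simp only [← Complex.exp_add]
    congr 2
    ring
  simp_rw [e]
  rw [integral_const_mul, integral_complex_ofReal, h]
  unfold P
  rw [Real.sqrt_div Real.pi_pos.le]
  push_cast
  ring

lemma step_rhs (z : ℝ) (ν : ℂ) (hν : 0 < ν.re) :
    ∫ q in Ioi (0:ℝ), ∫ u : ℝ, P z ν (q, u) =
      Complex.Gamma ν * ∫ r in Ioi (0:ℝ), (φ r : ℂ)^ν * (R z r : ℂ) := by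
  have hL := L_integrable z ν hν
  have hsw := integral_integral_swap hL
  simp_rw [L_integral_slice z ν hν, L_r] at hsw
  have hP := hL.integral_prod_right
  simp only [Function.uncurry, L_r] at hP
  rw [integral_prod _ hP] at hsw
  simp_rw [integral_const_mul] at hsw
  have hne : ((√Real.pi / 2 : ℝ) : ℂ) ≠ 0 := by
    have : 0 < √Real.pi / 2 := by positivity
    exact_mod_cast this.ne'
  rw [mul_assoc] at hsw
  exact (mul_left_cancel₀ hne hsw).symm

noncomputable def f (w : ℝ) (ν : ℂ) (t : ℝ) : ℂ := cexp ((w:ℂ) * t - (t:ℂ)^2/2) * (t:ℂ)^(ν-1)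

lemma measurable_f (w : ℝ) (ν : ℂ) : Measurable (f w ν) := by unfold f; fun_prop

lemma f_int (w : ℝ) (ν : ℂ) (hν : 0 < ν.re) : IntegrableOn (f w ν) (Ioi 0) := by
  have h := (integrableOn_rpow_mul_exp_neg_mul_sq (b := 1/4) (by norm_num) (s := ν.re - 1)
    (by linarith)).const_mul (Real.exp (w^2))
  refine h.mono' (measurable_f w ν).aestronglyMeasurable ?_
  refine (ae_restrict_iff' measurableSet_Ioi).mpr (Filter.Eventually.of_forall fun t ht => ?_)
  simp only [mem_Ioi] at ht
  unfold f
  rw [norm_mul, Complex.norm_cpow_eq_rpow_re_of_pos ht, Complex.norm_exp,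
    show (w:ℂ) * t - (t:ℂ)^2/2 = ((w * t - t^2/2 : ℝ) : ℂ) by push_cast; rfl, Complex.ofReal_re,
    Complex.sub_re, Complex.one_re, mul_left_comm, ← Real.exp_add, mul_comm]
  gcongr
  nlinarith [sq_nonneg (w - t/2)]

noncomputable def K (z : ℝ) (ν : ℂ) (s q : ℝ) : ℂ := (f (-z) ν s * ((s⁻¹:ℝ):ℂ)) * f z ν (s⁻¹ * q)

lemma K_slice (z : ℝ) (ν : ℂ) (s : ℝ) (hs : 0 < s) :
    ∫ q in Ioi (0:ℝ), K z ν s q = f (-z) ν s * ∫ t in Ioi (0:ℝ), f z ν t := by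
  unfold K
  rw [integral_const_mul, integral_comp_mul_left_Ioi _ _ (inv_pos.mpr hs)]
  have : (s:ℂ) ≠ 0 := by exact_mod_cast hs.ne'
  simp
  field_simp

lemma K_slice_norm (z : ℝ) (ν : ℂ) (s : ℝ) (hs : 0 < s) :
    ∫ q in Ioi (0:ℝ), ‖K z ν s q‖ = ‖f (-z) ν s‖ * ∫ t in Ioi (0:ℝ), ‖f z ν t‖ := by
  unfold K
  simp_rw [norm_mul]
  rw [integral_const_mul, integral_comp_mul_left_Ioi (fun t => ‖f z ν t‖) _ (inv_pos.mpr hs)]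
  simp [abs_of_pos hs]
  field_simp

lemma K_integrable (z : ℝ) (ν : ℂ) (hν : 0 < ν.re) :
    Integrable (Function.uncurry (K z ν)) ((volume.restrict (Ioi 0)).prod (volume.restrict (Ioi (0:ℝ)))) := by
  rw [integrable_prod_iff]
  · constructor
    · refine (ae_restrict_iff' measurableSet_Ioi).mpr (Filter.Eventually.of_forall fun s hs => ?_)
      refine Integrable.const_mul (f := fun q => f z ν (s⁻¹ * q)) ?_ (f (-z) ν s * ((s⁻¹:ℝ):ℂ))
      refine (integrableOn_Ioi_comp_mul_left_iff (f z ν) 0 (inv_pos.mpr hs)).mpr ?_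
      simpa using f_int z ν hν
    · refine ((f_int (-z) ν hν).norm.mul_const (∫ t in Ioi (0:ℝ), ‖f z ν t‖)).congr ?_
      refine (ae_restrict_iff' measurableSet_Ioi).mpr (Filter.Eventually.of_forall fun s hs => ?_)
      exact (K_slice_norm z ν s hs).symm
  · refine Measurable.aestronglyMeasurable ?_
    have h1 := measurable_f (-z) ν
    have h2 := measurable_f z ν
    unfold K Function.uncurry
    fun_prop

lemma step_lhs (z : ℝ) (ν : ℂ) (hν : 0 < ν.re) :
    (∫ t in Ioi (0:ℝ), f (-z) ν t) * (∫ t in Ioi (0:ℝ), f z ν t) =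
      ∫ q in Ioi (0:ℝ), ∫ s in Ioi (0:ℝ), K z ν s q := by
  rw [← integral_integral_swap (K_integrable z ν hν), ← integral_mul_const]
  exact (setIntegral_congr_fun measurableSet_Ioi fun s hs => K_slice z ν s hs).symm

lemma ψ_image (q : ℝ) (hq : 0 < q) : (fun s : ℝ => q / s - s) '' Ioi 0 = univ := by
  refine eq_univ_of_forall fun u => ?_
  have h1 : 0 ≤ u^2 + 4 * q := by positivity
  have h2 := Real.sq_sqrt h1
  have h3 : |u| < √(u^2 + 4 * q) := by
    rw [← Real.sqrt_sq_eq_abs]; exact Real.sqrt_lt_sqrt (sq_nonneg u) (by linarith)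
  have h4 : 0 < (-u + √(u^2 + 4 * q))/2 := by linarith [le_abs_self u]
  refine ⟨_, h4, ?_⟩
  simp only
  rw [sub_eq_iff_eq_add, div_eq_iff h4.ne']
  nlinarith

lemma ψ_inj (q : ℝ) (hq : 0 < q) : InjOn (fun s : ℝ => q / s - s) (Ioi 0) := by
  intro a ha b hb hab
  simp only [mem_Ioi] at ha hb hab
  field_simp at hab
  have : (a - b) * (q + a * b) = 0 := by linear_combination -hab
  rcases mul_eq_zero.mp this with h | h
  · linarith
  · have : 0 < q + a * b := by positivity
    linarith

lemma step_mid (z : ℝ) (ν : ℂ) (q : ℝ) (hq : 0 < q) :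
    ∫ u : ℝ, P z ν (q, u) = ∫ s in Ioi (0:ℝ), K z ν s q := by
  rw [← setIntegral_univ, ← ψ_image q hq,
    integral_image_eq_integral_abs_deriv_smul (f' := fun s => -q / s^2 - 1) measurableSet_Ioi
    (fun s hs => ?_) (ψ_inj q hq)]
  · refine setIntegral_congr_fun measurableSet_Ioi fun s hs => ?_
    simp only [mem_Ioi] at hs
    have h1 : √((q / s - s)^2 + 4 * q) = q / s + s := by
      rw [show (q / s - s)^2 + 4 * q = (q / s + s)^2 by field_simp; ring, Real.sqrt_sq (by positivity)]
    have h2 : |-q / s^2 - 1| = q / s^2 + 1 := by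
      rw [show -q / s^2 - 1 = -(q / s^2 + 1) by ring, abs_neg, abs_of_pos (by positivity)]
    have h3 : (q / s^2 + 1) * (q / s + s)⁻¹ = s⁻¹ := by
      have : 0 < q / s + s := by positivity
      field_simp
    have h4 : (q:ℂ)^(ν-1) = (s:ℂ)^(ν-1) * ((s⁻¹ * q : ℝ) : ℂ)^(ν-1) := by
      rw [← Complex.mul_cpow_ofReal_nonneg hs.le (by positivity), ← Complex.ofReal_mul,
        mul_inv_cancel_left₀ hs.ne']
    have hs' : (s:ℂ) ≠ 0 := by exact_mod_cast hs.ne'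
    have h5 : cexp (-(q:ℂ)) * cexp (z * ((q/s - s : ℝ):ℂ) - ((q/s - s : ℝ):ℂ)^2/2) =
      cexp (((-z:ℝ):ℂ) * s - (s:ℂ)^2/2) * cexp ((z:ℂ) * ((s⁻¹ * q : ℝ):ℂ) - ((s⁻¹ * q : ℝ):ℂ)^2/2) := by
      rw [← Complex.exp_add, ← Complex.exp_add]
      congr 1
      push_cast
      field_simp
      ring
    unfold P K f
    simp only
    have h6 : ((q / s^2 + 1 : ℝ):ℂ) * (((q / s + s)⁻¹ : ℝ):ℂ) = ((s⁻¹ : ℝ) : ℂ) := by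
      rw [← Complex.ofReal_mul, h3]
    rw [h1, h2, h4, Complex.real_smul, ← h6]
    linear_combination ((s:ℂ)^(ν-1) * ((s⁻¹ * q : ℝ) : ℂ)^(ν-1) * ((q / s^2 + 1 : ℝ):ℂ) *
      (((q / s + s)⁻¹ : ℝ):ℂ)) * h5
  · simp only [mem_Ioi] at hs
    have := ((hasDerivAt_inv hs.ne').const_mul q).sub (hasDerivAt_id s)
    refine HasDerivAt.hasDerivWithinAt ?_
    refine this.congr_deriv ?_
    field_simp

end PCH

/-- Series expansion (61) for `D₋ν(z) D₋ν(-z) = (1/Γ(ν)) ∑ₙ Dₙ(z)²/(n!(n+ν))`, written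
using the Laplace-integral representation of `D₋ν(±z)` and `Dₙ(z) = e^(-z²/4) Heₙ(z)`
where `Heₙ` is the probabilists' Hermite polynomial. -/
theorem product_parabolic_cylinder_hermite_series
    (z : ℝ) (ν : ℂ) (hν : 0 < ν.re) :
    Summable (fun n : ℕ =>
      (((Polynomial.aeval z) (Polynomial.hermite n) : ℝ) : ℂ)^2 /
        ((n.factorial : ℂ) * ((n : ℂ) + ν))) ∧
    (∫ t in Ioi (0:ℝ), Complex.exp (-(z:ℂ) * t - (t:ℂ)^2 / 2) * (t:ℂ) ^ (ν - 1)) *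
      (∫ t in Ioi (0:ℝ), Complex.exp ((z:ℂ) * t - (t:ℂ)^2 / 2) * (t:ℂ) ^ (ν - 1)) =
    Complex.Gamma ν *
      ∑' n : ℕ, (((Polynomial.aeval z) (Polynomial.hermite n) : ℝ) : ℂ)^2 /
        ((n.factorial : ℂ) * ((n : ℂ) + ν)) := by
  have hs := PCH.series z ν hν
  refine ⟨hs.summable, ?_⟩
  have hs2 := hs.tsum_eq
  have h1 := PCH.step_lhs z ν hν
  rw [← setIntegral_congr_fun measurableSet_Ioi fun q hq => PCH.step_mid z ν q hq,
    PCH.step_rhs z ν hν, ← PCH.subst_int, ← hs2] at h1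
  unfold PCH.f PCH.H at h1
  push_cast at h1
  exact h1
end
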